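/- Let f ∈ ℚ[x] be a square-free polynomial whose degree is a positive multiple of 4 and which satisfies f(t) > 0 for all t ∈ ℝ. Then either f is itself a sum of four squares in ℚ[x], or there exists ℓ ∈ ℕ such that f(x) − 2^{−2ℓ} is a sum of four squares in ℚ[x]. In particular, f is a sum of five squares of polynomials in ℚ[x]. -/

import Mathlib

set_option linter.all false

section
open Module

namespace FiveSq

/-- endomorphism `2 •` -/
abbrev dbl (A : Type*) [AddCommGroup A] : A →+ A := zsmulAddGroupHom (2 : ℤ)

lemma dbl_index_finite (A : Type*) [AddCommGroup A] [Finite A] :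
    (dbl A).range.index = Nat.card (dbl A).ker := by
  have h1 := AddSubgroup.card_mul_index (dbl A).range
  have h2 := AddSubgroup.card_mul_index (dbl A).ker
  rw [AddSubgroup.index_ker] at h2
  have h3 : 0 < Nat.card (dbl A).range := Nat.card_pos
  rw [← h2, mul_comm] at h1
  exact Nat.eq_of_mul_eq_mul_right h3 h1

lemma dbl_index_free (ι : Type*) [Fintype ι] :
    (dbl (ι → ℤ)).range.index = 2 ^ Fintype.card ι := by
  let φ : (ι → ℤ) →+ (ι → ZMod 2) := AddMonoidHom.compLeft (Int.castAddHom (ZMod 2)) ι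
  have hk : (dbl (ι → ℤ)).range = φ.ker := by
    ext x
    constructor
    · rintro ⟨y, rfl⟩
      rw [AddMonoidHom.mem_ker]
      funext i
      simp [φ, AddMonoidHom.compLeft]
      left; decide
    · intro hx
      rw [AddMonoidHom.mem_ker] at hx
      have : ∀ i, ∃ y, x i = 2 * y := fun i => by
        have := congrFun hx i
        simp [φ, AddMonoidHom.compLeft] at this
        exact (ZMod.intCast_zmod_eq_zero_iff_dvd (x i) 2).1 this
      choose y hy using this
      exact ⟨y, by funext i; simp [hy]⟩
  rw [hk, AddSubgroup.index_ker]
  have : φ.range = ⊤ := by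
    rw [AddMonoidHom.range_eq_top]
    intro y
    choose z hz using fun i => ZMod.intCast_surjective (y i)
    exact ⟨z, by funext i; simpa [φ] using hz i⟩
  rw [this, AddSubgroup.card_top]
  classical
  rw [Nat.card_eq_fintype_card, Fintype.card_fun, ZMod.card]

lemma dbl_index_congr {A B : Type*} [AddCommGroup A] [AddCommGroup B] (e : A ≃+ B) :
    (dbl A).range.index = (dbl B).range.index := by
  have : (dbl A).range = (dbl B).range.comap e.toAddMonoidHom := by
    ext x
    constructor
    · rintro ⟨y, rfl⟩
      exact ⟨e y, by simp⟩
    · rintro ⟨y, hy⟩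
      refine ⟨e.symm y, ?_⟩
      apply e.injective
      simpa using hy
  rw [this, AddSubgroup.index_comap_of_surjective _ e.surjective]

lemma rank_nullity {A B : Type*} [AddCommGroup A] [AddCommGroup B] [Module.Finite ℤ A]
    (φ : A →ₗ[ℤ] B) : finrank ℤ (LinearMap.range φ) + finrank ℤ (LinearMap.ker φ) = finrank ℤ A := by
  rw [← Submodule.finrank_quotient_add_finrank (LinearMap.ker φ),
    LinearEquiv.finrank_eq φ.quotKerEquivRange]

lemma dbl_index (A : Type*) [AddCommGroup A] [Module.Finite ℤ A] :
    (dbl A).range.index = 2 ^ finrank ℤ A * Nat.card (dbl A).ker := by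
  haveI : AddGroup.FG A := Module.Finite.iff_addGroup_fg.mp inferInstance
  obtain ⟨n, ι, _, p, hp, e, ⟨f⟩⟩ := AddCommGroup.equiv_free_prod_directSum_zmod A
  haveI : ∀ i, NeZero (p i ^ e i) := fun i => ⟨pow_ne_zero _ (hp i).ne_zero⟩
  set D := DirectSum ι (fun i => ZMod (p i ^ e i))
  haveI : Finite D := Finite.of_equiv _ (DirectSum.addEquivProd (fun i => ZMod (p i ^ e i))).symm.toEquiv
  let g : A ≃+ (Fin n → ℤ) × D := f.trans (AddEquiv.prodCongr Finsupp.addEquivFunOnFinite (AddEquiv.refl _))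
  have hr : finrank ℤ A = n := by
    rw [LinearEquiv.finrank_eq g.toIntLinearEquiv]
    have h : finrank ℤ ((Fin n → ℤ) × D) = finrank ℤ (Fin n → ℤ) := by
      let π : ((Fin n → ℤ) × D) →ₗ[ℤ] (Fin n → ℤ) := LinearMap.fst ℤ _ _
      have h1 := rank_nullity π
      have h2 : finrank ℤ (LinearMap.ker π) = 0 := by
        rw [Module.finrank_eq_zero_iff]
        rintro ⟨⟨a, b⟩, hab⟩
        refine ⟨Nat.card D, by exact_mod_cast (Nat.card_pos (α := D)).ne', ?_⟩
        ext1
        simp only [LinearMap.mem_ker, π, LinearMap.fst_apply] at hab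
        subst hab
        have hb : Nat.card D • b = 0 := card_nsmul_eq_zero'
        simp only [natCast_zsmul]
        exact Prod.ext (by simp) hb
      have h3 : LinearMap.range π = ⊤ := LinearMap.range_eq_top.2 (fun x => ⟨(x, 0), rfl⟩)
      rw [h3, h2, finrank_top] at h1
      omega
    rw [h]; simp
  rw [dbl_index_congr g, hr]
  have h1 : (dbl ((Fin n → ℤ) × D)).range = (dbl (Fin n → ℤ)).range.prod (dbl D).range := by
    ext ⟨x, y⟩
    constructor
    · rintro ⟨⟨a, b⟩, h⟩
      rw [Prod.ext_iff] at h
      exact ⟨⟨a, h.1⟩, ⟨b, h.2⟩⟩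
    · rintro ⟨⟨a, ha⟩, ⟨b, hb⟩⟩
      exact ⟨(a, b), Prod.ext ha hb⟩
  rw [h1, AddSubgroup.index_prod, dbl_index_free, dbl_index_finite, Fintype.card_fin]
  congr 1
  refine Nat.card_congr (Equiv.symm ?_)
  refine Equiv.ofBijective (fun a : (dbl A).ker => (⟨(g a).2, ?_⟩ : (dbl D).ker)) ⟨?_, ?_⟩
  · have : (2 : ℤ) • (a : A) = 0 := a.2
    have h2 := congrArg (fun x => (g x).2) this
    simpa using h2
  · rintro ⟨a, ha⟩ ⟨b, hb⟩ hab
    have hz : ∀ a : A, a ∈ (dbl A).ker → (g a).1 = 0 := by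
      intro a ha
      have : (2 : ℤ) • (a : A) = 0 := ha
      have h2 := congrArg (fun x => (g x).1) this
      funext i
      have h3 := congrFun h2 i
      simpa using h3
    ext1
    apply g.injective
    refine Prod.ext ?_ ?_
    · change (g a).1 = (g b).1
      rw [hz a ha, hz b hb]
    · simpa using hab
  · rintro ⟨b, hb⟩
    refine ⟨⟨g.symm (0, b), ?_⟩, by simp⟩
    rw [AddMonoidHom.mem_ker] at hb ⊢
    apply g.injective
    change (2:ℤ) • b = 0 at hb
    change g ((2:ℤ) • g.symm (0, b)) = g 0
    rw [map_zsmul]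
    simp [hb]

/-- multiplicative version -/
lemma sq_index (G : Type*) [CommGroup G] [Module.Finite ℤ (Additive G)] :
    (powMonoidHom 2 : G →* G).range.index
      = 2 ^ finrank ℤ (Additive G) * Nat.card {g : G // g ^ 2 = 1} := by
  have h := dbl_index (Additive G)
  have h1 : (powMonoidHom 2 : G →* G).range.index = (dbl (Additive G)).range.index := by
    rw [← Subgroup.index_toAddSubgroup]
    congr 1
    ext x
    constructor
    · rintro ⟨y, hy⟩
      refine ⟨Additive.ofMul y, ?_⟩
      apply Additive.toMul.injective
      rw [← hy]
      change (y ^ (2 : ℤ)) = y ^ 2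
      exact zpow_ofNat y 2
    · rintro ⟨y, hy⟩
      refine ⟨Additive.toMul y, ?_⟩
      have := congrArg Additive.toMul hy
      change (Additive.toMul y) ^ (2 : ℤ) = _ at this
      rw [← this]
      exact (zpow_ofNat _ 2).symm
  rw [h1, h]
  congr 1
  refine Nat.card_congr (Additive.toMul.subtypeEquiv fun a => ?_)
  change (2 : ℤ) • a = 0 ↔ _
  rw [← zpow_ofNat]
  rfl

/-- rank of the image of a map to `ι → ℤ` with diagonal preimages -/
lemma finrank_range_of_diag {A ι : Type*} [AddCommGroup A] [Fintype ι] [DecidableEq ι]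
    (φ : A →ₗ[ℤ] (ι → ℤ)) (a : ι → A) (h0 : ∀ i, φ (a i) i ≠ 0)
    (h1 : ∀ i j, i ≠ j → φ (a i) j = 0) : finrank ℤ (LinearMap.range φ) = Fintype.card ι := by
  apply le_antisymm
  · simpa using Submodule.finrank_le (LinearMap.range φ)
  · have li : LinearIndependent ℤ (fun i => (⟨φ (a i), ⟨a i, rfl⟩⟩ : LinearMap.range φ)) := by
      rw [Fintype.linearIndependent_iff]
      intro g hg i
      have := congrArg (fun x : LinearMap.range φ => (x : ι → ℤ) i) hg
      simp only [Submodule.coe_sum, Submodule.coe_smul, Finset.sum_apply, Pi.smul_apply, smul_eq_mul, Submodule.coe_zero, Pi.zero_apply] at this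
      rw [Finset.sum_eq_single i] at this
      · exact (mul_eq_zero.1 this).resolve_right (h0 i)
      · intro j _ hj
        rw [h1 j i hj, mul_zero]
      · simp
    exact li.fintype_card_le_finrank

end FiveSq

end

section
open Module NumberField IsDedekindDomain

namespace FiveSq

section ord
variable {K : Type*} [Field K] [NumberField K]

/-- places -/
abbrev Pl (K : Type*) [Field K] [NumberField K] := HeightOneSpectrum (𝓞 K)

/-- additive valuation, junk value `0` at `0` -/
noncomputable def ord (v : Pl K) (x : K) : ℤ := - WithZero.log (v.valuation K x)

variable (v : Pl K)

lemma coe_ne {a : 𝓞 K} (ha : a ≠ 0) : algebraMap (𝓞 K) K a ≠ 0 :=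
  fun h => ha ((map_eq_zero_iff _ (IsFractionRing.injective (𝓞 K) K)).1 h)

lemma val_ne_zero {x : K} (hx : x ≠ 0) : v.valuation K x ≠ 0 := (Valuation.ne_zero_iff _).2 hx

lemma ord_mul {x y : K} (hx : x ≠ 0) (hy : y ≠ 0) : ord v (x * y) = ord v x + ord v y := by
  unfold ord
  rw [map_mul, WithZero.log_mul (val_ne_zero v hx) (val_ne_zero v hy)]; ring

@[simp] lemma ord_one : ord v (1 : K) = 0 := by simp [ord]
@[simp] lemma ord_zero : ord v (0 : K) = 0 := by simp [ord]
@[simp] lemma ord_neg (x : K) : ord v (-x) = ord v x := by simp [ord, Valuation.map_neg]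
lemma ord_inv (x : K) : ord v x⁻¹ = - ord v x := by
  unfold ord; rw [map_inv₀, WithZero.log_inv]
lemma ord_div {x y : K} (hx : x ≠ 0) (hy : y ≠ 0) : ord v (x / y) = ord v x - ord v y := by
  rw [div_eq_mul_inv, ord_mul v hx (inv_ne_zero hy), ord_inv]; ring
lemma ord_pow (x : K) (n : ℕ) : ord v (x ^ n) = n * ord v x := by
  unfold ord; rw [map_pow, WithZero.log_pow]; simp

lemma ord_prod {ι : Type*} (s : Finset ι) (f : ι → K) (hf : ∀ i ∈ s, f i ≠ 0) :
    ord v (∏ i ∈ s, f i) = ∑ i ∈ s, ord v (f i) := by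
  classical
  induction s using Finset.induction_on with
  | empty => simp
  | insert a s ha ih =>
    rw [Finset.prod_insert ha, Finset.sum_insert ha, ord_mul, ih]
    · exact fun i hi => hf i (Finset.mem_insert_of_mem hi)
    · exact hf a (Finset.mem_insert_self _ _)
    · exact Finset.prod_ne_zero_iff.2 fun i hi => hf i (Finset.mem_insert_of_mem hi)

lemma ord_nonneg_iff {x : K} (hx : x ≠ 0) : 0 ≤ ord v x ↔ v.valuation K x ≤ 1 := by
  unfold ord
  rw [← WithZero.log_le_log (val_ne_zero v hx) one_ne_zero, WithZero.log_one]; omega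
lemma ord_pos_iff {x : K} (hx : x ≠ 0) : 0 < ord v x ↔ v.valuation K x < 1 := by
  unfold ord
  rw [← WithZero.log_lt_log (val_ne_zero v hx) one_ne_zero, WithZero.log_one]; omega
lemma ord_eq_zero_iff {x : K} (hx : x ≠ 0) : ord v x = 0 ↔ v.valuation K x = 1 := by
  have h1 := ord_nonneg_iff v hx
  have h2 := ord_pos_iff v hx
  constructor
  · intro h
    apply le_antisymm (h1.1 (by omega))
    by_contra h3
    have := h2.2 (not_le.1 h3); omega
  · intro h
    have := h1.2 h.le
    by_contra h3
    have := h2.1 (by omega)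
    simp [h] at this
lemma ord_le_iff {x y : K} (hx : x ≠ 0) (hy : y ≠ 0) :
    ord v x ≤ ord v y ↔ v.valuation K y ≤ v.valuation K x := by
  unfold ord
  rw [← WithZero.log_le_log (val_ne_zero v hy) (val_ne_zero v hx)]; omega
lemma ord_lt_iff {x y : K} (hx : x ≠ 0) (hy : y ≠ 0) :
    ord v x < ord v y ↔ v.valuation K y < v.valuation K x := by
  rw [← not_le, ord_le_iff v hy hx, not_le]

lemma ord_int_nonneg (a : 𝓞 K) : 0 ≤ ord v (a : K) := by
  by_cases h : (a : K) = 0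
  · simp [h]
  · rw [ord_nonneg_iff v h]; exact v.valuation_le_one a

lemma ord_int_pos_iff {a : 𝓞 K} (ha : a ≠ 0) : 0 < ord v (a : K) ↔ a ∈ v.asIdeal := by
  rw [ord_pos_iff v (by exact_mod_cast ha)]
  exact v.valuation_lt_one_iff_mem a

lemma ord_int_eq_zero_iff {a : 𝓞 K} (ha : a ≠ 0) : ord v (a : K) = 0 ↔ a ∉ v.asIdeal := by
  rw [← ord_int_pos_iff v ha]
  have := ord_int_nonneg v a
  omega

lemma exists_int_of_ord_nonneg {x : K} (h : ∀ v : Pl K, 0 ≤ ord v x) : ∃ a : 𝓞 K, (a : K) = x := by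
  by_cases hx : x = 0
  · exact ⟨0, by simp [hx]⟩
  · exact HeightOneSpectrum.mem_integers_of_valuation_le_one K x
      (fun v => (ord_nonneg_iff v hx).1 (h v))

lemma exists_unit_of_ord_eq_zero {x : K} (hx : x ≠ 0) (h : ∀ v : Pl K, ord v x = 0) :
    ∃ u : (𝓞 K)ˣ, ((u : 𝓞 K) : K) = x := by
  obtain ⟨a, ha⟩ := exists_int_of_ord_nonneg (fun v => (h v).ge)
  obtain ⟨b, hb⟩ := exists_int_of_ord_nonneg (x := x⁻¹) (fun v => by rw [ord_inv, h]; simp)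
  refine ⟨⟨a, b, ?_, ?_⟩, ha⟩ <;>
  · apply RingOfIntegers.ext
    simp [ha, hb, hx]

lemma ord_unit (u : (𝓞 K)ˣ) : ord v ((u : 𝓞 K) : K) = 0 := by
  rw [ord_int_eq_zero_iff v u.ne_zero]
  exact fun h => v.isPrime.ne_top (Ideal.eq_top_of_isUnit_mem _ h u.isUnit)

lemma ord_finite_int {a : 𝓞 K} (ha : a ≠ 0) : {v : Pl K | ord v (a : K) ≠ 0}.Finite := by
  have := Ideal.finite_factors (I := Ideal.span {a}) (by simpa using ha)
  refine this.subset fun v hv => ?_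
  have h1 : 0 < ord v (a : K) := lt_of_le_of_ne (ord_int_nonneg v a) (Ne.symm hv)
  rw [ord_int_pos_iff v ha] at h1
  simpa [Ideal.dvd_span_singleton] using h1

lemma ord_finite {x : K} (hx : x ≠ 0) : {v : Pl K | ord v x ≠ 0}.Finite := by
  obtain ⟨a, b, hb, rfl⟩ := IsFractionRing.div_surjective (A := 𝓞 K) x
  have hb' : b ≠ 0 := nonZeroDivisors.ne_zero hb
  have ha : a ≠ 0 := by rintro rfl; simp at hx
  refine ((ord_finite_int ha).union (ord_finite_int hb')).subset fun v hv => ?_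
  by_contra h
  simp only [Set.mem_union, Set.mem_setOf_eq, not_or, not_not] at h
  apply hv
  rw [ord_div v (coe_ne ha) (coe_ne hb')]
  simp [h.1, h.2]

/-- an integral element with support exactly `{v}` -/
lemma exists_supp_single : ∃ a : 𝓞 K, a ≠ 0 ∧ 0 < ord v (a : K) ∧ ∀ w : Pl K, w ≠ v → ord w (a : K) = 0 := by
  classical
  have hv : v.asIdeal ∈ nonZeroDivisors (Ideal (𝓞 K)) := mem_nonZeroDivisors_of_ne_zero v.ne_bot
  set h := Fintype.card (ClassGroup (𝓞 K)) with hh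
  have h1 : ClassGroup.mk0 (⟨v.asIdeal, hv⟩ ^ h : nonZeroDivisors (Ideal (𝓞 K))) = 1 := by
    rw [map_pow]; exact pow_card_eq_one
  have h2 := (ClassGroup.mk0_eq_one_iff (pow_mem hv h)).1 h1
  obtain ⟨a, ha⟩ := h2.principal
  have ha' : v.asIdeal ^ h = Ideal.span {a} := ha
  have ha0 : a ≠ 0 := by
    rintro rfl
    have : v.asIdeal ^ h = ⊥ := by simpa using ha'
    exact v.ne_bot (pow_eq_zero_iff (Fintype.card_ne_zero) |>.1 this)
  refine ⟨a, ha0, ?_, ?_⟩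
  · rw [ord_int_pos_iff v ha0]
    have : a ∈ v.asIdeal ^ h := by rw [ha']; exact Ideal.mem_span_singleton_self a
    exact Ideal.pow_le_self Fintype.card_ne_zero this
  · intro w hw
    rw [ord_int_eq_zero_iff w ha0]
    intro h3
    have h4 : v.asIdeal ^ h ≤ w.asIdeal := by
      rw [ha', Ideal.span_singleton_le_iff_mem]; exact h3
    have h5 := w.isPrime.le_of_pow_le h4
    have h6 := v.isMaximal.eq_of_le w.isPrime.ne_top h5
    exact hw (HeightOneSpectrum.ext h6.symm)

end ord

section sunits
variable {K : Type*} [Field K] [NumberField K]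

/-- `S`-units -/
noncomputable def SU (S : Set (Pl K)) : Subgroup Kˣ where
  carrier := {x | ∀ v ∉ S, ord v (x : K) = 0}
  one_mem' := by intro v _; simp
  mul_mem' := by
    intro a b ha hb v hv
    rw [Units.val_mul, ord_mul v a.ne_zero b.ne_zero, ha v hv, hb v hv, add_zero]
  inv_mem' := by
    intro a ha v hv
    rw [Units.val_inv_eq_inv_val, ord_inv, ha v hv, neg_zero]

lemma mem_SU {S : Set (Pl K)} {x : Kˣ} : x ∈ SU S ↔ ∀ v ∉ S, ord v (x : K) = 0 := Iff.rfl

/-- the map of `ord`s on a subgroup of `Kˣ` -/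
noncomputable def ordMap (G : Subgroup Kˣ) {ι : Type*} (p : ι → Pl K) : Additive G →ₗ[ℤ] (ι → ℤ) :=
  AddMonoidHom.toIntLinearMap
  { toFun := fun x i => ord (p i) (((Additive.toMul x : G) : Kˣ) : K)
    map_zero' := by funext i; simp
    map_add' := by
      intro x y; funext i
      simp [ord_mul (p i) (Units.ne_zero _) (Units.ne_zero _)] }

lemma ordMap_apply (G : Subgroup Kˣ) {ι : Type*} (p : ι → Pl K) (x : Additive G) (i : ι) :
  ordMap G p x i = ord (p i) (((Additive.toMul x : G) : Kˣ) : K) := rfl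

noncomputable def unitsToSU (S : Set (Pl K)) : (𝓞 K)ˣ →* SU S where
  toFun u := ⟨Units.map (algebraMap (𝓞 K) K : 𝓞 K →* K) u, fun v _ => by
    rw [Units.coe_map]; exact ord_unit v u⟩
  map_one' := by ext; simp
  map_mul' := by intro a b; ext; simp

lemma SU_finite_rank (S : Finset (Pl K)) : Module.Finite ℤ (Additive (SU (S : Set (Pl K)))) ∧
    finrank ℤ (Additive (SU (S : Set (Pl K)))) = Units.rank K + S.card := by
  classical
  set φ := ordMap (SU (S : Set (Pl K))) (fun i : S => (i : Pl K)) with hφ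
  let ψ : Additive (𝓞 K)ˣ →ₗ[ℤ] Additive (SU (S : Set (Pl K))) :=
    AddMonoidHom.toIntLinearMap (MonoidHom.toAdditive (unitsToSU (S : Set (Pl K))))
  have hinj : Function.Injective ψ := by
    intro a b hab
    have h1 : unitsToSU (S : Set (Pl K)) (Additive.toMul a) = unitsToSU (S : Set (Pl K)) (Additive.toMul b) := hab
    have h2 := congrArg (fun x : SU (S : Set (Pl K)) => ((x : Kˣ) : K)) h1
    simp only [unitsToSU] at h2
    apply Additive.toMul.injective
    ext
    simpa using h2
  have hker : LinearMap.ker φ = LinearMap.range ψ := by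
    ext x
    constructor
    · intro hx
      have h0 : ∀ v : Pl K, ord v (((Additive.toMul x : SU (S : Set (Pl K))) : Kˣ) : K) = 0 := by
        intro v
        by_cases hv : v ∈ S
        · exact congrFun (LinearMap.mem_ker.1 hx) ⟨v, hv⟩
        · exact (Additive.toMul x).2 v (by simpa using hv)
      obtain ⟨u, hu⟩ := exists_unit_of_ord_eq_zero (Units.ne_zero _) h0
      refine ⟨Additive.ofMul u, ?_⟩
      apply Additive.toMul.injective
      ext
      exact hu
    · rintro ⟨u, rfl⟩
      rw [LinearMap.mem_ker]
      funext i
      exact ord_unit i.1 (Additive.toMul u)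
  have hfin : Module.Finite ℤ (Additive (SU (S : Set (Pl K)))) := by
    have h1 : (LinearMap.ker φ).FG := by
      rw [hker]; exact Module.Finite.iff_fg.1 (Module.Finite.range ψ)
    have h2 : Module.Finite ℤ (Additive (SU (S : Set (Pl K))) ⧸ LinearMap.ker φ) :=
      Module.Finite.equiv φ.quotKerEquivRange.symm
    have : Module.Finite ℤ (LinearMap.ker φ) := Module.Finite.iff_fg.2 h1
    exact Module.Finite.of_submodule_quotient (LinearMap.ker φ)
  refine ⟨hfin, ?_⟩
  rw [← rank_nullity φ, hker, LinearMap.finrank_range_of_inj hinj, Units.finrank_eq]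
  choose a ha0 ha1 ha2 using fun v : Pl K => exists_supp_single v
  have ha0' : ∀ v : Pl K, (a v : K) ≠ 0 := fun v => by exact_mod_cast ha0 v
  rw [finrank_range_of_diag φ (fun i => Additive.ofMul ⟨Units.mk0 (a i.1 : K) (ha0' i), ?_⟩)]
  · simp [add_comm]
  · intro i
    rw [ordMap_apply]
    exact (ha1 i).ne'
  · intro i j hij
    rw [ordMap_apply]
    exact ha2 i j (fun h => hij (Subtype.ext h.symm))
  · intro v hv
    exact ha2 _ _ (fun h => hv (by rw [h]; exact i.2))

lemma card_sq_one (G : Subgroup Kˣ) (h : (-1 : Kˣ) ∈ G) : Nat.card {g : G // g ^ 2 = 1} = 2 := by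
  rw [Nat.card_eq_two_iff]
  refine ⟨⟨1, by simp⟩, ⟨⟨-1, h⟩, by ext; simp⟩, ?_, ?_⟩
  · intro h
    have := congrArg (fun x : {g : G // g ^ 2 = 1} => ((x.1 : Kˣ) : K)) h
    simp at this
    have h2 : (2 : K) = 0 := by linear_combination this
    exact two_ne_zero h2
  · ext ⟨x, hx⟩
    simp only [Set.mem_univ, iff_true, Set.mem_insert_iff, Set.mem_singleton_iff]
    have h1 : ((x : Kˣ) : K) ^ 2 = 1 := by
      have := congrArg (fun x : G => ((x : Kˣ) : K)) hx
      simpa using this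
    rcases sq_eq_one_iff.1 h1 with h | h 
    · left; ext; simpa using h
    · right; ext; simpa using h

lemma SU_sq_index (S : Finset (Pl K)) :
    (powMonoidHom 2 : SU (S : Set (Pl K)) →* SU (S : Set (Pl K))).range.index
      = 2 ^ (Units.rank K + 1 + S.card) := by
  obtain ⟨h1, h2⟩ := SU_finite_rank S
  rw [sq_index, h2, card_sq_one]
  · ring
  · intro v _; simp

end sunits
end FiveSq

end

section
open Module NumberField IsDedekindDomain

namespace FiveSq

section setup
variable {K : Type*} [Field K] [NumberField K]

/-- a modulus together with its set of places; outside of it the class group is trivial -/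
structure Setup (K : Type*) [Field K] [NumberField K] where
  N : ℕ
  hN : N ≠ 0
  two : 2 ∣ N
  S : Finset (Pl K)
  hS : ∀ v, v ∈ S ↔ (N : 𝓞 K) ∈ v.asIdeal
  unif : ∀ v ∉ S, ∃ p : K, p ≠ 0 ∧ ord v p = 1 ∧ ∀ w ∉ S, w ≠ v → ord w p = 0

lemma ord_ge_two_iff (v : Pl K) {a : 𝓞 K} (ha : a ≠ 0) : 2 ≤ ord v (a : K) ↔ a ∈ v.asIdeal ^ 2 := by
  have h := v.intValuation_le_pow_iff_mem a 2
  rw [← v.valuation_of_algebraMap (K := K)] at h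
  rw [← h]
  have h2 : v.valuation K (algebraMap (𝓞 K) K a) ≠ 0 := val_ne_zero v (coe_ne ha)
  rw [← WithZero.log_le_iff_le_exp h2]
  unfold ord
  push_cast
  constructor <;> intro h <;> linarith

lemma setup_aux (rep : ClassGroup (𝓞 K) → nonZeroDivisors (Ideal (𝓞 K)))
    (hrep : ∀ c, ClassGroup.mk0 (rep c) = c) (N : ℕ) (hmem : ∀ c, (N : 𝓞 K) ∈ (rep c : Ideal (𝓞 K)))
    (v : Pl K) (hv' : (N : 𝓞 K) ∉ v.asIdeal) :
    ∃ p : K, p ≠ 0 ∧ ord v p = 1 ∧ ∀ w : Pl K, (N : 𝓞 K) ∉ w.asIdeal → w ≠ v → ord w p = 0 := by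
  obtain ⟨V, hV⟩ : ∃ V : nonZeroDivisors (Ideal (𝓞 K)), (V : Ideal (𝓞 K)) = v.asIdeal :=
    ⟨⟨v.asIdeal, mem_nonZeroDivisors_of_ne_zero v.ne_bot⟩, rfl⟩
  obtain ⟨J, hJ⟩ : ∃ J, J = rep (ClassGroup.mk0 V)⁻¹ := ⟨_, rfl⟩
  have h1 : ClassGroup.mk0 (V * J) = 1 := by
    rw [map_mul, hJ, hrep, mul_inv_cancel]
  have h2 := (ClassGroup.mk0_eq_one_iff (V * J).2).1 h1
  obtain ⟨a, ha⟩ := h2.principal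
  have ha' : v.asIdeal * (J : Ideal (𝓞 K)) = Ideal.span {a} := by
    rw [← hV, ← Submonoid.coe_mul, ha]
  have hamem : a ∈ v.asIdeal * (J : Ideal (𝓞 K)) := by rw [ha']; exact Ideal.mem_span_singleton_self a
  have hav : a ∈ v.asIdeal := Ideal.mul_le_left hamem
  have ha0 : a ≠ 0 := by
    rintro rfl
    have h3 : v.asIdeal * (J : Ideal (𝓞 K)) = ⊥ := by simpa using ha'
    rcases Ideal.mul_eq_bot.1 h3 with h | h
    · exact v.ne_bot h
    · exact nonZeroDivisors.ne_zero J.2 h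
  have hJw : ∀ w : Pl K, (N : 𝓞 K) ∉ w.asIdeal → ¬ (J : Ideal (𝓞 K)) ≤ w.asIdeal :=
    fun w hw h => hw (h (hJ ▸ hmem _))
  refine ⟨a, coe_ne ha0, ?_, ?_⟩
  · have h3 := (ord_int_pos_iff v ha0).2 hav
    have h4 : ¬ 2 ≤ ord v (a : K) := by
      rw [ord_ge_two_iff v ha0]
      intro h
      have h5 : v.asIdeal * (J : Ideal (𝓞 K)) ≤ v.asIdeal * v.asIdeal := by
        rw [ha', Ideal.span_singleton_le_iff_mem, ← pow_two]; exact h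
      have h6 := Ideal.dvd_iff_le.2 h5
      have h7 : v.asIdeal ∣ J := by
        rwa [mul_dvd_mul_iff_left v.ne_bot] at h6
      exact hJw v hv' (Ideal.dvd_iff_le.1 h7)
    omega
  · intro w hw' hwv
    rw [ord_int_eq_zero_iff w ha0]
    intro h
    have h5 : v.asIdeal * (J : Ideal (𝓞 K)) ≤ w.asIdeal := by
      rw [ha', Ideal.span_singleton_le_iff_mem]; exact h
    rcases (w.isPrime.mul_le).1 h5 with h | h
    · exact hwv (HeightOneSpectrum.ext (v.isMaximal.eq_of_le w.isPrime.ne_top h).symm)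
    · exact hJw w hw' h

lemma exists_setup (K : Type*) [Field K] [NumberField K] : Nonempty (Setup K) := by
  classical
  choose rep hrep using ClassGroup.mk0_surjective (R := 𝓞 K)
  obtain ⟨N, hNdef⟩ : ∃ N : ℕ, N = 2 * ∏ c : ClassGroup (𝓞 K), Ideal.absNorm (rep c : Ideal (𝓞 K)) := ⟨_, rfl⟩
  have hN : N ≠ 0 := by
    rw [hNdef]
    apply mul_ne_zero two_ne_zero
    apply Finset.prod_ne_zero_iff.2
    intro c _
    rw [Ne, Ideal.absNorm_eq_zero_iff]
    exact nonZeroDivisors.ne_zero (rep c).2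
  have hN0 : (N : 𝓞 K) ≠ 0 := by exact_mod_cast hN
  have hfin : {v : Pl K | (N : 𝓞 K) ∈ v.asIdeal}.Finite := by
    refine (ord_finite_int hN0).subset fun v hv => ?_
    have := (ord_int_pos_iff v hN0).2 hv
    exact this.ne'
  have hmem : ∀ c, (N : 𝓞 K) ∈ (rep c : Ideal (𝓞 K)) := by
    intro c
    have h1 : Ideal.absNorm (rep c : Ideal (𝓞 K)) ∣ N :=
      hNdef ▸ Dvd.dvd.mul_left (Finset.dvd_prod_of_mem _ (Finset.mem_univ c)) 2
    obtain ⟨k, hk⟩ := h1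
    rw [hk]; push_cast
    exact Ideal.mul_mem_right _ _ (Ideal.absNorm_mem _)
  refine ⟨⟨N, hN, ⟨_, hNdef⟩, hfin.toFinset, by simp, ?_⟩⟩
  intro v hv
  obtain ⟨p, h1, h2, h3⟩ := setup_aux rep hrep N hmem v (by simpa using hv)
  exact ⟨p, h1, h2, fun w hw => h3 w (by simpa using hw)⟩

variable (st : Setup K)

lemma ord_zpow (v : Pl K) (x : K) (n : ℤ) : ord v (x ^ n) = n * ord v x := by
  unfold ord; rw [map_zpow₀, WithZero.log_zpow]; simp

lemma exists_prescribed (k : Pl K → ℤ) (hk : {v | k v ≠ 0}.Finite) :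
    ∃ t : K, t ≠ 0 ∧ ∀ v ∉ st.S, ord v t = k v := by
  classical
  have : ∀ v : Pl K, ∃ p : K, p ≠ 0 ∧ (v ∉ st.S → ord v p = 1 ∧ ∀ w ∉ st.S, w ≠ v → ord w p = 0) := by
    intro v
    by_cases hv : v ∈ st.S
    · exact ⟨1, one_ne_zero, fun h => absurd hv h⟩
    · obtain ⟨p, h1, h2, h3⟩ := st.unif v hv
      exact ⟨p, h1, fun _ => ⟨h2, h3⟩⟩
  choose p hp0 hp using this
  set T : Finset (Pl K) := hk.toFinset.filter (· ∉ st.S)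
  refine ⟨∏ v ∈ T, p v ^ k v, Finset.prod_ne_zero_iff.2 fun i _ => zpow_ne_zero _ (hp0 i), ?_⟩
  intro v hv
  rw [ord_prod _ _ _ (fun i _ => zpow_ne_zero _ (hp0 i))]
  simp_rw [ord_zpow]
  by_cases hvk : k v = 0
  · rw [hvk]
    apply Finset.sum_eq_zero
    intro i hi
    simp only [T, Finset.mem_filter, Set.Finite.mem_toFinset, Set.mem_setOf_eq] at hi
    rw [(hp i hi.2).2 v hv (by rintro rfl; exact hi.1 hvk), mul_zero]
  · rw [Finset.sum_eq_single v, (hp v hv).1, mul_one]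
    · intro i hi hiv
      simp only [T, Finset.mem_filter, Set.Finite.mem_toFinset, Set.mem_setOf_eq] at hi
      rw [(hp i hi.2).2 v hv (Ne.symm hiv), mul_zero]
    · intro h
      exfalso; apply h
      simp [T, hvk, hv]

/-- common scaling -/
lemma exists_coprime_scaling (x y : K) (hxy : x ≠ 0 ∨ y ≠ 0) : ∃ c : K, c ≠ 0 ∧ ∀ v ∉ st.S,
    v.valuation K (x / c) ≤ 1 ∧ v.valuation K (y / c) ≤ 1 ∧
      (v.valuation K (x / c) = 1 ∨ v.valuation K (y / c) = 1) := by
  classical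
  by_cases hx : x = 0
  · subst hx
    have hy : y ≠ 0 := by simpa using hxy
    exact ⟨y, hy, fun v _ => by simp [hy]⟩
  by_cases hy : y = 0
  · subst hy
    exact ⟨x, hx, fun v _ => by simp [hx]⟩
  obtain ⟨c, hc, h⟩ := exists_prescribed st (fun v => min (ord v x) (ord v y)) (by
    refine ((ord_finite hx).union (ord_finite hy)).subset fun v hv => ?_
    by_contra h
    simp only [Set.mem_union, Set.mem_setOf_eq, not_or, not_not] at h
    simp [h.1, h.2] at hv)
  refine ⟨c, hc, fun v hv => ?_⟩
  have h1 := h v hv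
  rw [← ord_nonneg_iff v (div_ne_zero hx hc), ← ord_nonneg_iff v (div_ne_zero hy hc),
    ← ord_eq_zero_iff v (div_ne_zero hx hc), ← ord_eq_zero_iff v (div_ne_zero hy hc),
    ord_div v hx hc, ord_div v hy hc, h1]
  omega

end setup

section sqmod
variable {K : Type*} [Field K] [NumberField K]

/-- being a square modulo the place `v` -/
def SqMod (v : Pl K) (x : K) : Prop := ∃ t : K, v.valuation K (x - t ^ 2) < 1

lemma SqMod.val_t {v : Pl K} {x t : K} (hx : v.valuation K x = 1) (h : v.valuation K (x - t ^ 2) < 1) :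
    v.valuation K t = 1 := by
  have h1 : v.valuation K (t ^ 2) = 1 := by
    have h2 := Valuation.map_sub_eq_of_lt_right (v.valuation K) (x := x - t ^ 2) (y := x) (by rw [hx]; exact h)
    rw [← hx, ← h2, ← Valuation.map_neg]; congr 1; ring
  rw [map_pow] at h1
  exact (pow_eq_one_iff_of_nonneg (by simp) two_ne_zero).1 h1

lemma SqMod.of_sq (v : Pl K) (t : K) : SqMod v (t ^ 2) := ⟨t, by simp⟩

lemma SqMod.mul {v : Pl K} {x y : K} (hx : v.valuation K x = 1) (hy : v.valuation K y = 1)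
    (h1 : SqMod v x) (h2 : SqMod v y) : SqMod v (x * y) := by
  obtain ⟨t, ht⟩ := h1
  obtain ⟨s, hs⟩ := h2
  have ht1 := SqMod.val_t hx ht
  refine ⟨t * s, ?_⟩
  have : x * y - (t * s) ^ 2 = (x - t ^ 2) * y + t ^ 2 * (y - s ^ 2) := by ring
  rw [this]
  apply Valuation.map_add_lt
  · rw [map_mul, hy, mul_one]; exact ht
  · rw [map_mul, map_pow, ht1, one_pow, one_mul]; exact hs

lemma SqMod.inv {v : Pl K} {x : K} (hx : v.valuation K x = 1)
    (h1 : SqMod v x) : SqMod v x⁻¹ := by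
  obtain ⟨t, ht⟩ := h1
  have ht1 := SqMod.val_t hx ht
  have hx0 : x ≠ 0 := by rintro rfl; simp at hx
  have ht0 : t ≠ 0 := by rintro rfl; simp at ht1
  refine ⟨t⁻¹, ?_⟩
  have : x⁻¹ - t⁻¹ ^ 2 = - (x⁻¹ * (x - t ^ 2) * (t⁻¹) ^ 2) := by field_simp; ring
  rw [this, Valuation.map_neg, map_mul, map_mul, map_pow, map_inv₀, map_inv₀, hx, ht1]
  simpa using ht

lemma SqMod.of_mul {v : Pl K} {x y : K} (hx : v.valuation K x = 1) (hy : v.valuation K y = 1)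
    (h1 : SqMod v x) (h2 : SqMod v (x * y)) : SqMod v y := by
  have hx0 : x ≠ 0 := by rintro rfl; simp at hx
  have := SqMod.mul (by rw [map_inv₀, hx, inv_one]) (by rw [map_mul, hx, hy, one_mul]) (SqMod.inv hx h1) h2
  rwa [inv_mul_cancel_left₀ hx0] at this

/-- Finite products -/
lemma SqMod.prod {ι : Type*} {v : Pl K} (s : Finset ι) (f : ι → K) (hf : ∀ i ∈ s, v.valuation K (f i) = 1)
    (h : ∀ i ∈ s, SqMod v (f i)) : v.valuation K (∏ i ∈ s, f i) = 1 ∧ SqMod v (∏ i ∈ s, f i) := by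
  classical
  induction s using Finset.induction_on with
  | empty => exact ⟨by simp, 1, by simp⟩
  | insert a s ha ih =>
    obtain ⟨h1, h2⟩ := ih (fun i hi => hf i (Finset.mem_insert_of_mem hi)) (fun i hi => h i (Finset.mem_insert_of_mem hi))
    rw [Finset.prod_insert ha]
    have h3 := hf a (Finset.mem_insert_self _ _)
    exact ⟨by rw [map_mul, h3, h1, one_mul], SqMod.mul h3 h1 (h a (Finset.mem_insert_self _ _)) h2⟩

/-- units that are norms `x² - d y²` are squares at places where `d` has odd valuation -/
lemma SqMod.of_norm {v : Pl K} {n x y d : K} (hn : v.valuation K n = 1) (hd : Odd (ord v d))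
    (h : n = x ^ 2 - d * y ^ 2) : SqMod v n := by
  refine ⟨x, ?_⟩
  have hd0 : d ≠ 0 := by rintro rfl; simp at hd
  have hn0 : n ≠ 0 := by rintro rfl; simp at hn
  have e : n - x ^ 2 = - (d * y ^ 2) := by rw [h]; ring
  rw [e, Valuation.map_neg]
  by_cases hy : y = 0
  · simp [hy]
  have hdy : d * y ^ 2 ≠ 0 := mul_ne_zero hd0 (pow_ne_zero _ hy)
  have o1 : Odd (ord v (d * y ^ 2)) := by
    rw [ord_mul v hd0 (pow_ne_zero _ hy), ord_pow]
    exact hd.add_even (by simp)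
  rw [← ord_pos_iff v hdy]
  by_contra hneg
  have hneg' : ord v (d * y ^ 2) < 0 := by
    rcases o1 with ⟨k, hk⟩; omega
  have hgt : 1 < v.valuation K (d * y ^ 2) := by
    rw [← not_le, ← ord_nonneg_iff v hdy]; omega
  by_cases hx : x = 0
  · have : n = - (d * y ^ 2) := by rw [h, hx]; ring
    rw [this, Valuation.map_neg] at hn
    rw [hn] at hgt
    exact lt_irrefl _ hgt
  have hne : v.valuation K (x ^ 2) ≠ v.valuation K (d * y ^ 2) := by
    intro heq
    have : ord v (x ^ 2) = ord v (d * y ^ 2) := by unfold ord; rw [heq]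
    rw [← this, ord_pow] at o1
    rcases o1 with ⟨k, hk⟩
    push_cast at hk; omega
  have hm := Valuation.map_add_of_distinct_val (v.valuation K) (x := x ^ 2) (y := -(d * y ^ 2)) (by rwa [Valuation.map_neg])
  rw [← sub_eq_add_neg, ← h, hn, Valuation.map_neg] at hm
  exact absurd (lt_of_lt_of_le hgt (le_max_right _ _)) (by rw [← hm]; exact lt_irrefl _)

end sqmod
end FiveSq

end

section
open Module NumberField IsDedekindDomain

namespace FiveSq

section ext
variable {K L : Type*} [Field K] [NumberField K] [Field L] [NumberField L] [Algebra K L]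

lemma coe_algMap (a : 𝓞 K) :
    algebraMap (𝓞 L) L (algebraMap (𝓞 K) (𝓞 L) a) = algebraMap K L (algebraMap (𝓞 K) K a) := rfl

lemma algMapO_inj : Function.Injective (algebraMap (𝓞 K) (𝓞 L)) := by
  intro a b h
  have := congrArg (algebraMap (𝓞 L) L) h
  rw [coe_algMap, coe_algMap] at this
  exact IsFractionRing.injective (𝓞 K) K ((algebraMap K L).injective this)

/-- the place below -/
noncomputable def under (K : Type*) {L : Type*} [Field K] [NumberField K] [Field L] [NumberField L] [Algebra K L]
    (w : Pl L) : Pl K where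
  asIdeal := w.asIdeal.comap (algebraMap (𝓞 K) (𝓞 L))
  isPrime := w.isPrime.comap _
  ne_bot := by
    obtain ⟨x, hx, hx0⟩ := Submodule.exists_mem_ne_zero_of_ne_bot w.ne_bot
    have : IsIntegral (𝓞 K) x :=
      IsIntegral.tower_top (R := ℤ) (RingOfIntegers.isIntegral x)
    exact Ideal.comap_ne_bot_of_integral_mem hx0 hx this

lemma mem_under {w : Pl L} {a : 𝓞 K} :
    a ∈ (under K w).asIdeal ↔ algebraMap (𝓞 K) (𝓞 L) a ∈ w.asIdeal := Iff.rfl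

lemma exists_over (v : Pl K) : ∃ w : Pl L, under K w = v := by
  have hIntg : Algebra.IsIntegral (𝓞 K) (𝓞 L) :=
    ⟨fun x => IsIntegral.tower_top (R := ℤ) (RingOfIntegers.isIntegral x)⟩
  have hk : RingHom.ker (algebraMap (𝓞 K) (𝓞 L)) ≤ v.asIdeal := by
    rw [(RingHom.injective_iff_ker_eq_bot _).1 algMapO_inj]; exact bot_le
  obtain ⟨Q, hQ, hQ2⟩ := Ideal.exists_ideal_over_maximal_of_isIntegral (S := 𝓞 L) v.asIdeal hk
  have hne : Q ≠ ⊥ := by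
    rintro rfl
    apply v.ne_bot
    rw [← hQ2, Ideal.comap_bot_of_injective _ algMapO_inj]
  exact ⟨⟨Q, hQ.isPrime, hne⟩, HeightOneSpectrum.ext hQ2⟩

lemma val_under_le {w : Pl L} {x : K} (h : (under K w).valuation K x ≤ 1) :
    w.valuation L (algebraMap K L x) ≤ 1 := by
  obtain ⟨n, d, hnd⟩ := HeightOneSpectrum.exists_primeCompl_mul_eq_of_integer (K := K) (under K w) x h
  have hd : algebraMap (𝓞 K) (𝓞 L) d ∉ w.asIdeal := d.2
  have h1 := congrArg (fun y => w.valuation L (algebraMap K L y)) hnd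
  simp only [map_mul, ← coe_algMap] at h1
  rw [(w.valuation_eq_one_iff_notMem (K := L)).2 hd, mul_one] at h1
  rw [h1]; exact w.valuation_le_one _

lemma val_under_lt {w : Pl L} {x : K} (h : (under K w).valuation K x < 1) :
    w.valuation L (algebraMap K L x) < 1 := by
  obtain ⟨n, d, hnd⟩ := HeightOneSpectrum.exists_primeCompl_mul_eq_of_integer (K := K) (under K w) x h.le
  have hd : algebraMap (𝓞 K) (𝓞 L) d ∉ w.asIdeal := d.2
  have h1 := congrArg (fun y => w.valuation L (algebraMap K L y)) hnd
  simp only [map_mul, ← coe_algMap] at h1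
  rw [(w.valuation_eq_one_iff_notMem (K := L)).2 hd, mul_one] at h1
  have h2 : (under K w).valuation K (algebraMap (𝓞 K) K n) < 1 := by
    rw [← hnd, map_mul, ((under K w).valuation_eq_one_iff_notMem (K := K)).2 d.2, mul_one]
    exact h
  rw [h1, w.valuation_lt_one_iff_mem, ← mem_under]
  exact ((under K w).valuation_lt_one_iff_mem (K := K) n).1 h2

lemma val_under_eq {w : Pl L} {x : K} (h : (under K w).valuation K x = 1) :
    w.valuation L (algebraMap K L x) = 1 := by
  have hx : x ≠ 0 := by rintro rfl; simp at h
  apply le_antisymm (val_under_le h.le)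
  have h2 : (under K w).valuation K x⁻¹ ≤ 1 := by rw [map_inv₀, h, inv_one]
  have h3 := val_under_le h2
  rw [map_inv₀, map_inv₀] at h3
  have h4 : w.valuation L (algebraMap K L x) ≠ 0 :=
    val_ne_zero w ((map_ne_zero _).2 hx)
  exact (inv_le_one₀ (zero_lt_iff.2 h4)).1 h3

lemma val_under_lt_iff {w : Pl L} {x : K} :
    w.valuation L (algebraMap K L x) < 1 ↔ (under K w).valuation K x < 1 := by
  refine ⟨fun h => ?_, val_under_lt⟩
  by_contra h2
  rcases eq_or_lt_of_le (not_lt.1 h2) with h3 | h3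
  · rw [val_under_eq h3.symm] at h; exact lt_irrefl _ h
  · have hx : x ≠ 0 := by rintro rfl; simp at h3
    have h5 : (under K w).valuation K x⁻¹ < 1 := by
      rw [map_inv₀]; exact inv_lt_one_of_one_lt₀ h3
    have h6 := val_under_lt h5
    rw [map_inv₀, map_inv₀] at h6
    have h4 : w.valuation L (algebraMap K L x) ≠ 0 :=
      val_ne_zero w ((map_ne_zero _).2 hx)
    exact absurd h (not_lt.2 ((inv_lt_one₀ (zero_lt_iff.2 h4)).1 h6).le)

/-- a finite set of places has finitely many places above -/
lemma over_finite (S : Finset (Pl K)) : {w : Pl L | under K w ∈ S}.Finite := by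
  classical
  have : {w : Pl L | under K w ∈ S} ⊆ ⋃ v ∈ S, {w : Pl L | under K w = v} := by
    intro w hw
    simp only [Set.mem_iUnion, Set.mem_setOf_eq, exists_prop, exists_eq_right']
    exact hw
  refine Set.Finite.subset (Set.Finite.biUnion S.finite_toSet fun v _ => ?_) this
  obtain ⟨a, ha, ha0⟩ := Submodule.exists_mem_ne_zero_of_ne_bot v.ne_bot
  have h0 : algebraMap (𝓞 K) (𝓞 L) a ≠ 0 := fun h => ha0 (algMapO_inj (L := L) (by rw [h, map_zero]))
  refine (ord_finite_int h0).subset fun w hw => ?_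
  have h1 : a ∈ (under K w).asIdeal := by rw [hw]; exact ha
  exact ((ord_int_pos_iff w h0).2 (mem_under.1 h1)).ne'

end ext

/-- quadratic extension data -/
structure Quad (K L : Type*) [Field K] [Field L] [Algebra K L] (d : K) where
  th : L
  th_sq : th ^ 2 = algebraMap K L d
  gen : ∀ z : L, ∃ x y : K, z = algebraMap K L x + algebraMap K L y * th
  s : L ≃ₐ[K] L
  s_th : s th = - th
  fr : finrank K L = 2

section quad
variable {K L : Type*} [Field K] [Field L] [Algebra K L] {d : K} (q : Quad K L d)

lemma Quad.s_s (z : L) : q.s (q.s z) = z := by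
  obtain ⟨x, y, rfl⟩ := q.gen z
  simp [q.s_th]

lemma Quad.norm (x y : K) : (algebraMap K L x + algebraMap K L y * q.th) *
    q.s (algebraMap K L x + algebraMap K L y * q.th) = algebraMap K L (x ^ 2 - d * y ^ 2) := by
  simp only [map_add, map_mul, q.s_th, AlgEquiv.commutes, map_sub, map_pow, ← q.th_sq]
  ring

lemma Quad.exists_norm (z : L) : ∃ x y : K, z * q.s z = algebraMap K L (x ^ 2 - d * y ^ 2) := by
  obtain ⟨x, y, rfl⟩ := q.gen z
  exact ⟨x, y, q.norm x y⟩

/-- existence of the quadratic extension -/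
lemma exists_quad.{u} {K : Type u} [Field K] [NumberField K] (d : K) (hd : ¬ IsSquare d) :
    ∃ (L : Type u) (_ : Field L) (_ : NumberField L) (_ : Algebra K L), Nonempty (Quad K L d) := by
  classical
  let p : Polynomial K := Polynomial.X ^ 2 - Polynomial.C d
  have hp : Irreducible p := by
    apply X_pow_sub_C_irreducible_of_prime Nat.prime_two
    intro b hb
    exact hd ⟨b, by rw [← hb, pow_two]⟩
  have : Fact (Irreducible p) := ⟨hp⟩
  have hdeg : p.natDegree = 2 := Polynomial.natDegree_X_pow_sub_C
  have hmonic : p.Monic := Polynomial.monic_X_pow_sub_C d two_ne_zero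
  let L := AdjoinRoot p
  let pb := AdjoinRoot.powerBasis hp.ne_zero
  have hfin : FiniteDimensional K L := pb.finite
  have hc : CharZero L := charZero_of_injective_algebraMap (algebraMap K L).injective
  have hnf : NumberField L := @NumberField.mk _ _ hc (Module.Finite.trans (R := ℚ) K L)
  refine ⟨L, inferInstance, hnf, inferInstance, ?_⟩
  have hroot : (AdjoinRoot.root p) ^ 2 = algebraMap K L d := by
    have h := AdjoinRoot.eval₂_root p
    simp only [p, Polynomial.eval₂_sub, Polynomial.eval₂_pow, Polynomial.eval₂_X, Polynomial.eval₂_C] at h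
    exact sub_eq_zero.1 h
  have hgen : ∀ z : L, ∃ x y : K, z = algebraMap K L x + algebraMap K L y * AdjoinRoot.root p := by
    intro z
    obtain ⟨f, hf⟩ := AdjoinRoot.mk_surjective z
    have h1 : z = AdjoinRoot.mk p (f %ₘ p) := by
      rw [← hf, AdjoinRoot.mk_eq_mk]
      exact ⟨f /ₘ p, by rw [sub_eq_iff_eq_add, add_comm, Polynomial.modByMonic_add_div f p]⟩
    have h2 : (f %ₘ p).natDegree < 2 := by
      rw [← hdeg]; exact Polynomial.natDegree_modByMonic_lt f hmonic (by intro h; rw [h] at hdeg; simp at hdeg)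
    have h3 := Polynomial.eq_X_add_C_of_natDegree_le_one (Nat.lt_succ_iff.1 h2)
    rw [h3] at h1
    refine ⟨(f %ₘ p).coeff 0, (f %ₘ p).coeff 1, ?_⟩
    rw [h1]
    simp [add_comm]
    rfl
  have hneg : Polynomial.aeval (-(AdjoinRoot.root p)) p = 0 := by
    simp only [p, map_sub, map_pow, Polynomial.aeval_X, Polynomial.aeval_C]
    rw [neg_sq, hroot, sub_self]
  let s : L →ₐ[K] L := AdjoinRoot.liftAlgHom p (Algebra.ofId K L) (-(AdjoinRoot.root p)) hneg
  have hs : s (AdjoinRoot.root p) = -(AdjoinRoot.root p) := by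
    exact AdjoinRoot.liftAlgHom_root _ _ _ _
  have hss : s.comp s = AlgHom.id K L := by
    apply AdjoinRoot.algHom_ext
    change s (s (AdjoinRoot.root p)) = AdjoinRoot.root p
    rw [hs, map_neg, hs, neg_neg]
  exact ⟨⟨AdjoinRoot.root p, hroot, hgen, AlgEquiv.ofAlgHom s s hss hss, hs, by
    rw [pb.finrank, AdjoinRoot.powerBasis_dim, hdeg]⟩⟩

end quad
end FiveSq

end

section
open Module NumberField IsDedekindDomain

namespace FiveSq

section cj
variable {K L : Type*} [Field K] [NumberField K] [Field L] [NumberField L] [Algebra K L] {d : K}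
  (q : Quad K L d)

noncomputable def Quad.sO : 𝓞 L ≃+* 𝓞 L := RingOfIntegers.mapRingEquiv q.s.toRingEquiv

lemma Quad.coe_sO (a : 𝓞 L) : algebraMap (𝓞 L) L (q.sO a) = q.s (algebraMap (𝓞 L) L a) := rfl

lemma Quad.sO_sO (a : 𝓞 L) : q.sO (q.sO a) = a := by
  apply RingOfIntegers.ext
  exact q.s_s _

lemma Quad.sO_alg (a : 𝓞 K) : q.sO (algebraMap (𝓞 K) (𝓞 L) a) = algebraMap (𝓞 K) (𝓞 L) a := by
  apply RingOfIntegers.ext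
  exact q.s.commutes _

noncomputable def Quad.cj (w : Pl L) : Pl L where
  asIdeal := w.asIdeal.comap q.sO
  isPrime := w.isPrime.comap _
  ne_bot := by
    obtain ⟨x, hx, hx0⟩ := Submodule.exists_mem_ne_zero_of_ne_bot w.ne_bot
    intro h
    apply hx0
    have h1 : q.sO x ∈ w.asIdeal.comap q.sO := by
      rw [Ideal.mem_comap, q.sO_sO]; exact hx
    rw [h, Ideal.mem_bot] at h1
    exact (map_eq_zero_iff _ q.sO.injective).1 h1

lemma Quad.mem_cj {w : Pl L} {a : 𝓞 L} : a ∈ (q.cj w).asIdeal ↔ q.sO a ∈ w.asIdeal := Iff.rfl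

lemma Quad.under_cj (w : Pl L) : under K (q.cj w) = under K w := by
  apply HeightOneSpectrum.ext
  ext a
  rw [mem_under, mem_under, q.mem_cj, q.sO_alg]

lemma Quad.cj_lt {w : Pl L} {x : L} (h : (q.cj w).valuation L x < 1) :
    w.valuation L (q.s x) < 1 := by
  obtain ⟨n, d, hnd⟩ := HeightOneSpectrum.exists_primeCompl_mul_eq_of_integer (K := L) (q.cj w) x h.le
  have hd : q.sO d ∉ w.asIdeal := d.2
  have h1 := congrArg (fun y => w.valuation L (q.s y)) hnd
  simp only [map_mul, ← q.coe_sO] at h1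
  rw [(w.valuation_eq_one_iff_notMem (K := L)).2 hd, mul_one] at h1
  have h2 : (q.cj w).valuation L (algebraMap (𝓞 L) L n) < 1 := by
    rw [← hnd, map_mul, ((q.cj w).valuation_eq_one_iff_notMem (K := L)).2 d.2, mul_one]
    exact h
  rw [h1, w.valuation_lt_one_iff_mem, ← q.mem_cj]
  exact ((q.cj w).valuation_lt_one_iff_mem (K := L) n).1 h2

lemma Quad.cj_cj (w : Pl L) : q.cj (q.cj w) = w := by
  apply HeightOneSpectrum.ext
  ext a
  rw [q.mem_cj, q.mem_cj, q.sO_sO]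

lemma Quad.cj_lt_iff {w : Pl L} {x : L} :
    w.valuation L (q.s x) < 1 ↔ (q.cj w).valuation L x < 1 := by
  refine ⟨fun h => ?_, q.cj_lt⟩
  have h1 : (q.cj (q.cj w)).valuation L (q.s x) < 1 := by rwa [q.cj_cj]
  have := q.cj_lt h1
  rwa [q.s_s] at this

lemma Quad.ord_s_eq_zero {w : Pl L} {x : L} (hx : x ≠ 0) (h : ord (q.cj w) x = 0) : ord w (q.s x) = 0 := by
  have hx2 : q.s x ≠ 0 := (map_ne_zero _).2 hx
  have h1 : ¬ 0 < ord w (q.s x) := by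
    rw [ord_pos_iff w hx2, q.cj_lt_iff, ← ord_pos_iff _ hx, h]; exact lt_irrefl _
  have h2 : ¬ 0 < ord w (q.s x⁻¹) := by
    rw [ord_pos_iff w ((map_ne_zero _).2 (inv_ne_zero hx)), q.cj_lt_iff, ← ord_pos_iff _ (inv_ne_zero hx), ord_inv, h]; simp
  rw [map_inv₀, ord_inv] at h2
  omega

lemma ord_alg_eq_zero_iff {w : Pl L} {x : K} (hx : x ≠ 0) :
    ord w (algebraMap K L x) = 0 ↔ ord (under K w) x = 0 := by
  have hx2 : algebraMap K L x ≠ 0 := (map_ne_zero _).2 hx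
  have h1 : 0 < ord w (algebraMap K L x) ↔ 0 < ord (under K w) x := by
    rw [ord_pos_iff w hx2, val_under_lt_iff, ← ord_pos_iff _ hx]
  have h2 : 0 < ord w (algebraMap K L x⁻¹) ↔ 0 < ord (under K w) x⁻¹ := by
    rw [ord_pos_iff w ((map_ne_zero _).2 (inv_ne_zero hx)), val_under_lt_iff, ← ord_pos_iff _ (inv_ne_zero hx)]
  rw [map_inv₀, ord_inv, ord_inv] at h2
  omega

/-- norm -/
noncomputable def Quad.nm : Lˣ →* Kˣ where
  toFun z := Units.mk0 ((q.exists_norm z).choose ^ 2 - d * (q.exists_norm z).choose_spec.choose ^ 2) (by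
    intro h
    have := (q.exists_norm z).choose_spec.choose_spec
    rw [h, map_zero] at this
    rcases mul_eq_zero.1 this with h1 | h1
    · exact z.ne_zero h1
    · exact z.ne_zero ((map_eq_zero _).1 h1))
  map_one' := by
    ext
    apply (algebraMap K L).injective
    simp only [Units.val_mk0]
    rw [← (q.exists_norm ((1 : Lˣ) : L)).choose_spec.choose_spec]
    simp
  map_mul' a b := by
    ext
    apply (algebraMap K L).injective
    refine ((q.exists_norm ((a * b : Lˣ) : L)).choose_spec.choose_spec).symm.trans ?_
    rw [Units.val_mul, Units.val_mul, map_mul (algebraMap K L), Units.val_mk0, Units.val_mk0,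
      ← (q.exists_norm (a : L)).choose_spec.choose_spec,
      ← (q.exists_norm (b : L)).choose_spec.choose_spec, map_mul]
    ring

lemma Quad.nm_spec (z : Lˣ) : algebraMap K L (q.nm z : Kˣ) = z * q.s z :=
  ((q.exists_norm z).choose_spec.choose_spec).symm

lemma Quad.nm_form (z : Lˣ) : ∃ x y : K, ((q.nm z : Kˣ) : K) = x ^ 2 - d * y ^ 2 := ⟨_, _, rfl⟩

def Quad.Em (S : Set (Pl K)) : Subgroup Lˣ where
  carrier := {e | (∀ w : Pl L, under K w ∉ S → ord w (e : L) = 0) ∧ (e : L) * q.s e = 1}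
  one_mem' := by simp
  mul_mem' := by
    rintro a b ⟨ha, ha2⟩ ⟨hb, hb2⟩
    refine ⟨fun w hw => ?_, ?_⟩
    · rw [Units.val_mul, ord_mul w a.ne_zero b.ne_zero, ha w hw, hb w hw, add_zero]
    · rw [Units.val_mul, map_mul, mul_mul_mul_comm, ha2, hb2, one_mul]
  inv_mem' := by
    rintro a ⟨ha, ha2⟩
    refine ⟨fun w hw => ?_, ?_⟩
    · rw [Units.val_inv_eq_inv_val, ord_inv, ha w hw, neg_zero]
    · rw [Units.val_inv_eq_inv_val, map_inv₀, ← mul_inv, ha2, inv_one]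

lemma Quad.mem_Em {S : Set (Pl K)} {e : Lˣ} : e ∈ q.Em S ↔
    (∀ w : Pl L, under K w ∉ S → ord w (e : L) = 0) ∧ (e : L) * q.s e = 1 := Iff.rfl

lemma Quad.Em_rank [IsTotallyComplex K] (S' S₀ : Finset (Pl K)) (hS : S₀ ⊆ S')
    (hsplit : ∀ v ∈ S₀, ∃ w : Pl L, under K w = v ∧ q.cj w ≠ w) :
    Module.Finite ℤ (Additive (q.Em (S' : Set (Pl K)))) ∧
    Units.rank K + 1 + S₀.card ≤ finrank ℤ (Additive (q.Em (S' : Set (Pl K)))) := by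
  classical
  haveI : IsTotallyComplex L := isTotallyComplex_of_algebra K L
  -- rank
  have hrk : Units.rank L + 1 = 2 * (Units.rank K + 1) := by
    have h1 := IsTotallyComplex.finrank K
    have h2 := IsTotallyComplex.finrank L
    have h3 : finrank ℚ K * finrank K L = finrank ℚ L := finrank_mul_finrank ℚ K L
    rw [q.fr] at h3
    have e1 := InfinitePlace.card_eq_nrRealPlaces_add_nrComplexPlaces (K := K)
    have e2 := InfinitePlace.card_eq_nrRealPlaces_add_nrComplexPlaces (K := L)
    rw [(nrRealPlaces_eq_zero_iff (K := K)).2 inferInstance] at e1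
    rw [(nrRealPlaces_eq_zero_iff (K := L)).2 inferInstance] at e2
    have p1 : 0 < finrank ℚ K := finrank_pos
    have p2 : 0 < finrank ℚ L := finrank_pos
    unfold Units.rank
    omega
  obtain ⟨SL, hSL⟩ : ∃ SL : Finset (Pl L), ∀ w, w ∈ SL ↔ under K w ∈ S' :=
    ⟨(over_finite S').toFinset, by simp⟩
  -- count
  have hcard : S'.card + S₀.card ≤ SL.card := by
    have hsplit' : ∀ v : Pl K, ∃ w : Pl L, under K w = v ∧ (v ∈ S₀ → q.cj w ≠ w) := by
      intro v
      by_cases hv : v ∈ S₀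
      · obtain ⟨w, h1, h2⟩ := hsplit v hv
        exact ⟨w, h1, fun _ => h2⟩
      · obtain ⟨w, h1⟩ := exists_over (L := L) v
        exact ⟨w, h1, fun h => absurd h hv⟩
    choose P2 hP2 hP3 using hsplit'
    let g : S' ⊕ S₀ → SL := fun i => match i with
      | Sum.inl v => ⟨P2 v, by rw [hSL, hP2 v]; exact v.2⟩
      | Sum.inr v => ⟨q.cj (P2 v), by rw [hSL, q.under_cj, hP2 v]; exact hS v.2⟩
    have hg : Function.Injective g := by
      have hu1 : ∀ v : S', under K (g (Sum.inl v) : Pl L) = v := by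
        intro v; exact hP2 v
      have hu2 : ∀ v : S₀, under K (g (Sum.inr v) : Pl L) = v := by
        intro v; simp only [g]; rw [q.under_cj]; exact hP2 v
      rintro (a | a) (b | b) h
      · congr 1; apply Subtype.ext; rw [← hu1, ← hu1, h]
      · exfalso
        have h1 : (a : Pl K) = b := by rw [← hu1, ← hu2, h]
        have h2 := congrArg Subtype.val h
        simp only [g] at h2
        rw [h1] at h2
        exact hP3 b b.2 h2.symm
      · exfalso
        have h1 : (b : Pl K) = a := by rw [← hu1, ← hu2, h]
        have h2 := congrArg Subtype.val h
        simp only [g] at h2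
        rw [h1] at h2
        exact hP3 a a.2 h2
      · congr 1; apply Subtype.ext; rw [← hu2, ← hu2, h]
    have := Fintype.card_le_of_injective g hg
    simpa using this
  obtain ⟨f1, r1⟩ := SU_finite_rank SL
  obtain ⟨f2, r2⟩ := SU_finite_rank S'
  -- norm map
  have hmap : ∀ z ∈ SU (SL : Set (Pl L)), q.nm z ∈ SU (S' : Set (Pl K)) := by
    intro z hz v hv
    obtain ⟨w, hw⟩ := exists_over (L := L) v
    have h1 : ord w (z : L) = 0 := hz w (by
      intro h; rw [Finset.mem_coe, hSL, hw] at h; exact hv h)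
    have h2 : ord (q.cj w) (z : L) = 0 := hz _ (by
      intro h; rw [Finset.mem_coe, hSL, q.under_cj, hw] at h; exact hv h)
    have h3 := q.ord_s_eq_zero z.ne_zero h2
    rw [← hw, ← ord_alg_eq_zero_iff (Units.ne_zero _), q.nm_spec,
      ord_mul w z.ne_zero ((map_ne_zero _).2 z.ne_zero), h1, h3, add_zero]
  let ν : SU (SL : Set (Pl L)) →* SU (S' : Set (Pl K)) :=
    (q.nm.comp (SU (SL : Set (Pl L))).subtype).codRestrict _ (fun z => hmap z z.2)
  let φ : Additive (SU (SL : Set (Pl L))) →ₗ[ℤ] Additive (SU (S' : Set (Pl K))) :=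
    AddMonoidHom.toIntLinearMap (MonoidHom.toAdditive ν)
  have hle : q.Em (S' : Set (Pl K)) ≤ SU (SL : Set (Pl L)) := by
    intro e he w hw
    exact he.1 w (by intro h; exact hw (by rw [Finset.mem_coe, hSL]; exact h))
  let ι : Additive (q.Em (S' : Set (Pl K))) →ₗ[ℤ] Additive (SU (SL : Set (Pl L))) :=
    AddMonoidHom.toIntLinearMap (MonoidHom.toAdditive (Subgroup.inclusion hle))
  have hι : Function.Injective ι := Subgroup.inclusion_injective hle
  have hfin : Module.Finite ℤ (Additive (q.Em (S' : Set (Pl K)))) := Module.Finite.of_injective ι hι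
  refine ⟨hfin, ?_⟩
  have hn := rank_nullity φ
  have hr : finrank ℤ (LinearMap.range φ) ≤ finrank ℤ (Additive (SU (S' : Set (Pl K)))) :=
    Submodule.finrank_le _
  have hk : finrank ℤ (LinearMap.ker φ) ≤ finrank ℤ (Additive (q.Em (S' : Set (Pl K)))) := by
    rw [← LinearMap.finrank_range_of_inj hι]
    apply Submodule.finrank_mono
    intro z hz
    have hz1 : q.nm ((Additive.toMul z : SU (SL : Set (Pl L))) : Lˣ) = 1 := by
      have : ν (Additive.toMul z) = 1 := hz
      exact congrArg Subtype.val this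
    refine ⟨Additive.ofMul ⟨((Additive.toMul z : SU (SL : Set (Pl L))) : Lˣ), ?_, ?_⟩, rfl⟩
    · intro w hw
      exact (Additive.toMul z).2 w (by rw [Finset.mem_coe, hSL]; exact hw)
    · rw [← q.nm_spec, hz1]; simp
  omega

end cj
end FiveSq

end

section
open Module NumberField IsDedekindDomain

namespace FiveSq

section herb
variable {K : Type*} [Field K] [NumberField K]

/-- the local-square-at-bad-primes condition -/
def InH (st : Setup K) (d : K) : Prop := ∃ t : K, t ≠ 0 ∧ ∃ d₀ c k : 𝓞 K,
  d = t ^ 2 * algebraMap (𝓞 K) K d₀ ∧ d₀ - c ^ 2 = 4 * st.N * k ∧ ∀ v ∈ st.S, c ∉ v.asIdeal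

lemma two_unit (st : Setup K) {v : Pl K} (hv : v ∉ st.S) : v.valuation K (2 : K) = 1 := by
  have h : (2 : 𝓞 K) ∉ v.asIdeal := by
    intro h
    apply hv
    rw [st.hS]
    obtain ⟨k, hk⟩ := st.two
    rw [hk]; push_cast
    exact Ideal.mul_mem_right _ _ h
  have := (v.valuation_eq_one_iff_notMem (K := K)).2 h
  rwa [map_ofNat] at this

variable {L : Type*} [Field L] [NumberField L] [Algebra K L] {d : K} (q : Quad K L d) (st : Setup K)

lemma Quad.split (hd : InH st d) (w : Pl L) (hv : under K w ∈ st.S) : q.cj w ≠ w := by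
  obtain ⟨t, ht, d₀, c, k, h1, h2, h3⟩ := hd
  set z : L := (algebraMap K L c + algebraMap K L t⁻¹ * q.th) / 2 with hz
  have hth : (algebraMap K L t⁻¹ * q.th) ^ 2 = algebraMap K L d₀ := by
    rw [mul_pow, q.th_sq, h1, ← map_pow, ← map_mul]; congr 1; field_simp
  have h2' : algebraMap K L d₀ - (algebraMap K L c) ^ 2 = 4 * (algebraMap K L (st.N * k)) := by
    have := congrArg (fun a : 𝓞 K => algebraMap K L (algebraMap (𝓞 K) K a)) h2
    simp only [map_sub, map_pow, map_mul, map_natCast, map_ofNat] at this ⊢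
    rw [this]; ring
  have hz2 : z ^ 2 = algebraMap K L c * z + algebraMap K L (st.N * k) := by
    rw [hz]
    linear_combination (1 / 4) * hth + (1/4) * h2'
  have hIntg : IsIntegral (𝓞 K) z := by
    refine ⟨Polynomial.X ^ 2 - Polynomial.C c * Polynomial.X - Polynomial.C (st.N * k), ?_, ?_⟩
    · have : (Polynomial.X ^ 2 - Polynomial.C c * Polynomial.X - Polynomial.C (st.N * k) : Polynomial (𝓞 K)) =
        Polynomial.X ^ 2 - (Polynomial.C c * Polynomial.X + Polynomial.C (st.N * k)) := by ring
      rw [this]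
      apply Polynomial.monic_X_pow_sub
      compute_degree!
    · have e : ∀ a : 𝓞 K, algebraMap (𝓞 K) L a = algebraMap K L (algebraMap (𝓞 K) K a) := fun a => rfl
      simp only [Polynomial.eval₂_sub, Polynomial.eval₂_pow, Polynomial.eval₂_mul, Polynomial.eval₂_X, Polynomial.eval₂_C, e]
      rw [hz2]; simp only [map_mul, map_natCast]; ring
  have hIntg2 : IsIntegral ℤ z := isIntegral_trans (A := 𝓞 K) z hIntg
  obtain ⟨Z, hZ⟩ : ∃ Z : 𝓞 L, algebraMap (𝓞 L) L Z = z := ⟨⟨z, hIntg2⟩, rfl⟩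
  have hsz : q.s z = (algebraMap K L c - algebraMap K L t⁻¹ * q.th) / 2 := by
    rw [hz, map_div₀, map_add, map_mul, q.s_th, AlgEquiv.commutes, AlgEquiv.commutes, map_ofNat]; ring
  have e1 : Z + q.sO Z = algebraMap (𝓞 K) (𝓞 L) c := by
    apply RingOfIntegers.ext
    change algebraMap (𝓞 L) L (Z + q.sO Z) = algebraMap K L c
    rw [map_add, q.coe_sO, hZ, hsz, hz]; ring
  have e2 : Z * q.sO Z = algebraMap (𝓞 K) (𝓞 L) (- (st.N * k)) := by
    apply RingOfIntegers.ext
    change algebraMap (𝓞 L) L (Z * q.sO Z) = algebraMap K L (algebraMap (𝓞 K) K (- (st.N * k)))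
    rw [map_mul, q.coe_sO, hZ, hsz, hz, map_neg, map_neg, map_mul, map_natCast]
    linear_combination (-1/4) * hth - (1/4) * h2'
  intro hcj
  have hN : (st.N : 𝓞 K) ∈ (under K w).asIdeal := (st.hS _).1 hv
  have h5 : Z * q.sO Z ∈ w.asIdeal := by
    rw [e2]
    rw [← mem_under]
    exact neg_mem (Ideal.mul_mem_right _ _ hN)
  have h6 : Z ∈ w.asIdeal ↔ q.sO Z ∈ w.asIdeal := by
    rw [← q.mem_cj, hcj]
  have h7 : Z ∈ w.asIdeal := by
    rcases w.isPrime.mem_or_mem h5 with h | h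
    · exact h
    · exact h6.2 h
  have h8 : algebraMap (𝓞 K) (𝓞 L) c ∈ w.asIdeal := by
    rw [← e1]; exact add_mem h7 (h6.1 h7)
  exact h3 _ hv (mem_under.2 h8)

lemma Quad.hilb (hd0 : d ≠ 0) (S' : Finset (Pl K)) (hS : st.S ⊆ S') (hev : ∀ v ∉ S', Even (ord v d))
    (e : Lˣ) (he : e ∈ q.Em (S' : Set (Pl K))) :
    ∃ b : Lˣ, (e : L) * q.s b = b ∧ q.nm b ∈ SU (S' : Set (Pl K)) := by
  have hth0 : q.th ≠ 0 := by
    intro h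
    have := q.th_sq
    rw [h] at this
    simp at this
    exact hd0 ((map_eq_zero _).1 this.symm)
  obtain ⟨b₀, hb0, hb1⟩ : ∃ b₀ : L, b₀ ≠ 0 ∧ (e : L) * q.s b₀ = b₀ := by
    by_cases h : (e : L) = -1
    · exact ⟨q.th, hth0, by rw [h, q.s_th]; ring⟩
    · refine ⟨1 + e, fun h2 => h (by linear_combination h2), ?_⟩
      rw [map_add, map_one, mul_add, he.2]; ring
  obtain ⟨x, y, hxy⟩ := q.gen b₀
  obtain ⟨t, ht0, ht⟩ := exists_prescribed st (fun v => ord v d / 2) (by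
    refine (ord_finite hd0).subset fun v hv hv2 => hv ?_
    simp [hv2])
  have hne : x ≠ 0 ∨ y * t ≠ 0 := by
    by_contra h
    push Not at h
    have : y = 0 := by simpa [ht0] using h.2
    exact hb0 (by rw [hxy, h.1, this]; simp)
  obtain ⟨c, hc0, hc⟩ := exists_coprime_scaling st x (y * t) hne
  set x1 := x / c with hx1
  set y1 := y * t / c with hy1
  have hb : b₀ / algebraMap K L c = algebraMap K L x1 + algebraMap K L (y1 / t) * q.th := by
    have hc1 : algebraMap K L c ≠ 0 := (map_ne_zero _).2 hc0
    have ht1 : algebraMap K L t ≠ 0 := (map_ne_zero _).2 ht0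
    rw [hxy, hx1, hy1]
    simp only [map_div₀, map_mul]
    field_simp
  have hbne : b₀ / algebraMap K L c ≠ 0 := div_ne_zero hb0 ((map_ne_zero _).2 hc0)
  set b : Lˣ := Units.mk0 _ hbne with hbdef
  have hbv : (b : L) = algebraMap K L x1 + algebraMap K L (y1 / t) * q.th := hb
  have heb : (e : L) * q.s b = b := by
    change (e : L) * q.s (b₀ / algebraMap K L c) = b₀ / algebraMap K L c
    rw [map_div₀, AlgEquiv.commutes, ← mul_div_assoc, hb1]
  have hnm : ((q.nm b : Kˣ) : K) = x1 ^ 2 - d * (y1 / t) ^ 2 := by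
    apply (algebraMap K L).injective
    rw [q.nm_spec, hbv, q.norm]
  refine ⟨b, heb, fun v hv => ?_⟩
  have hvS : v ∉ st.S := fun h => hv (hS h)
  obtain ⟨hv1, hv2, hv3⟩ := hc v hvS
  have hdl : v.valuation K (d / t ^ 2) = 1 := by
    rw [← ord_eq_zero_iff v (div_ne_zero hd0 (pow_ne_zero _ ht0)), ord_div v hd0 (pow_ne_zero _ ht0), ord_pow, ht v hvS]
    obtain ⟨k, hk⟩ := hev v hv
    push_cast
    omega
  have hnm2 : ((q.nm b : Kˣ) : K) = x1 ^ 2 - (d / t ^ 2) * y1 ^ 2 := by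
    rw [hnm]; field_simp
  have hle : 0 ≤ ord v ((q.nm b : Kˣ) : K) := by
    rw [ord_nonneg_iff v (Units.ne_zero _), hnm2]
    refine (Valuation.map_sub _ _ _).trans (max_le ?_ ?_)
    · rw [map_pow]; exact pow_le_one' hv1 _
    · rw [map_mul, hdl, one_mul, map_pow]; exact pow_le_one' hv2 _
  by_contra hne0
  have hpos : 0 < ord v ((q.nm b : Kˣ) : K) := lt_of_le_of_ne hle (Ne.symm hne0)
  obtain ⟨w, hw⟩ := exists_over (L := L) v
  have hsb0 : q.s b ≠ 0 := (map_ne_zero _).2 b.ne_zero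
  have hordb : ord w (b : L) = ord w (q.s b) := by
    conv_lhs => rw [← heb]
    rw [ord_mul w e.ne_zero hsb0, he.1 w (by rw [hw]; exact hv), zero_add]
  have hp2 : 0 < ord w (b : L) := by
    rw [ord_pos_iff v (Units.ne_zero _), ← hw, ← val_under_lt_iff, q.nm_spec, ← ord_pos_iff w (mul_ne_zero b.ne_zero hsb0),
      ord_mul w b.ne_zero hsb0, ← hordb] at hpos
    omega
  have hp3 : 0 < ord w (q.s b) := hordb ▸ hp2
  rw [ord_pos_iff w b.ne_zero] at hp2
  rw [ord_pos_iff w hsb0] at hp3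
  have hsb : q.s b = algebraMap K L x1 - algebraMap K L (y1 / t) * q.th := by
    rw [hbv, map_add, map_mul, q.s_th, AlgEquiv.commutes, AlgEquiv.commutes]; ring
  have h2v := two_unit st hvS
  have hA : w.valuation L ((b : L) + q.s b) < 1 := Valuation.map_add_lt _ hp2 hp3
  have hB : w.valuation L ((b : L) - q.s b) < 1 := Valuation.map_sub_lt _ hp2 hp3
  have eA : (b : L) + q.s b = algebraMap K L (2 * x1) := by rw [hsb, hbv, map_mul, map_ofNat]; ring
  have eB : ((b : L) - q.s b) ^ 2 = algebraMap K L (2 ^ 2 * (y1 ^ 2 * (d / t ^ 2))) := by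
    have : ((b : L) - q.s b) ^ 2 = algebraMap K L (2 ^ 2 * ((y1 / t) ^ 2 * d)) := by
      rw [hsb, hbv, map_mul, map_mul, ← q.th_sq, map_pow, map_pow, map_ofNat]; ring
    rw [this]; congr 1; field_simp
  rw [eA, val_under_lt_iff, hw, map_mul, h2v, one_mul] at hA
  have hB2 : w.valuation L (((b : L) - q.s b) ^ 2) < 1 := by
    rw [map_pow]; exact pow_lt_one' hB two_ne_zero
  rw [eB, val_under_lt_iff, hw, map_mul, map_pow, h2v, one_pow, one_mul, map_mul, hdl, mul_one, map_pow] at hB2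
  rcases hv3 with h | h
  · rw [h] at hA; exact lt_irrefl _ hA
  · rw [h, one_pow] at hB2; exact lt_irrefl _ hB2

end herb
end FiveSq

end

section
open Module NumberField IsDedekindDomain

namespace FiveSq

section herb
variable {K : Type*} [Field K] [NumberField K]
variable {L : Type*} [Field L] [NumberField L] [Algebra K L] {d : K} (q : Quad K L d) (st : Setup K)

lemma SU_val {S : Set (Pl K)} {x : Kˣ} (hx : x ∈ SU S) {v : Pl K} (hv : v ∉ S) : v.valuation K (x : K) = 1 :=
  (ord_eq_zero_iff v x.ne_zero).1 (hx v hv)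

lemma SU_mono {S T : Set (Pl K)} (h : S ⊆ T) : SU S ≤ SU T := fun x hx v hv => hx v (fun h2 => hv (h h2))

/-- index of squares in the norm subgroup -/
lemma Quad.norm_index [IsTotallyComplex K] (hd0 : d ≠ 0) (hd : InH st d) (S' : Finset (Pl K)) (hS : st.S ⊆ S')
    (hev : ∀ v ∉ S', Even (ord v d)) :
    (q.nm.range.subgroupOf (SU (S' : Set (Pl K)))).index * 2 ^ (Units.rank K + 1 + st.S.card + 1)
      ≤ 2 ^ (Units.rank K + 1 + S'.card) ∧
    (q.nm.range.subgroupOf (SU (S' : Set (Pl K)))).index ≠ 0 := by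
  classical
  set G := SU (S' : Set (Pl K)) with hG
  set M := q.nm.range.subgroupOf G with hM
  set Sq := (powMonoidHom 2 : G →* G).range with hSq
  obtain ⟨hf, hrk⟩ := q.Em_rank S' st.S hS (by
    intro v hv
    obtain ⟨w, hw⟩ := exists_over (L := L) v
    exact ⟨w, hw, q.split st hd w (by rw [hw]; exact hv)⟩)
  set E := q.Em (S' : Set (Pl K)) with hE
  have hidx : Sq.index = 2 ^ (Units.rank K + 1 + S'.card) := SU_sq_index S'
  have hle : Sq ≤ M := by
    rintro _ ⟨g, rfl⟩
    rw [hM, Subgroup.mem_subgroupOf]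
    refine ⟨Units.map (algebraMap K L).toMonoidHom (g : Kˣ), ?_⟩
    ext
    apply (algebraMap K L).injective
    rw [q.nm_spec]
    simp [pow_two]
  have hmul : Sq.relIndex M * M.index = Sq.index := Subgroup.relIndex_mul_index hle
  have hne : Sq.relIndex M * M.index ≠ 0 := by rw [hmul, hidx]; positivity
  have hEidx : (powMonoidHom 2 : E →* E).range.index = 2 ^ finrank ℤ (Additive E) * 2 := by
    rw [sq_index, card_sq_one]
    exact ⟨fun w _ => by simp, by simp⟩
  have key : (powMonoidHom 2 : E →* E).range.index ≤ Sq.relIndex M := by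
    have hb : ∀ e : E, ∃ b : Lˣ, ((e : Lˣ) : L) * q.s b = b ∧ q.nm b ∈ G :=
      fun e => q.hilb st hd0 S' hS hev e e.2
    choose b hb1 hb2 using hb
    let F : E ⧸ (powMonoidHom 2 : E →* E).range → M ⧸ Sq.subgroupOf M := fun e =>
      QuotientGroup.mk (⟨⟨q.nm (b e.out), hb2 _⟩, by
        rw [hM, Subgroup.mem_subgroupOf]; exact ⟨_, rfl⟩⟩ : M)
    have hF : Function.Injective F := by
      intro e1 e2 h
      rw [QuotientGroup.eq, Subgroup.mem_subgroupOf] at h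
      obtain ⟨g, hg⟩ := h
      rw [← QuotientGroup.out_eq' e1, ← QuotientGroup.out_eq' e2, QuotientGroup.eq]
      set a1 := e1.out with ha1
      set a2 := e2.out with ha2
      have hg2 : ((g : Kˣ) : K) ^ 2 = ((q.nm (b a1) : Kˣ) : K)⁻¹ * ((q.nm (b a2) : Kˣ) : K) := by
        have := congrArg (fun x : G => ((x : Kˣ) : K)) hg
        simpa using this
      have hg3 : (algebraMap K L ((g : Kˣ) : K)) ^ 2 =
          ((b a1 : L) * q.s (b a1))⁻¹ * ((b a2 : L) * q.s (b a2)) := by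
        rw [← map_pow, hg2, map_mul, map_inv₀, q.nm_spec, q.nm_spec]
      have hb10 := (b a1).ne_zero
      have hb20 := (b a2).ne_zero
      have hsb1 : q.s (b a1) ≠ 0 := (map_ne_zero _).2 hb10
      have hsb2 : q.s (b a2) ≠ 0 := (map_ne_zero _).2 hb20
      have hgne : algebraMap K L ((g : Kˣ) : K) ≠ 0 := (map_ne_zero _).2 (Units.ne_zero _)
      set z : L := (b a2 : L) / (b a1) / algebraMap K L ((g : Kˣ) : K) with hz
      have hz0 : z ≠ 0 := div_ne_zero (div_ne_zero hb20 hb10) hgne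
      have hzz : z * q.s z = 1 := by
        rw [hz, map_div₀, map_div₀, AlgEquiv.commutes]
        field_simp
        rw [hg3]; field_simp
      have hz2 : z ^ 2 = ((a1 : Lˣ) : L)⁻¹ * ((a2 : Lˣ) : L) := by
        have h1 : ((a1 : Lˣ) : L) = b a1 / q.s (b a1) := by rw [eq_div_iff hsb1, hb1]
        have h2 : ((a2 : Lˣ) : L) = b a2 / q.s (b a2) := by rw [eq_div_iff hsb2, hb1]
        rw [h1, h2, hz, div_pow, hg3]; field_simp
      refine ⟨⟨Units.mk0 z hz0, fun w hw => ?_, hzz⟩, ?_⟩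
      · have h3 : ord w (z ^ 2) = 0 := by
          rw [hz2, ord_mul w (inv_ne_zero (Units.ne_zero _)) (Units.ne_zero _), ord_inv, a1.2.1 w hw, a2.2.1 w hw]; simp
        rw [ord_pow] at h3
        simpa using h3
      · apply Subtype.ext
        apply Units.ext
        simpa using hz2
    haveI : Finite (M ⧸ Sq.subgroupOf M) := by
      apply Nat.finite_of_card_ne_zero
      exact left_ne_zero_of_mul hne
    exact Nat.card_le_card_of_injective F hF
  refine ⟨?_, right_ne_zero_of_mul hne⟩
  rw [← hidx, ← hmul, mul_comm]
  apply Nat.mul_le_mul_right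
  refine le_trans ?_ key
  rw [hEidx, pow_succ]
  apply Nat.mul_le_mul_right
  exact Nat.pow_le_pow_right (by norm_num) hrk

end herb

/-- Main lemma (1). -/
theorem herbrand.{u} {K : Type u} [Field K] [NumberField K] [IsTotallyComplex K] (st : Setup K) (d : K) (hd : InH st d) (hsq : ¬ IsSquare d)
    (R : Finset (Pl K)) (hR : ∀ v, v ∈ R ↔ v ∉ st.S ∧ Odd (ord v d)) (Q : Finset (Pl K)) (hQ : Q ⊆ R)
    (u : Pl K → Kˣ) (hu : ∀ v ∈ Q, u v ∈ SU (st.S : Set (Pl K))) (hu1 : ∀ v ∈ Q, ¬ SqMod v (u v : K))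
    (hu2 : ∀ v ∈ Q, ∀ v' ∈ Q, v' ≠ v → SqMod v' (u v : K)) :
    Q.card + 1 ≤ R.card ∧ (Q.card + 1 = R.card → ∀ w ∈ SU (st.S : Set (Pl K)),
      (∀ v ∈ Q, SqMod v (w : K)) → ∃ x y : K, (w : K) = x ^ 2 - d * y ^ 2) := by
  classical
  obtain ⟨L, _, _, _, ⟨q⟩⟩ := exists_quad d hsq
  have hd0 : d ≠ 0 := by rintro rfl; exact hsq ⟨0, by simp⟩
  have hdis : Disjoint st.S R := by
    rw [Finset.disjoint_left]; intro v hv hv2; exact ((hR v).1 hv2).1 hv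
  have hcard : (st.S ∪ R).card = st.S.card + R.card := Finset.card_union_of_disjoint hdis
  obtain ⟨h1, h2⟩ := q.norm_index st hd0 hd (st.S ∪ R) Finset.subset_union_left (by
    intro v hv
    rw [Finset.mem_union, hR, not_or, not_and] at hv
    exact Int.not_odd_iff_even.1 (hv.2 hv.1))
  set G := SU ((st.S ∪ R : Finset (Pl K)) : Set (Pl K)) with hG
  set M := q.nm.range.subgroupOf G with hM
  have hUG : SU (st.S : Set (Pl K)) ≤ G := SU_mono (by simp)
  have hQS : ∀ v ∈ Q, v ∉ (st.S : Set (Pl K)) := fun v hv => ((hR v).1 (hQ hv)).1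
  -- elements of M which are units at v ∈ Q are squares mod v
  have hMsq : ∀ g : Kˣ, g ∈ SU (st.S : Set (Pl K)) → g ∈ q.nm.range → ∀ v ∈ Q, SqMod v (g : K) := by
    rintro _ hg ⟨z, rfl⟩ v hv
    obtain ⟨x, y, hxy⟩ := q.nm_form z
    exact SqMod.of_norm (SU_val hg (hQS v hv)) ((hR v).1 (hQ hv)).2 hxy
  let uI : Finset (Pl K) → Kˣ := fun I => ∏ v ∈ I, u v
  have huI : ∀ I ⊆ Q, uI I ∈ SU (st.S : Set (Pl K)) := fun I hI => Subgroup.prod_mem _ (fun v hv => hu v (hI hv))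
  have huI_out : ∀ I ⊆ Q, ∀ v ∈ Q, v ∉ I → SqMod v (uI I : K) := by
    intro I hI v hv hvI
    simp only [uI, Units.coe_prod]
    exact (SqMod.prod I (fun i => (u i : K)) (fun i hi => SU_val (hu i (hI hi)) (hQS v hv))
      (fun i hi => hu2 i (hI hi) v hv (by rintro rfl; exact hvI hi))).2
  have huI_in : ∀ I ⊆ Q, ∀ v ∈ I, ¬ SqMod v (uI I : K) := by
    intro I hI v hv h
    apply hu1 v (hI hv)
    have e : ((uI (I.erase v) : Kˣ) : K) * (u v : K) = (uI I : K) := by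
      rw [← Units.val_mul]; congr 1; exact Finset.prod_erase_mul I u hv
    have hs : I.erase v ⊆ Q := (Finset.erase_subset _ _).trans hI
    refine SqMod.of_mul (x := (uI (I.erase v) : K)) (SU_val (huI _ hs) (hQS v (hI hv))) (SU_val (hu v (hI hv)) (hQS v (hI hv)))
      (huI_out _ hs v (hI hv) (Finset.notMem_erase _ _)) ?_
    rw [e]; exact h
  -- quotient relation
  have hrel : ∀ a b : Kˣ, a ∈ SU (st.S : Set (Pl K)) → b ∈ SU (st.S : Set (Pl K)) → a⁻¹ * b ∈ q.nm.range → 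
      ∀ v ∈ Q, SqMod v (a : K) → SqMod v (b : K) := by
    intro a b ha hb hab v hv h
    have h3 := hMsq _ (mul_mem (inv_mem ha) hb) hab v hv
    have := SqMod.mul (SU_val ha (hQS v hv)) (SU_val (mul_mem (inv_mem ha) hb) (hQS v hv)) h h3
    rwa [← Units.val_mul, mul_inv_cancel_left] at this
  let F : Q.powerset → G ⧸ M := fun I => QuotientGroup.mk ⟨uI I, hUG (huI I (Finset.mem_powerset.1 I.2))⟩
  have hF : Function.Injective F := by
    intro I J h
    have hI := Finset.mem_powerset.1 I.2
    have hJ := Finset.mem_powerset.1 J.2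
    have h3 := hrel (uI I) (uI J) (huI I hI) (huI J hJ) (by
      rw [QuotientGroup.eq, hM, Subgroup.mem_subgroupOf] at h; exact h)
    have h4 := hrel (uI J) (uI I) (huI J hJ) (huI I hI) (by
      have h := h.symm
      rw [QuotientGroup.eq, hM, Subgroup.mem_subgroupOf] at h; exact h)
    apply Subtype.ext
    ext v
    constructor
    · intro hv
      by_contra hv2
      exact huI_in I hI v hv (h4 v (hI hv) (huI_out J hJ v (hI hv) hv2))
    · intro hv
      by_contra hv2
      exact huI_in J hJ v hv (h3 v (hJ hv) (huI_out I hI v (hJ hv) hv2))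
  haveI : Finite (G ⧸ M) := Nat.finite_of_card_ne_zero h2
  have hcle : 2 ^ Q.card ≤ M.index := by
    have := Nat.card_le_card_of_injective F hF
    rw [Nat.card_eq_fintype_card, Fintype.card_coe, Finset.card_powerset] at this
    exact this
  rw [hcard] at h1
  have h1' : M.index * 2 ^ (Units.rank K + 1 + st.S.card) * 2 ≤ 2 ^ R.card * 2 ^ (Units.rank K + 1 + st.S.card) := by
    calc _ = M.index * 2 ^ (Units.rank K + 1 + st.S.card + 1) := by ring
      _ ≤ _ := h1
      _ = _ := by ring
  have hp : 0 < 2 ^ (Units.rank K + 1 + st.S.card) := by positivity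
  have h5 : M.index * 2 ≤ 2 ^ R.card := by
    apply Nat.le_of_mul_le_mul_right _ hp
    linarith
  constructor
  · have h6 : 2 ^ (Q.card + 1) ≤ 2 ^ R.card := by rw [pow_succ]; omega
    exact (Nat.pow_le_pow_iff_right (by norm_num)).1 h6
  · intro heq w hw hwQ
    have h6 : M.index = 2 ^ Q.card := by
      rw [← heq, pow_succ] at h5; omega
    have hbij : Function.Bijective F := by
      rw [Nat.bijective_iff_injective_and_card]
      refine ⟨hF, ?_⟩
      rw [Nat.card_eq_fintype_card, Fintype.card_coe, Finset.card_powerset]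
      exact h6.symm
    obtain ⟨I, hI⟩ := hbij.2 (QuotientGroup.mk ⟨w, hUG hw⟩)
    have hIQ := Finset.mem_powerset.1 I.2
    have hI0 : (I : Finset (Pl K)) = ∅ := by
      by_contra hne
      obtain ⟨v, hv⟩ := Finset.nonempty_iff_ne_empty.2 hne
      refine huI_in I hIQ v hv (hrel w (uI I) hw (huI I hIQ) ?_ v (hIQ hv) (hwQ v (hIQ hv)))
      have h := hI.symm
      rw [QuotientGroup.eq, hM, Subgroup.mem_subgroupOf] at h; exact h
    rw [QuotientGroup.eq, hM, Subgroup.mem_subgroupOf] at hI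
    simp only [hI0, uI, Finset.prod_empty, Subgroup.coe_mul, Subgroup.coe_inv, inv_one, one_mul] at hI
    obtain ⟨z, rfl⟩ := hI
    exact q.nm_form z

end FiveSq

end

section
open Module NumberField IsDedekindDomain

namespace FiveSq

variable {K : Type*} [Field K] [NumberField K]

lemma InH.mul {st : Setup K} {a b : K} (ha : InH st a) (hb : InH st b) : InH st (a * b) := by
  obtain ⟨t, ht, d, c, k, h1, h2, h3⟩ := ha
  obtain ⟨t', ht', d', c', k', h1', h2', h3'⟩ := hb
  refine ⟨t * t', mul_ne_zero ht ht', d * d', c * c', k * d' + c ^ 2 * k', ?_, ?_, ?_⟩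
  · rw [h1, h1', map_mul]; ring
  · linear_combination d' * h2 + c ^ 2 * h2'
  · intro v hv h
    rcases v.isPrime.mem_or_mem h with h | h
    · exact h3 v hv h
    · exact h3' v hv h

lemma InH.of_sq_mul {st : Setup K} {a s : K} (hs : s ≠ 0) (ha : InH st (s ^ 2 * a)) : InH st a := by
  obtain ⟨t, ht, d, c, k, h1, h2, h3⟩ := ha
  refine ⟨t / s, div_ne_zero ht hs, d, c, k, ?_, h2, h3⟩
  rw [div_pow, div_mul_eq_mul_div, ← h1]; field_simp

lemma exists_unif_on (S : Finset (Pl K)) (v : Pl K) (hv : v ∈ S) : ∃ p : K, p ≠ 0 ∧ ord v p = 1 ∧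
    ∀ w ∈ S, w ≠ v → ord w p = 0 := by
  classical
  obtain ⟨ϖ, hϖ⟩ := v.intValuation_exists_uniformizer
  have hϖ0 : ϖ ≠ 0 := by
    rintro rfl
    rw [map_zero] at hϖ
    exact WithZero.exp_ne_zero hϖ.symm
  have hϖ1 : ord v (algebraMap (𝓞 K) K ϖ) = 1 := by
    unfold ord; rw [v.valuation_of_algebraMap, hϖ]; simp
  obtain ⟨y, hy⟩ := IsDedekindDomain.exists_forall_sub_mem_ideal (s := S) (fun w : Pl K => w.asIdeal) (fun _ => 2)
    (fun w _ => w.prime) (fun i _ j _ hij h => hij (HeightOneSpectrum.ext h)) (fun w => if (w : Pl K) = v then ϖ else 1)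
  have h1 := hy v hv
  simp only [if_true] at h1
  have hyv : ord v (algebraMap (𝓞 K) K y) = 1 := by
    by_cases h0 : y - ϖ = 0
    · rw [sub_eq_zero.1 h0, hϖ1]
    · have h2 : 2 ≤ ord v (algebraMap (𝓞 K) K (y - ϖ)) := (ord_ge_two_iff v h0).2 h1
      have hlt : v.valuation K (algebraMap (𝓞 K) K (y - ϖ)) < v.valuation K (algebraMap (𝓞 K) K ϖ) := by
        rw [← ord_lt_iff v (coe_ne hϖ0) (coe_ne h0), hϖ1]; omega
      have h3 := Valuation.map_add_eq_of_lt_left (v.valuation K) hlt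
      rw [← map_add, add_sub_cancel] at h3
      unfold ord at hϖ1 ⊢
      rw [h3]; exact hϖ1
  have hy0 : y ≠ 0 := by rintro rfl; simp at hyv
  refine ⟨algebraMap (𝓞 K) K y, coe_ne hy0, hyv, fun w hw hwv => ?_⟩
  have h2 := hy w hw
  simp only [if_neg hwv] at h2
  rw [ord_int_eq_zero_iff w hy0]
  intro h3
  have h4 := Ideal.pow_le_self two_ne_zero h2
  apply w.isPrime.ne_top
  rw [Ideal.eq_top_iff_one]
  have := sub_mem h3 h4
  simpa using this

lemma exists_prescribed_on (S : Finset (Pl K)) (k : Pl K → ℤ) :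
    ∃ t : K, t ≠ 0 ∧ ∀ v ∈ S, ord v t = k v := by
  classical
  have : ∀ v : Pl K, ∃ p : K, p ≠ 0 ∧ (v ∈ S → ord v p = 1 ∧ ∀ w ∈ S, w ≠ v → ord w p = 0) := by
    intro v
    by_cases hv : v ∈ S
    · obtain ⟨p, h1, h2, h3⟩ := exists_unif_on S v hv
      exact ⟨p, h1, fun _ => ⟨h2, h3⟩⟩
    · exact ⟨1, one_ne_zero, fun h => absurd h hv⟩
  choose p hp0 hp using this
  refine ⟨∏ v ∈ S, p v ^ k v, Finset.prod_ne_zero_iff.2 fun i _ => zpow_ne_zero _ (hp0 i), ?_⟩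
  intro v hv
  rw [ord_prod _ _ _ (fun i _ => zpow_ne_zero _ (hp0 i))]
  simp_rw [ord_zpow]
  rw [Finset.sum_eq_single v, (hp v hv).1, mul_one]
  · intro i hi hiv
    rw [(hp i hi).2 v hv (Ne.symm hiv), mul_zero]
  · exact fun h => absurd hv h

lemma exists_clear (S : Finset (Pl K)) (y : K) (hy : y ≠ 0) (h : ∀ v ∈ S, 0 ≤ ord v y) :
    ∃ b a : 𝓞 K, b ≠ 0 ∧ (∀ v ∈ S, ord v (algebraMap (𝓞 K) K b) = 0) ∧
      algebraMap (𝓞 K) K b * y = algebraMap (𝓞 K) K a := by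
  classical
  choose a ha0 ha1 ha2 using fun v : Pl K => exists_supp_single v
  set T : Finset (Pl K) := (ord_finite hy).toFinset.filter (· ∉ S)
  have hT : ∀ v, v ∈ T ↔ ord v y ≠ 0 ∧ v ∉ S := by intro v; simp [T]
  have hb0 : ∏ v ∈ T, a v ^ (ord v y).natAbs ≠ 0 :=
    Finset.prod_ne_zero_iff.2 fun i _ => pow_ne_zero _ (ha0 i)
  have hbord : ∀ v, ord v (algebraMap (𝓞 K) K (∏ v ∈ T, a v ^ (ord v y).natAbs)) =
      if v ∈ T then (ord v y).natAbs * ord v (algebraMap (𝓞 K) K (a v)) else 0 := by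
    intro v
    rw [map_prod, ord_prod _ _ _ (fun i _ => coe_ne (pow_ne_zero _ (ha0 i)))]
    simp_rw [map_pow, ord_pow]
    split_ifs with hv
    · rw [Finset.sum_eq_single v]
      · intro i hi hiv
        rw [ha2 i v (Ne.symm hiv), mul_zero]
      · exact fun h => absurd hv h
    · apply Finset.sum_eq_zero
      intro i hi
      rw [ha2 i v (by rintro rfl; exact hv hi), mul_zero]
  obtain ⟨c, hc⟩ := exists_int_of_ord_nonneg (x := algebraMap (𝓞 K) K (∏ v ∈ T, a v ^ (ord v y).natAbs) * y) (by
    intro v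
    rw [ord_mul v (coe_ne hb0) hy, hbord]
    split_ifs with hv
    · have := ha1 v
      have h2 : ((ord v y).natAbs : ℤ) ≤ (ord v y).natAbs * ord v (algebraMap (𝓞 K) K (a v)) :=
        le_mul_of_one_le_right (by positivity) this
      omega
    · rw [hT] at hv
      by_cases h2 : v ∈ S
      · have := h v h2; omega
      · have : ord v y = 0 := by by_contra h3; exact hv ⟨h3, h2⟩
        omega)
  refine ⟨_, c, hb0, fun v hv => ?_, hc.symm⟩
  rw [hbord, if_neg]
  rw [hT]; exact fun h => h.2 hv

/-- normalization -/
lemma exists_normalize (S : Finset (Pl K)) (x : K) (hx : x ≠ 0) (h : ∀ v ∈ S, Even (ord v x)) :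
    ∃ t : K, t ≠ 0 ∧ ∃ d : 𝓞 K, d ≠ 0 ∧ x = t ^ 2 * algebraMap (𝓞 K) K d ∧ ∀ v ∈ S, d ∉ v.asIdeal := by
  obtain ⟨τ, hτ0, hτ⟩ := exists_prescribed_on S (fun v => ord v x / 2)
  have hy0 : x / τ ^ 2 ≠ 0 := div_ne_zero hx (pow_ne_zero _ hτ0)
  have hy : ∀ v ∈ S, ord v (x / τ ^ 2) = 0 := by
    intro v hv
    rw [ord_div v hx (pow_ne_zero _ hτ0), ord_pow, hτ v hv]
    obtain ⟨k, hk⟩ := h v hv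
    push_cast; omega
  obtain ⟨b, a, hb0, hb, hab⟩ := exists_clear S _ hy0 (fun v hv => (hy v hv).ge)
  have hbK := coe_ne hb0
  have ha0 : a ≠ 0 := by
    rintro rfl
    rw [map_zero] at hab
    exact mul_ne_zero hbK hy0 hab
  have hba0 : b * a ≠ 0 := mul_ne_zero hb0 ha0
  refine ⟨τ / algebraMap (𝓞 K) K b, div_ne_zero hτ0 hbK, b * a, hba0, ?_, fun v hv => ?_⟩
  · rw [map_mul, ← hab]; field_simp
  · rw [← ord_int_eq_zero_iff v hba0]
    change ord v (algebraMap (𝓞 K) K (b * a)) = 0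
    rw [map_mul, ← hab, ord_mul v hbK (mul_ne_zero hbK hy0), ord_mul v hbK hy0, hb v hv, hy v hv]
    simp

/-- number of square roots of one mod `4 * N` -/
lemma card_two_torsion (st : Setup K) :
    Nat.card {x : 𝓞 K ⧸ Ideal.span {(4 * st.N : 𝓞 K)} // x ^ 2 = 1} ≤ 2 ^ (st.S.card + finrank ℚ K) := by
  classical
  set I := Ideal.span {(4 * st.N : 𝓞 K)} with hI
  have hNK : (st.N : K) ≠ 0 := by exact_mod_cast st.hN
  have hNO : (st.N : 𝓞 K) ≠ 0 := by exact_mod_cast st.hN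
  have h1 : ∀ x : {x : 𝓞 K ⧸ I // x ^ 2 = 1}, ∃ y k : 𝓞 K, Ideal.Quotient.mk I (1 + 2 * y) = x.1 ∧ y * (y + 1) = st.N * k := by
    rintro ⟨x, hx⟩
    obtain ⟨X, rfl⟩ := Ideal.Quotient.mk_surjective x
    rw [← map_pow, ← map_one (Ideal.Quotient.mk I), Ideal.Quotient.eq, hI, Ideal.mem_span_singleton] at hx
    obtain ⟨k, hk⟩ := hx
    set z : K := (algebraMap (𝓞 K) K X - 1) / 2 with hz
    have hz2 : z ^ 2 + z = algebraMap (𝓞 K) K (st.N * k) := by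
      have := congrArg (algebraMap (𝓞 K) K) hk
      simp only [map_sub, map_pow, map_mul, map_natCast, map_one, map_ofNat] at this ⊢
      rw [hz]; linear_combination (1 / 4) * this
    have hIntg : IsIntegral (𝓞 K) z := by
      refine ⟨Polynomial.X ^ 2 + Polynomial.X - Polynomial.C (st.N * k), ?_, ?_⟩
      · have : (Polynomial.X ^ 2 + Polynomial.X - Polynomial.C (st.N * k) : Polynomial (𝓞 K)) =
          Polynomial.X ^ 2 + (Polynomial.X - Polynomial.C (st.N * k)) := by ring
        rw [this]
        apply Polynomial.monic_X_pow_add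
        compute_degree!
      · simp only [Polynomial.eval₂_sub, Polynomial.eval₂_add, Polynomial.eval₂_pow, Polynomial.eval₂_X, Polynomial.eval₂_C]
        rw [hz2, sub_self]
    have hIntg2 : IsIntegral ℤ z := isIntegral_trans (A := 𝓞 K) z hIntg
    obtain ⟨y, hy⟩ : ∃ y : 𝓞 K, algebraMap (𝓞 K) K y = z := ⟨⟨z, hIntg2⟩, rfl⟩
    refine ⟨y, k, ?_, ?_⟩
    · congr 1
      apply RingOfIntegers.ext
      change algebraMap (𝓞 K) K (1 + 2 * y) = algebraMap (𝓞 K) K X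
      rw [map_add, map_mul, hy, hz, map_one, map_ofNat]; ring
    · apply RingOfIntegers.ext
      change algebraMap (𝓞 K) K (y * (y + 1)) = algebraMap (𝓞 K) K _
      rw [← hz2, map_mul, map_add, hy, map_one]; ring
  choose y k hy hk using h1
  let pat : {x : 𝓞 K ⧸ I // x ^ 2 = 1} → Finset st.S := fun x => Finset.univ.filter (fun v => y x ∈ (v : Pl K).asIdeal)
  have hdiff : ∀ x x', pat x = pat x' → ∃ z : 𝓞 K, y x - y x' = st.N * z := by
    intro x x' hp
    have hp' : ∀ v ∈ st.S, y x ∈ v.asIdeal ↔ y x' ∈ v.asIdeal := by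
      intro v hv
      have := congrArg (fun s => (⟨v, hv⟩ : st.S) ∈ s) hp
      simpa [pat] using this
    -- key local fact
    have hloc : ∀ (a : {x : 𝓞 K ⧸ I // x ^ 2 = 1}) (v : Pl K), 
        (y a ∈ v.asIdeal → v.valuation K (algebraMap (𝓞 K) K (y a)) ≤ v.valuation K (st.N : K)) ∧
        (y a ∉ v.asIdeal → v.valuation K (algebraMap (𝓞 K) K (y a + 1)) ≤ v.valuation K (st.N : K)) := by
      intro a v
      have e := congrArg (fun z => v.valuation K (algebraMap (𝓞 K) K z)) (hk a)
      simp only [map_mul, map_natCast] at e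
      have hk1 : v.valuation K (algebraMap (𝓞 K) K (k a)) ≤ 1 := v.valuation_le_one _
      constructor
      · intro h
        have h2 : y a + 1 ∉ v.asIdeal := by
          intro h3
          apply v.isPrime.ne_top
          rw [Ideal.eq_top_iff_one]
          have := sub_mem h3 h
          simpa using this
        rw [(v.valuation_eq_one_iff_notMem (K := K)).2 h2, mul_one] at e
        rw [e]; exact mul_le_of_le_one_right' hk1
      · intro h
        rw [(v.valuation_eq_one_iff_notMem (K := K)).2 h, one_mul] at e
        rw [e]; exact mul_le_of_le_one_right' hk1
    have hall : ∀ v : Pl K, 0 ≤ ord v (algebraMap (𝓞 K) K (y x - y x') / st.N) := by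
      intro v
      by_cases h0 : algebraMap (𝓞 K) K (y x - y x') = 0
      · rw [h0]; simp
      rw [ord_nonneg_iff v (div_ne_zero h0 hNK), map_div₀]
      apply div_le_one_of_le₀ _ (by simp)
      by_cases hv : v ∈ st.S
      · by_cases h : y x ∈ v.asIdeal
        · rw [map_sub]
          exact (Valuation.map_sub _ _ _).trans (max_le ((hloc x v).1 h) ((hloc x' v).1 ((hp' v hv).1 h)))
        · have : y x - y x' = (y x + 1) - (y x' + 1) := by ring
          rw [this, map_sub]
          exact (Valuation.map_sub _ _ _).trans (max_le ((hloc x v).2 h) ((hloc x' v).2 (fun h2 => h ((hp' v hv).2 h2))))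
      · have : (st.N : 𝓞 K) ∉ v.asIdeal := fun h => hv ((st.hS v).2 h)
        have := (v.valuation_eq_one_iff_notMem (K := K)).2 this
        rw [map_natCast] at this
        rw [this]; exact v.valuation_le_one _
    obtain ⟨z, hz⟩ := exists_int_of_ord_nonneg hall
    refine ⟨z, ?_⟩
    apply RingOfIntegers.ext
    change algebraMap (𝓞 K) K _ = algebraMap (𝓞 K) K _
    have hz' : algebraMap (𝓞 K) K z = algebraMap (𝓞 K) K (y x - y x') / st.N := hz
    rw [map_mul, hz', map_natCast]; field_simp
  -- reference
  have href : ∃ ref : Finset st.S → {x : 𝓞 K ⧸ I // x ^ 2 = 1}, ∀ x, pat (ref (pat x)) = pat x := by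
    refine ⟨fun s => if h : ∃ x, pat x = s then h.choose else ⟨1, by simp⟩, fun x => ?_⟩
    have h : ∃ x', pat x' = pat x := ⟨x, rfl⟩
    simp only [dif_pos h]
    exact h.choose_spec
  obtain ⟨ref, href⟩ := href
  choose z hz using fun x => hdiff x (ref (pat x)) (href x).symm
  have h2ne : (2 : 𝓞 K) ≠ 0 := two_ne_zero
  have habs : Nat.card (𝓞 K ⧸ Ideal.span {(2 : 𝓞 K)}) = 2 ^ finrank ℚ K := by
    have h := Ideal.absNorm_span_singleton (2 : 𝓞 K)
    have h3 : Algebra.norm ℤ (2 : 𝓞 K) = 2 ^ finrank ℤ (𝓞 K) := by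
      have := Algebra.norm_algebraMap_of_basis (RingOfIntegers.basis K) (2 : ℤ)
      rw [map_ofNat] at this
      rw [this, finrank_eq_card_basis (RingOfIntegers.basis K)]
    rw [h3, RingOfIntegers.rank] at h
    rw [Ideal.absNorm_apply, Submodule.cardQuot_apply] at h
    rw [h, Int.natAbs_pow]; rfl
  haveI : Finite (𝓞 K ⧸ Ideal.span {(2 : 𝓞 K)}) := Nat.finite_of_card_ne_zero (by rw [habs]; positivity)
  let F : {x : 𝓞 K ⧸ I // x ^ 2 = 1} → Finset st.S × (𝓞 K ⧸ Ideal.span {(2 : 𝓞 K)}) :=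
    fun x => (pat x, Ideal.Quotient.mk _ (z x))
  have hF : Function.Injective F := by
    intro x x' h
    have e1 : pat x = pat x' := congrArg Prod.fst h
    have e2 : Ideal.Quotient.mk (Ideal.span {(2 : 𝓞 K)}) (z x) = Ideal.Quotient.mk _ (z x') := congrArg Prod.snd h
    rw [Ideal.Quotient.eq, Ideal.mem_span_singleton] at e2
    obtain ⟨m, hm⟩ := e2
    apply Subtype.ext
    rw [← hy x, ← hy x', Ideal.Quotient.eq, hI, Ideal.mem_span_singleton]
    refine ⟨m, ?_⟩
    have a1 := hz x
    have a2 := hz x'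
    rw [← e1] at a2
    linear_combination 2 * a1 - 2 * a2 + 2 * st.N * hm
  have := Nat.card_le_card_of_injective F hF
  rw [Nat.card_prod, habs] at this
  refine this.trans (le_of_eq ?_)
  rw [Nat.card_eq_fintype_card, Fintype.card_finset, Fintype.card_coe, pow_add]

end FiveSq

end

section
open Module NumberField IsDedekindDomain

namespace FiveSq

variable {K : Type*} [Field K] [NumberField K]

lemma Setup.mem_of_four (st : Setup K) {v : Pl K} (h : (4 * st.N : 𝓞 K) ∈ v.asIdeal) : v ∈ st.S := by
  rw [st.hS]
  rcases v.isPrime.mem_or_mem h with h | h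
  · have h4 : (4 : 𝓞 K) = 2 * 2 := by norm_num
    rw [h4] at h
    have h2 : (2 : 𝓞 K) ∈ v.asIdeal := by
      rcases v.isPrime.mem_or_mem h with h | h <;> exact h
    obtain ⟨k, hk⟩ := st.two
    rw [hk]; push_cast
    exact Ideal.mul_mem_right _ _ h2
  · exact h

lemma Setup.mem_four (st : Setup K) {v : Pl K} (h : v ∈ st.S) : (4 * st.N : 𝓞 K) ∈ v.asIdeal :=
  Ideal.mul_mem_left _ _ ((st.hS v).1 h)

lemma Setup.four_ne (st : Setup K) : (4 * st.N : 𝓞 K) ≠ 0 := by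
  have : (st.N : 𝓞 K) ≠ 0 := by exact_mod_cast st.hN
  have h4 : ((4 : ℕ) : 𝓞 K) ≠ 0 := Nat.cast_ne_zero.2 (by norm_num)
  exact mul_ne_zero (by exact_mod_cast h4) this

lemma Setup.isUnit (st : Setup K) {d : 𝓞 K} (hd : ∀ v ∈ st.S, d ∉ v.asIdeal) :
    IsUnit (Ideal.Quotient.mk (Ideal.span {(4 * st.N : 𝓞 K)}) d) := by
  by_contra h
  obtain ⟨m, hm, hdm⟩ := exists_max_ideal_of_mem_nonunits (mem_nonunits_iff.2 h)
  have hp : (m.comap (Ideal.Quotient.mk (Ideal.span {(4 * st.N : 𝓞 K)}))).IsPrime := hm.isPrime.comap _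
  have h4 : (4 * st.N : 𝓞 K) ∈ m.comap (Ideal.Quotient.mk (Ideal.span {(4 * st.N : 𝓞 K)})) := by
    rw [Ideal.mem_comap, Ideal.Quotient.eq_zero_iff_mem.2 (Ideal.mem_span_singleton_self _)]
    exact zero_mem _
  let v : Pl K := ⟨_, hp, fun h => st.four_ne (by rw [h] at h4; simpa using h4)⟩
  exact hd v (st.mem_of_four (v := v) h4) hdm

lemma not_mem_of_isUnit (st : Setup K) {d : 𝓞 K}
    (h : IsUnit (Ideal.Quotient.mk (Ideal.span {(4 * st.N : 𝓞 K)}) d)) : ∀ v ∈ st.S, d ∉ v.asIdeal := by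
  intro v hv hd
  obtain ⟨x, hx⟩ := h.exists_right_inv
  obtain ⟨e, rfl⟩ := Ideal.Quotient.mk_surjective x
  rw [← map_mul, ← map_one (Ideal.Quotient.mk _), Ideal.Quotient.eq, Ideal.mem_span_singleton] at hx
  obtain ⟨k, hk⟩ := hx
  apply v.isPrime.ne_top
  rw [Ideal.eq_top_iff_one]
  have : (1 : 𝓞 K) = d * e - 4 * st.N * k := by rw [← hk]; ring
  rw [this]
  exact sub_mem (Ideal.mul_mem_right _ _ hd) (Ideal.mul_mem_right _ _ (st.mem_four hv))

lemma Setup.finite_quot (st : Setup K) : Finite (𝓞 K ⧸ Ideal.span {(4 * st.N : 𝓞 K)}) :=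
  Ideal.finiteQuotientOfFreeOfNeBot _ (by
    rw [Ne, Ideal.span_singleton_eq_bot]; exact st.four_ne)

lemma exists_psi (st : Setup K) : ∃ (A : Type) (_ : Finite A) (Ψ : Kˣ → A),
    Nat.card A ≤ 2 ^ (st.S.card + (st.S.card + finrank ℚ K)) ∧
    ∀ x y : Kˣ, Ψ x = Ψ y → InH st ((x * y : Kˣ) : K) := by
  classical
  haveI := st.finite_quot
  let O4 := 𝓞 K ⧸ Ideal.span {(4 * st.N : 𝓞 K)}
  let f : O4ˣ →* O4ˣ := powMonoidHom 2
  have hidx : f.range.index ≤ 2 ^ (st.S.card + finrank ℚ K) := by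
    rw [Subgroup.index_range]
    refine le_trans ?_ (card_two_torsion st)
    let g : f.ker → {x : O4 // x ^ 2 = 1} := fun u => ⟨((u : O4ˣ) : O4), by
      have h : (u : O4ˣ) ^ 2 = 1 := u.2
      rw [← Units.val_pow_eq_pow_val, h]; rfl⟩
    apply Nat.card_le_card_of_injective g
    intro a b h
    apply Subtype.ext
    apply Units.ext
    exact congrArg Subtype.val h
  -- parity pattern
  let pat : Kˣ → Finset st.S := fun x => Finset.univ.filter (fun v => Odd (ord (v : Pl K) (x : K)))
  have href : ∃ ref : Finset st.S → Kˣ, ∀ x, pat (ref (pat x)) = pat x := by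
    refine ⟨fun s => if h : ∃ x, pat x = s then h.choose else 1, fun x => ?_⟩
    have h : ∃ x', pat x' = pat x := ⟨x, rfl⟩
    simp only [dif_pos h]
    exact h.choose_spec
  obtain ⟨ref, href⟩ := href
  have hev : ∀ x : Kˣ, ∀ v ∈ st.S, Even (ord v ((x * ref (pat x) : Kˣ) : K)) := by
    intro x v hv
    have h : Odd (ord v (ref (pat x) : K)) ↔ Odd (ord v (x : K)) := by
      have := congrArg (fun s => (⟨v, hv⟩ : st.S) ∈ s) (href x)
      simpa [pat] using this
    rw [Units.val_mul, ord_mul v x.ne_zero (Units.ne_zero _), Int.even_add]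
    rw [← Int.not_odd_iff_even, ← Int.not_odd_iff_even, h]
  choose t ht0 d hd0 hd1 hd2 using fun x : Kˣ => exists_normalize st.S _ (Units.ne_zero _) (hev x)
  have hunit : ∀ x, ∃ u : O4ˣ, (u : O4) = Ideal.Quotient.mk _ (d x) := fun x => st.isUnit (hd2 x)
  choose u hu using hunit
  let Q := O4ˣ ⧸ f.range
  haveI : Finite Q := inferInstance
  obtain ⟨n, ⟨eq⟩⟩ := Finite.exists_equiv_fin (Finset st.S × Q)
  refine ⟨Fin n, inferInstance, fun x => eq (pat x, QuotientGroup.mk (u x)), ?_, ?_⟩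
  · rw [← Nat.card_congr eq, Nat.card_prod, Nat.card_eq_fintype_card (α := Finset st.S), Fintype.card_finset, Fintype.card_coe, pow_add]
    exact Nat.mul_le_mul_left _ hidx
  · intro x y h
    have h := eq.injective h
    have e1 : pat x = pat y := congrArg Prod.fst h
    have e2 : (QuotientGroup.mk (u x) : Q) = QuotientGroup.mk (u y) := congrArg Prod.snd h
    rw [QuotientGroup.eq] at e2
    obtain ⟨g, hg⟩ := e2
    have hg1 : (u x * g) ^ 2 = u x * u y := by
      have : g ^ 2 = (u x)⁻¹ * u y := hg
      rw [mul_pow, this, pow_two]; simp [mul_assoc]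
    obtain ⟨c, hc⟩ := Ideal.Quotient.mk_surjective ((u x * g : O4ˣ) : O4)
    have hcu : ∀ v ∈ st.S, c ∉ v.asIdeal := not_mem_of_isUnit st (by rw [hc]; exact Units.isUnit _)
    have hk : Ideal.Quotient.mk (Ideal.span {(4 * st.N : 𝓞 K)}) (d x * d y) = Ideal.Quotient.mk _ (c ^ 2) := by
      rw [map_mul, map_pow, hc, ← hu, ← hu, ← Units.val_pow_eq_pow_val, hg1, Units.val_mul]
    rw [Ideal.Quotient.eq, Ideal.mem_span_singleton] at hk
    obtain ⟨k, hk⟩ := hk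
    have hx := hd1 x
    have hy := hd1 y
    rw [← e1] at hy
    refine InH.of_sq_mul (s := (ref (pat x) : K)) (Units.ne_zero _) ⟨t x * t y, mul_ne_zero (ht0 x) (ht0 y), d x * d y, c, k, ?_, hk, hcu⟩
    rw [Units.val_mul] at hx hy ⊢
    rw [map_mul]
    linear_combination (y : K) * ref (pat x) * hx + t x ^ 2 * (algebraMap (𝓞 K) K (d x)) * hy

lemma SU_root {S : Set (Pl K)} {x : Kˣ} (h : x ^ 2 ∈ SU S) : x ∈ SU S := by
  intro v hv
  have := h v hv
  rw [Units.val_pow_eq_pow_val, ord_pow] at this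
  simpa using this

theorem exists_InH (st : Setup K) (S' : Finset (Pl K))
    (hcard : st.S.card + (st.S.card + finrank ℚ K) < Units.rank K + 1 + S'.card) :
    ∃ d : Kˣ, d ∈ SU (S' : Set (Pl K)) ∧ ¬ IsSquare (d : K) ∧ InH st (d : K) := by
  classical
  obtain ⟨A, _, Ψ, hA, hΨ⟩ := exists_psi st
  let G := SU (S' : Set (Pl K))
  let f : G →* G := powMonoidHom 2
  have hi : Nat.card (G ⧸ f.range) = 2 ^ (Units.rank K + 1 + S'.card) := SU_sq_index S'
  have hlt : Nat.card A < Nat.card (G ⧸ f.range) := by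
    rw [hi]
    exact hA.trans_lt (Nat.pow_lt_pow_right (by norm_num) hcard)
  haveI : Finite (G ⧸ f.range) := Nat.finite_of_card_ne_zero (by omega)
  have hni : ¬ Function.Injective (fun g : G ⧸ f.range => Ψ (g.out : G)) := by
    intro h
    exact absurd (Nat.card_le_card_of_injective _ h) (not_le.2 hlt)
  simp only [Function.Injective, not_forall] at hni
  obtain ⟨a, b, hab, hne⟩ := hni
  refine ⟨((a.out : G) : Kˣ) * ((b.out : G) : Kˣ), mul_mem a.out.2 b.out.2, ?_, hΨ _ _ hab⟩
  rintro ⟨r, hr⟩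
  apply hne
  rw [← QuotientGroup.out_eq' a, ← QuotientGroup.out_eq' b, QuotientGroup.eq]
  have ha0 := ((a.out : G) : Kˣ).ne_zero
  have hb0 := ((b.out : G) : Kˣ).ne_zero
  have hr0 : r ≠ 0 := by
    rintro rfl
    simp at hr
  have hz : (Units.mk0 r hr0 * ((a.out : G) : Kˣ)⁻¹) ^ 2 = ((a.out : G) : Kˣ)⁻¹ * ((b.out : G) : Kˣ) := by
    ext
    simp only [Units.val_pow_eq_pow_val, Units.val_mul, Units.val_inv_eq_inv_val, Units.val_mk0] at hr ⊢
    rw [mul_pow, pow_two r, ← hr]; field_simp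
  refine ⟨⟨Units.mk0 r hr0 * ((a.out : G) : Kˣ)⁻¹, SU_root ?_⟩, ?_⟩
  · rw [hz]; exact mul_mem (inv_mem a.out.2) b.out.2
  · apply Subtype.ext
    exact hz

end FiveSq

end

section
open Module NumberField IsDedekindDomain

namespace FiveSq

variable {K : Type*} [Field K] [NumberField K]

/-- `d` is a square in the completion at `v` (Newton criterion) -/
def LocSq (v : Pl K) (d : K) : Prop := ∃ t : K, t ≠ 0 ∧ v.valuation K ((d - t ^ 2) / (4 * t ^ 2)) < 1

lemma four_ne_K : (4 : K) ≠ 0 := by norm_num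

lemma LocSq.mul_sq {v : Pl K} {d : K} (h : LocSq v d) {s : K} (hs : s ≠ 0) : LocSq v (d * s ^ 2) := by
  obtain ⟨t, ht, h⟩ := h
  refine ⟨t * s, mul_ne_zero ht hs, ?_⟩
  have : (d * s ^ 2 - (t * s) ^ 2) / (4 * (t * s) ^ 2) = (d - t ^ 2) / (4 * t ^ 2) := by
    field_simp
  rwa [this]

lemma val_four_le (v : Pl K) : v.valuation K 4 ≤ 1 := by
  have : v.valuation K (algebraMap (𝓞 K) K 4) ≤ 1 := v.valuation_le_one (K := K) (4 : 𝓞 K)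
  rwa [map_ofNat] at this

lemma val_two_le (v : Pl K) : v.valuation K 2 ≤ 1 := by
  have : v.valuation K (algebraMap (𝓞 K) K 2) ≤ 1 := v.valuation_le_one (K := K) (2 : 𝓞 K)
  rwa [map_ofNat] at this

lemma val_lt_one_iff (v : Pl K) (x : K) : v.valuation K x < 1 ↔ v.valuation K x ≤ WithZero.exp (-(((0 : ℕ) : ℤ) + 1)) := by
  by_cases hx : x = 0
  · simp [hx]
  · rw [← ord_pos_iff v hx, ← WithZero.log_le_iff_le_exp (val_ne_zero v hx)]
    unfold ord; push_cast; omega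

lemma mem_pow_iff (v : Pl K) (a : 𝓞 K) (n : ℕ) :
    a ∈ v.asIdeal ^ n ↔ v.valuation K (algebraMap (𝓞 K) K a) ≤ WithZero.exp (-(n : ℤ)) := by
  rw [v.valuation_of_algebraMap, ← v.intValuation_le_pow_iff_mem]

/-- Newton iteration -/
lemma LocSq.newton {v : Pl K} {d : K} (h : LocSq v d) (n : ℕ) :
    ∃ t : K, t ≠ 0 ∧ v.valuation K ((d - t ^ 2) / (4 * t ^ 2)) ≤ WithZero.exp (-((n : ℤ) + 1)) := by
  induction n with
  | zero =>
    obtain ⟨t, ht, h⟩ := h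
    refine ⟨t, ht, ?_⟩
    exact (val_lt_one_iff v _).1 h
  | succ n ih =>
    obtain ⟨t, ht, h⟩ := ih
    set ε := (d - t ^ 2) / (4 * t ^ 2) with hε
    have h1 : v.valuation K ε < 1 := by
      refine h.trans_lt ?_
      rw [← WithZero.exp_zero, WithZero.exp_lt_exp]; omega
    have h2 : v.valuation K (1 + 2 * ε) = 1 := by
      apply Valuation.map_one_add_of_lt
      rw [map_mul]
      exact mul_lt_one_of_nonneg_of_lt_one_right (val_two_le v) zero_le' h1
    have h3 : (1 + 2 * ε) ≠ 0 := by intro h0; rw [h0] at h2; simp at h2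
    refine ⟨t * (1 + 2 * ε), mul_ne_zero ht h3, ?_⟩
    have hd : d = t ^ 2 * (1 + 4 * ε) := by rw [hε]; field_simp; ring
    have : (d - (t * (1 + 2 * ε)) ^ 2) / (4 * (t * (1 + 2 * ε)) ^ 2) = - ε ^ 2 / (1 + 2 * ε) ^ 2 := by
      rw [hd]; field_simp; ring
    rw [this, map_div₀, map_pow, h2, Valuation.map_neg, map_pow]
    simp only [one_pow, div_one]
    calc (v.valuation K ε) ^ 2 = v.valuation K ε * v.valuation K ε := sq _
      _ ≤ WithZero.exp (-((n : ℤ) + 1)) * WithZero.exp (-((n : ℤ) + 1)) := mul_le_mul' h h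
      _ = WithZero.exp (-((n : ℤ) + 1) + -((n : ℤ) + 1)) := (WithZero.exp_add _ _).symm
      _ ≤ _ := by rw [WithZero.exp_le_exp]; push_cast; omega

lemma LocSq.even {v : Pl K} {d : K} (h : LocSq v d) : Even (ord v d) := by
  obtain ⟨t, ht, h⟩ := h
  set ε := (d - t ^ 2) / (4 * t ^ 2) with hε
  have hd : d = t ^ 2 * (1 + 4 * ε) := by rw [hε]; field_simp; ring
  have h2 : v.valuation K (1 + 4 * ε) = 1 := by
    apply Valuation.map_one_add_of_lt
    rw [map_mul]
    exact mul_lt_one_of_nonneg_of_lt_one_right (val_four_le v) zero_le' h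
  have h3 : (1 + 4 * ε) ≠ 0 := by intro h0; rw [h0] at h2; simp at h2
  rw [hd, ord_mul v (pow_ne_zero _ ht) h3, (ord_eq_zero_iff v h3).2 h2, ord_pow]
  simp

lemma LocSq.of_sqMod {v : Pl K} {d : K} (hd : v.valuation K d = 1) (h2 : v.valuation K 2 = 1) (h : SqMod v d) : LocSq v d := by
  obtain ⟨t, ht⟩ := id h
  have h1 : v.valuation K t = 1 := SqMod.val_t hd ht
  refine ⟨t, by rintro rfl; simp at h1, ?_⟩
  have h4 : v.valuation K 4 = 1 := by
    rw [show (4 : K) = 2 * 2 by norm_num, map_mul, h2, one_mul]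
  rw [map_div₀, map_mul, map_pow, h1, h4]; simpa using ht

lemma InH.locSq {st : Setup K} {d : K} (h : InH st d) {v : Pl K} (hv : v ∈ st.S) : LocSq v d := by
  obtain ⟨t, ht, d₀, c, k, rfl, h1, hc⟩ := h
  have hc0 : c ≠ 0 := by rintro rfl; exact hc v hv (zero_mem _)
  have hcK := coe_ne hc0
  have h2 : algebraMap (𝓞 K) K d₀ - (algebraMap (𝓞 K) K c) ^ 2 = 4 * algebraMap (𝓞 K) K (st.N) * algebraMap (𝓞 K) K k := by
    rw [← map_pow, ← map_sub, h1, map_mul, map_mul, map_ofNat]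
  have : LocSq v (algebraMap (𝓞 K) K d₀) := by
    refine ⟨algebraMap (𝓞 K) K c, hcK, ?_⟩
    rw [h2]
    have e : (4 * algebraMap (𝓞 K) K (st.N) * algebraMap (𝓞 K) K k) / (4 * (algebraMap (𝓞 K) K c) ^ 2)
      = algebraMap (𝓞 K) K (st.N * k) / (algebraMap (𝓞 K) K c) ^ 2 := by
      rw [map_mul]; field_simp
    have hcv : v.valuation K (algebraMap (𝓞 K) K c) = 1 :=
      (ord_eq_zero_iff v hcK).1 ((ord_int_eq_zero_iff v hc0).2 (hc v hv))
    rw [e, map_div₀, map_pow, hcv, one_pow, div_one]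
    exact (v.valuation_lt_one_iff_mem _).2 (Ideal.mul_mem_right _ _ ((st.hS v).1 hv))
  rw [mul_comm]; exact this.mul_sq ht

lemma LocSq.up {L : Type*} [Field L] [NumberField L] [Algebra K L] {w : Pl L} {d : K} (h : LocSq (under K w) d) :
    LocSq w (algebraMap K L d) := by
  obtain ⟨t, ht, h⟩ := h
  refine ⟨algebraMap K L t, by simpa using ht, ?_⟩
  have := val_under_lt (L := L) h
  simpa only [map_div₀, map_sub, map_mul, map_pow, map_ofNat] using this

/-- local-global criterion for `InH` -/
lemma InH.of_locSq (st : Setup K) (d : K) (hd : d ≠ 0) (h : ∀ v ∈ st.S, LocSq v d) : InH st d := by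
  classical
  obtain ⟨t, ht, d₀, hd0, rfl, hcop⟩ := exists_normalize st.S d hd (fun v hv => (h v hv).even)
  have hdK := coe_ne hd0
  -- local square roots
  have hN0 : (4 * st.N : 𝓞 K) ≠ 0 := st.four_ne
  obtain ⟨n, hn⟩ : ∃ n : ℕ, ∀ v ∈ st.S, ord v (algebraMap (𝓞 K) K (4 * st.N)) ≤ n := by
    refine ⟨∑ v ∈ st.S, (ord v (algebraMap (𝓞 K) K (4 * st.N))).toNat, fun v hv => ?_⟩
    push_cast
    refine (Int.self_le_toNat _).trans ?_
    exact Finset.single_le_sum (f := fun v => (((ord v (algebraMap (𝓞 K) K (4 * st.N))).toNat : ℕ) : ℤ)) (fun i _ => Int.natCast_nonneg _) hv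
  have hloc : ∀ v ∈ st.S, ∃ c : 𝓞 K, c ∉ v.asIdeal ∧ d₀ - c ^ 2 ∈ v.asIdeal ^ n := by
    intro v hv
    have h1 : LocSq v (algebraMap (𝓞 K) K d₀) := by
      have := (h v hv).mul_sq (inv_ne_zero ht)
      rwa [show t ^ 2 * algebraMap (𝓞 K) K d₀ * t⁻¹ ^ 2 = algebraMap (𝓞 K) K d₀ by field_simp] at this
    obtain ⟨x, hx, h2⟩ := h1.newton n
    set ε := (algebraMap (𝓞 K) K d₀ - x ^ 2) / (4 * x ^ 2) with hε
    have hd1 : v.valuation K (algebraMap (𝓞 K) K d₀) = 1 :=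
      (ord_eq_zero_iff v hdK).1 ((ord_int_eq_zero_iff v hd0).2 (hcop v hv))
    have hlt : v.valuation K ε < 1 := by
      refine h2.trans_lt ?_
      rw [← WithZero.exp_zero, WithZero.exp_lt_exp]; omega
    have h4 : v.valuation K (1 + 4 * ε) = 1 := by
      apply Valuation.map_one_add_of_lt
      rw [map_mul]
      exact mul_lt_one_of_nonneg_of_lt_one_right (val_four_le v) zero_le' hlt
    have hde : algebraMap (𝓞 K) K d₀ = x ^ 2 * (1 + 4 * ε) := by rw [hε]; field_simp; ring
    have hx1 : v.valuation K x = 1 := by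
      rw [hde, map_mul, h4, mul_one, map_pow] at hd1
      exact (pow_eq_one_iff_of_nonneg zero_le' two_ne_zero).1 hd1
    obtain ⟨c, hc⟩ := v.exists_valuation_sub_lt_of_integer (x := x) hx1.le (Units.mk0 (WithZero.exp (-((n : ℤ) + 1))) WithZero.exp_ne_zero)
    simp only [Units.val_mk0] at hc
    have hc1 : v.valuation K (algebraMap (𝓞 K) K c) = 1 := by
      have := Valuation.map_add_eq_of_lt_right (v := v.valuation K) (x := algebraMap (𝓞 K) K c - x) (y := x) (by
        rw [hx1]; refine hc.trans ?_
        rw [← WithZero.exp_zero, WithZero.exp_lt_exp]; omega)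
      rwa [sub_add_cancel, hx1] at this
    refine ⟨c, ?_, ?_⟩
    · rw [← v.valuation_lt_one_iff_mem (K := K), hc1]; exact lt_irrefl _
    · rw [mem_pow_iff]
      have e : algebraMap (𝓞 K) K (d₀ - c ^ 2) = 4 * x ^ 2 * ε - (algebraMap (𝓞 K) K c - x) * (algebraMap (𝓞 K) K c + x) := by
        rw [map_sub, map_pow, hde]; ring
      rw [e]
      have hm : WithZero.exp (-((n : ℤ) + 1)) ≤ WithZero.exp (-(n : ℤ)) := by
        rw [WithZero.exp_le_exp]; omega
      refine (Valuation.map_sub _ _ _).trans (max_le ?_ ?_)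
      · rw [map_mul, map_mul, map_pow, hx1, one_pow, mul_one]
        refine (mul_le_of_le_one_left' (val_four_le v)).trans (h2.trans hm)
      · rw [map_mul]
        refine (mul_le_of_le_one_right' ?_).trans (hc.le.trans hm)
        refine (Valuation.map_add _ _ _).trans (max_le hc1.le hx1.le)
  choose! c hc1 hc2 using hloc
  obtain ⟨C, hC⟩ := IsDedekindDomain.exists_forall_sub_mem_ideal (s := st.S) (fun v : Pl K => v.asIdeal) (fun _ => n + 1)
    (fun v hv => v.prime) (fun v _ w _ hvw he => hvw (HeightOneSpectrum.ext he)) (fun v => c v)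
  have hCc : ∀ v ∈ st.S, C ∉ v.asIdeal := by
    intro v hv h
    apply hc1 v hv
    have := Ideal.pow_le_self (Nat.succ_ne_zero n) (hC v hv)
    have := sub_mem h this
    simpa using this
  have hCs : ∀ v ∈ st.S, d₀ - C ^ 2 ∈ v.asIdeal ^ n := by
    intro v hv
    have h1 := Ideal.pow_le_pow_right (Nat.le_succ n) (hC v hv)
    have h2 := Ideal.mul_mem_right (C + c v) _ h1
    have := sub_mem (hc2 v hv) h2
    convert this using 1; simp only []; ring
  have hk : ∃ k : 𝓞 K, d₀ - C ^ 2 = 4 * st.N * k := by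
    by_cases hz : d₀ - C ^ 2 = 0
    · exact ⟨0, by rw [hz]; simp⟩
    have hzK := coe_ne hz
    have hNK := coe_ne hN0
    obtain ⟨k, hk⟩ := exists_int_of_ord_nonneg (x := algebraMap (𝓞 K) K (d₀ - C ^ 2) / algebraMap (𝓞 K) K (4 * st.N)) (by
      intro v
      rw [ord_div v hzK hNK, sub_nonneg]
      by_cases hv : v ∈ st.S
      · refine (hn v hv).trans ?_
        have := (mem_pow_iff v _ _).1 (hCs v hv)
        rw [← WithZero.log_le_iff_le_exp (val_ne_zero v hzK)] at this
        unfold ord; omega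
      · have : ord v (algebraMap (𝓞 K) K (4 * st.N)) = 0 :=
          (ord_int_eq_zero_iff v hN0).2 (fun h => hv (st.mem_of_four h))
        rw [this]; exact ord_int_nonneg v _)
    refine ⟨k, ?_⟩
    apply RingOfIntegers.ext
    change algebraMap (𝓞 K) K _ = algebraMap (𝓞 K) K _
    have hk' : algebraMap (𝓞 K) K k = _ := hk
    rw [map_mul _ _ k, hk']; field_simp
  obtain ⟨k, hk⟩ := hk
  exact ⟨t, ht, d₀, C, k, rfl, hk, hCc⟩

lemma Setup.enlarge (st : Setup K) (T : Finset (Pl K)) : ∃ st' : Setup K, st.S ⊆ st'.S ∧ T ⊆ st'.S := by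
  classical
  obtain ⟨n, hn0, hn⟩ : ∃ n : ℕ, n ≠ 0 ∧ ∀ v ∈ T, (n : 𝓞 K) ∈ v.asIdeal := by
    refine ⟨∏ v ∈ T, Ideal.absNorm v.asIdeal, ?_, ?_⟩
    · apply Finset.prod_ne_zero_iff.2
      intro v _
      rw [Ne, Ideal.absNorm_eq_zero_iff]
      exact v.ne_bot
    · intro v hv
      obtain ⟨k, hk⟩ := Finset.dvd_prod_of_mem (fun v : Pl K => Ideal.absNorm v.asIdeal) hv
      rw [hk]; push_cast
      exact Ideal.mul_mem_right _ _ (Ideal.absNorm_mem _)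
  have hN : st.N * n ≠ 0 := mul_ne_zero st.hN hn0
  have hN0 : ((st.N * n : ℕ) : 𝓞 K) ≠ 0 := by exact_mod_cast hN
  have hfin : {v : Pl K | ((st.N * n : ℕ) : 𝓞 K) ∈ v.asIdeal}.Finite := by
    refine (ord_finite_int hN0).subset fun v hv => ?_
    have := (ord_int_pos_iff v hN0).2 hv
    exact this.ne'
  have hsub : ∀ v ∈ st.S, ((st.N * n : ℕ) : 𝓞 K) ∈ v.asIdeal := by
    intro v hv
    push_cast
    exact Ideal.mul_mem_right _ _ ((st.hS v).1 hv)
  refine ⟨⟨st.N * n, hN, Dvd.dvd.mul_right st.two n, hfin.toFinset, by simp, ?_⟩, ?_, ?_⟩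
  · intro v hv
    have hv1 : v ∉ st.S := fun h => hv (by simpa using hsub v h)
    obtain ⟨p, h1, h2, h3⟩ := st.unif v hv1
    exact ⟨p, h1, h2, fun w hw => h3 w (fun h => hw (by simpa using hsub w h))⟩
  · intro v hv; simpa using hsub v hv
  · intro v hv
    have := Ideal.mul_mem_left _ (st.N : 𝓞 K) (hn v hv)
    simpa using this

lemma exists_pl_of_nat (K : Type*) [Field K] [NumberField K] (n : ℕ) (hn0 : n ≠ 0) (hn : n ≠ 1) : ∃ v : Pl K, (n : 𝓞 K) ∈ v.asIdeal := by
  have hu : ¬ IsUnit (n : 𝓞 K) := by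
    intro h
    have h2 : IsUnit ((Algebra.norm ℤ) (n : 𝓞 K)) := h.map (Algebra.norm ℤ)
    rw [show (n : 𝓞 K) = algebraMap ℤ (𝓞 K) n by simp, Algebra.norm_algebraMap] at h2
    rw [isUnit_pow_iff (Module.finrank_pos (R := ℤ) (M := 𝓞 K)).ne'] at h2
    rw [Int.isUnit_iff] at h2
    omega
  obtain ⟨P, hP, hP2⟩ := exists_max_ideal_of_mem_nonunits hu
  refine ⟨⟨P, hP.isPrime, ?_⟩, hP2⟩
  rintro rfl
  simp [hn0] at hP2

lemma exists_pl_notMem (K : Type*) [Field K] [NumberField K] (T : Finset (Pl K)) : ∃ v : Pl K, v ∉ T := by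
  classical
  obtain ⟨st0⟩ := exists_setup K
  obtain ⟨st, -, h⟩ := st0.enlarge T
  obtain ⟨v, hv⟩ := exists_pl_of_nat K (st.N + 1) (by omega) (by have := st.hN; omega)
  refine ⟨v, fun hvT => ?_⟩
  have h1 := (st.hS v).1 (h hvT)
  have h2 := sub_mem hv h1
  apply v.isPrime.ne_top
  rw [Ideal.eq_top_iff_one]
  simpa using h2

lemma infinite_pl (K : Type*) [Field K] [NumberField K] (n : ℕ) : ∃ J : Finset (Pl K), J.card = n := by
  classical
  induction n with
  | zero => exact ⟨∅, rfl⟩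
  | succ n ih =>
    obtain ⟨J, hJ⟩ := ih
    obtain ⟨v, hv⟩ := exists_pl_notMem K J
    exact ⟨insert v J, by rw [Finset.card_insert_of_notMem hv, hJ]⟩

/-- infinitely many primes at which a given nonsquare is not a square -/
theorem exists_nonsq.{u} {K : Type u} [Field K] [NumberField K] [IsTotallyComplex K] (e : K) (he : ¬ IsSquare e) (T : Finset (Pl K)) :
    ∃ v : Pl K, v ∉ T ∧ ord v e = 0 ∧ ¬ SqMod v e := by
  classical
  by_contra hcon
  push Not at hcon
  have he0 : e ≠ 0 := by rintro rfl; exact he ⟨0, by simp⟩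
  obtain ⟨st0⟩ := exists_setup K
  obtain ⟨st, hst1, hst2⟩ := st0.enlarge (T ∪ (ord_finite he0).toFinset)
  have hT : ∀ v ∉ st.S, ord v e = 0 ∧ SqMod v e := by
    intro v hv
    have h1 : v ∉ T := fun h => hv (hst2 (Finset.mem_union_left _ h))
    have h2 : ord v e = 0 := by
      by_contra h
      exact hv (hst2 (Finset.mem_union_right _ (by simpa using h)))
    exact ⟨h2, hcon v h1 h2⟩
  obtain ⟨J, hJ⟩ := infinite_pl K (2 * st.S.card + finrank ℚ K + 1)
  obtain ⟨h, -, hsq, hH⟩ := exists_InH st J (by omega)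
  have hh0 : (h : K) ≠ 0 := h.ne_zero
  -- `h` is ramified somewhere outside `S`
  have hR : ∃ v ∉ st.S, Odd (ord v (h : K)) := by
    by_contra hno
    push Not at hno
    have := (herbrand st (h : K) hH hsq ∅ (by
      intro v; simp only [Finset.notMem_empty, false_iff]; exact fun hv => (hno v hv.1) hv.2) ∅ (by simp) (fun _ => 1) (by simp) (by simp) (by simp)).1
    simp at this
  obtain ⟨v₀, hv₀, hodd⟩ := hR
  have heh : ¬ IsSquare (e * h) := by
    rintro ⟨z, hz⟩
    have hz0 : z ≠ 0 := by rintro rfl; exact mul_ne_zero he0 hh0 (by rw [hz]; simp)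
    have h1 := congrArg (ord v₀) hz
    rw [ord_mul v₀ he0 hh0, ord_mul v₀ hz0 hz0, (hT v₀ hv₀).1, zero_add] at h1
    rw [h1] at hodd
    exact (Int.not_odd_iff_even.2 ⟨_, rfl⟩) hodd
  obtain ⟨M, _, _, _, ⟨q⟩⟩ := exists_quad (e * h) heh
  haveI : IsTotallyComplex M := isTotallyComplex_of_algebra K M
  have hth0 : q.th ≠ 0 := by
    intro h0
    have := q.th_sq
    rw [h0] at this
    simp [he0, hh0] at this
  have hhM : algebraMap K M h ≠ 0 := by simpa using hh0
  have hee : algebraMap K M e = algebraMap K M h * (q.th / algebraMap K M h) ^ 2 := by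
    rw [div_pow, q.th_sq, map_mul]; field_simp
  have heM : ¬ IsSquare (algebraMap K M e) := by
    rintro ⟨z, hz⟩
    obtain ⟨x, y, rfl⟩ := q.gen z
    have hthK : ∀ r : K, algebraMap K M r ≠ q.th := by
      intro r hr
      apply heh
      refine ⟨r, (algebraMap K M).injective ?_⟩
      rw [← q.th_sq, ← hr, map_mul]; ring
    have h1 : algebraMap K M (e - x ^ 2 - e * h * y ^ 2) = algebraMap K M (2 * x * y) * q.th := by
      simp only [map_sub, map_mul, map_pow, map_ofNat]
      have := q.th_sq
      rw [map_mul] at this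
      linear_combination hz + (algebraMap K M y) ^ 2 * this
    by_cases hxy : 2 * x * y = 0
    · rw [hxy, map_zero, zero_mul] at h1
      have h2 : e - x ^ 2 - e * h * y ^ 2 = 0 := (algebraMap K M).injective (h1.trans (map_zero _).symm)
      rcases mul_eq_zero.1 hxy with h3 | h3
      · have hx : x = 0 := by simpa using h3
        have hy : y ≠ 0 := by rintro rfl; apply he0; simpa [hx] using h2
        apply hsq
        refine ⟨y⁻¹, ?_⟩
        rw [hx] at h2
        have h5 : e * (1 - h * y ^ 2) = 0 := by linear_combination h2
        have h6 : (h : K) * y ^ 2 = 1 := by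
          rcases mul_eq_zero.1 h5 with h7 | h7
          · exact absurd h7 he0
          · linear_combination -h7
        field_simp; exact h6
      · apply he
        refine ⟨x, ?_⟩
        rw [h3] at h2
        linear_combination h2
    · apply hthK ((e - x ^ 2 - e * h * y ^ 2) / (2 * x * y))
      rw [map_div₀, h1, mul_comm, mul_div_assoc, div_self, mul_one]
      simpa using hxy
  have hloc : ∀ w : Pl M, LocSq w (algebraMap K M e) := by
    intro w
    by_cases hw : under K w ∈ st.S
    · rw [hee]
      exact (hH.locSq hw).up.mul_sq (div_ne_zero hth0 hhM)
    · obtain ⟨h1, h2⟩ := hT _ hw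
      exact (LocSq.of_sqMod ((ord_eq_zero_iff _ he0).1 h1) (two_unit st hw) h2).up
  obtain ⟨stM⟩ := exists_setup M
  have heM0 : algebraMap K M e ≠ 0 := by simpa using he0
  have hHM := InH.of_locSq stM _ heM0 (fun v _ => hloc v)
  have := (herbrand stM (algebraMap K M e) hHM heM ∅ (by
      intro v; simp only [Finset.notMem_empty, false_iff]; exact fun hv => (Int.not_odd_iff_even.2 (hloc v).even) hv.2) ∅ (by simp) (fun _ => 1) (by simp) (by simp) (by simp)).1
  simp at this

end FiveSq

end

section
open Module NumberField IsDedekindDomain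

namespace FiveSq

lemma sq_of_not_not_field {F : Type*} [Field F] [Finite F] {a b : F} (ha : ¬ IsSquare a) (hb : ¬ IsSquare b) : IsSquare (a * b) := by
  classical
  haveI := Fintype.ofFinite F
  by_cases h2 : ringChar F = 2
  · exact FiniteField.isSquare_of_char_two h2 _
  · have ha0 : a ≠ 0 := by rintro rfl; exact ha ⟨0, by simp⟩
    have hb0 : b ≠ 0 := by rintro rfl; exact hb ⟨0, by simp⟩
    rw [← quadraticChar_one_iff_isSquare (mul_ne_zero ha0 hb0), map_mul,
      (quadraticChar_neg_one_iff_not_isSquare).2 ha, (quadraticChar_neg_one_iff_not_isSquare).2 hb]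
    norm_num

variable {K : Type*} [Field K] [NumberField K]

/-- reduction of `SqMod` to the residue field -/
lemma sqMod_int_iff (v : Pl K) (a : 𝓞 K) : SqMod v (algebraMap (𝓞 K) K a) ↔ IsSquare (Ideal.Quotient.mk v.asIdeal a) := by
  constructor
  · rintro ⟨t, ht⟩
    have ht1 : v.valuation K t ≤ 1 := by
      by_contra h
      have h1 : v.valuation K (t ^ 2) ≤ 1 := by
        have : t ^ 2 = algebraMap (𝓞 K) K a - (algebraMap (𝓞 K) K a - t ^ 2) := by ring
        rw [this]
        exact (Valuation.map_sub _ _ _).trans (max_le (v.valuation_le_one a) ht.le)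
      rw [map_pow] at h1
      exact h ((pow_le_one_iff_of_nonneg zero_le' two_ne_zero).1 h1)
    obtain ⟨b, hb⟩ := v.exists_valuation_sub_lt_of_integer ht1 1
    rw [Units.val_one] at hb
    refine ⟨Ideal.Quotient.mk _ b, ?_⟩
    rw [← map_mul, Ideal.Quotient.eq, ← v.valuation_lt_one_iff_mem (K := K)]
    have e : algebraMap (𝓞 K) K (a - b * b) = (algebraMap (𝓞 K) K a - t ^ 2) - (algebraMap (𝓞 K) K b - t) * (algebraMap (𝓞 K) K b + t) := by
      rw [map_sub, map_mul]; ring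
    change v.valuation K (algebraMap (𝓞 K) K (a - b * b)) < 1
    rw [e]
    refine (Valuation.map_sub _ _ _).trans_lt (max_lt ht ?_)
    rw [map_mul]
    refine mul_lt_one_of_nonneg_of_lt_one_left zero_le' hb ?_
    exact (Valuation.map_add _ _ _).trans (max_le (v.valuation_le_one b) ht1)
  · rintro ⟨y, hy⟩
    obtain ⟨b, rfl⟩ := Ideal.Quotient.mk_surjective y
    refine ⟨algebraMap (𝓞 K) K b, ?_⟩
    rw [← map_mul, Ideal.Quotient.eq, ← v.valuation_lt_one_iff_mem (K := K)] at hy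
    rwa [sq, ← map_mul, ← map_sub]

lemma SqMod.congr {v : Pl K} {x y : K} (h : v.valuation K (y - x) < 1) (hx : SqMod v x) : SqMod v y := by
  obtain ⟨t, ht⟩ := hx
  refine ⟨t, ?_⟩
  rw [show y - t ^ 2 = (y - x) + (x - t ^ 2) by ring]
  exact (Valuation.map_add _ _ _).trans_lt (max_lt h ht)

lemma SqMod.of_not_not {v : Pl K} {x y : K} (hx : v.valuation K x = 1) (hy : v.valuation K y = 1)
    (h1 : ¬ SqMod v x) (h2 : ¬ SqMod v y) : SqMod v (x * y) := by
  obtain ⟨a, ha⟩ := v.exists_valuation_sub_lt_of_integer hx.le 1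
  obtain ⟨b, hb⟩ := v.exists_valuation_sub_lt_of_integer hy.le 1
  rw [Units.val_one] at ha hb
  haveI := v.isMaximal
  letI := Ideal.Quotient.field v.asIdeal
  haveI : Finite (𝓞 K ⧸ v.asIdeal) := Ideal.finiteQuotientOfFreeOfNeBot _ v.ne_bot
  have ha' : v.valuation K (x - algebraMap (𝓞 K) K a) < 1 := by rwa [Valuation.map_sub_swap]
  have hb' : v.valuation K (y - algebraMap (𝓞 K) K b) < 1 := by rwa [Valuation.map_sub_swap]
  have h3 : ¬ IsSquare (Ideal.Quotient.mk v.asIdeal a) := fun h => h1 (((sqMod_int_iff v a).2 h).congr ha')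
  have h4 : ¬ IsSquare (Ideal.Quotient.mk v.asIdeal b) := fun h => h2 (((sqMod_int_iff v b).2 h).congr hb')
  have h5 := sq_of_not_not_field h3 h4
  rw [← map_mul, ← sqMod_int_iff] at h5
  refine h5.congr ?_
  rw [map_mul, show x * y - algebraMap (𝓞 K) K a * algebraMap (𝓞 K) K b = (x - algebraMap (𝓞 K) K a) * y +
    algebraMap (𝓞 K) K a * (y - algebraMap (𝓞 K) K b) by ring]
  refine (Valuation.map_add _ _ _).trans_lt (max_lt ?_ ?_)
  · rw [map_mul, hy, mul_one]; exact ha'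
  · rw [map_mul]
    exact mul_lt_one_of_nonneg_of_lt_one_right (v.valuation_le_one a) zero_le' hb'

lemma SqMod.up {L : Type*} [Field L] [NumberField L] [Algebra K L] {w : Pl L} {d : K} (h : SqMod (under K w) d) :
    SqMod w (algebraMap K L d) := by
  obtain ⟨t, h⟩ := h
  refine ⟨algebraMap K L t, ?_⟩
  have := val_under_lt (L := L) h
  simpa only [map_sub, map_pow] using this

/-- third step, second half -/
lemma exists_nonsq_split.{u} {K : Type u} [Field K] [NumberField K] [IsTotallyComplex K] (hi : ¬ IsSquare (-1 : K)) (e : K)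
    (he : ¬ IsSquare e) (he' : ¬ IsSquare (-e)) (T : Finset (Pl K)) :
    ∃ v : Pl K, v ∉ T ∧ ¬ SqMod v e ∧ SqMod v (-1) := by
  classical
  have he0 : e ≠ 0 := by rintro rfl; exact he ⟨0, by simp⟩
  obtain ⟨L, _, _, _, ⟨q⟩⟩ := exists_quad (-1 : K) hi
  haveI : IsTotallyComplex L := isTotallyComplex_of_algebra K L
  have hth : q.th ^ 2 = -1 := by rw [q.th_sq]; simp
  have heL : ¬ IsSquare (algebraMap K L e) := by
    rintro ⟨z, hz⟩
    obtain ⟨x, y, rfl⟩ := q.gen z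
    have hthK : ∀ r : K, algebraMap K L r ≠ q.th := by
      intro r hr
      apply hi
      refine ⟨r, (algebraMap K L).injective ?_⟩
      rw [← q.th_sq, ← hr, map_mul]; ring
    have h1 : algebraMap K L (e - x ^ 2 + y ^ 2) = algebraMap K L (2 * x * y) * q.th := by
      simp only [map_sub, map_add, map_mul, map_pow, map_ofNat]
      linear_combination hz + (algebraMap K L y) ^ 2 * hth
    by_cases hxy : 2 * x * y = 0
    · rw [hxy, map_zero, zero_mul] at h1
      have h2 : e - x ^ 2 + y ^ 2 = 0 := (algebraMap K L).injective (h1.trans (map_zero _).symm)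
      rcases mul_eq_zero.1 hxy with h3 | h3
      · have hx : x = 0 := by simpa using h3
        apply he'
        refine ⟨y, ?_⟩
        rw [hx] at h2
        linear_combination -h2
      · apply he
        refine ⟨x, ?_⟩
        rw [h3] at h2
        linear_combination h2
    · apply hthK ((e - x ^ 2 + y ^ 2) / (2 * x * y))
      rw [map_div₀, h1, mul_comm, mul_div_assoc, div_self, mul_one]
      simpa using hxy
  obtain ⟨w, hw1, hw2, hw3⟩ := exists_nonsq (algebraMap K L e) heL (over_finite (L := L) (T ∪ (ord_finite he0).toFinset)).toFinset
  simp only [Set.Finite.mem_toFinset, Set.mem_setOf_eq, Finset.mem_union, not_or, not_not] at hw1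
  have hv1 : (under K w).valuation K e = 1 := (ord_eq_zero_iff _ he0).1 hw1.2
  have h3 : ¬ SqMod (under K w) e := fun h => hw3 h.up
  refine ⟨under K w, hw1.1, h3, ?_⟩
  by_contra h4
  have h5 := SqMod.of_not_not hv1 (by rw [Valuation.map_neg, map_one]) h3 h4
  apply hw3
  obtain ⟨t, ht⟩ := h5.up (L := L)
  refine ⟨t * q.th, ?_⟩
  rw [mul_pow, hth, ← Valuation.map_neg]
  convert ht using 2
  simp only [map_mul, map_neg, map_one]; ring

lemma exists_sq_on {K : Type*} [Field K] [NumberField K] (S J : Finset (Pl K)) (hSJ : ∀ v ∈ J, v ∉ S)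
    (hc : J.card < Units.rank K + 1 + S.card) :
    ∃ e ∈ SU (S : Set (Pl K)), ¬ IsSquare (e : K) ∧ ∀ v ∈ J, SqMod v (e : K) := by
  classical
  by_contra hcon
  push Not at hcon
  have hidx := SU_sq_index S
  set U := SU (S : Set (Pl K))
  set R := (powMonoidHom 2 : U →* U).range
  let F : (U ⧸ R) → (J → Prop) := fun x v => SqMod (v : Pl K) (((Quotient.out x : U) : Kˣ) : K)
  have hF : Function.Injective F := by
    intro x y hxy
    rw [← Quotient.out_eq x, ← Quotient.out_eq y]
    set a : U := Quotient.out x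
    set b : U := Quotient.out y
    have hab : ∀ v ∈ J, SqMod v ((a : Kˣ) : K) ↔ SqMod v ((b : Kˣ) : K) := fun v hv => iff_of_eq (congrFun hxy ⟨v, hv⟩)
    have hs : ∀ v ∈ J, SqMod v (((a * b : U) : Kˣ) : K) := by
      intro v hv
      have h1 := SU_val a.2 (hSJ v hv)
      have h2 := SU_val b.2 (hSJ v hv)
      rw [Subgroup.coe_mul, Units.val_mul]
      by_cases h : SqMod v ((a : Kˣ) : K)
      · exact SqMod.mul h1 h2 h ((hab v hv).1 h)
      · exact SqMod.of_not_not h1 h2 h (fun h' => h ((hab v hv).2 h'))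
    have hsq : IsSquare (((a * b : U) : Kˣ) : K) := by
      by_contra hns
      obtain ⟨v, hv, h⟩ := hcon _ (a * b : U).2 hns
      exact h (hs v hv)
    obtain ⟨z, hz⟩ := hsq
    have hz0 : z ≠ 0 := by rintro rfl; simp at hz
    have hz2 : (Units.mk0 z hz0) ^ 2 = ((a * b : U) : Kˣ) := by
      ext; rw [hz]; simp [sq]
    have hzU : Units.mk0 z hz0 ∈ U := SU_root (by rw [hz2]; exact (a * b).2)
    apply QuotientGroup.eq.2
    refine ⟨a⁻¹ * ⟨_, hzU⟩, ?_⟩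
    have : (⟨_, hzU⟩ : U) ^ 2 = a * b := Subtype.ext hz2
    rw [powMonoidHom_apply, mul_pow, this]
    group
  have h1 := Nat.card_le_card_of_injective F hF
  have h2 : Nat.card (U ⧸ R) = 2 ^ (Units.rank K + 1 + S.card) := hidx
  rw [h2] at h1
  have h3 : Nat.card (J → Prop) = 2 ^ J.card := by
    rw [Nat.card_fun]; simp
  rw [h3] at h1
  have := (Nat.pow_le_pow_iff_right (by norm_num)).1 h1
  omega

structure DualJ {K : Type*} [Field K] [NumberField K] (S : Finset (Pl K)) (J : Finset (Pl K)) (u : Pl K → Kˣ) (v₀ : Pl K) : Prop where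
  dis : ∀ v ∈ J, v ∉ S
  mem : ∀ v ∈ J, u v ∈ SU (S : Set (Pl K))
  ns : ∀ v ∈ J, ¬ SqMod v (u v : K)
  sq : ∀ v ∈ J, ∀ v' ∈ J, v' ≠ v → SqMod v' (u v : K)
  mem0 : v₀ ∈ J
  ns0 : ¬ SqMod v₀ (-1 : K)
  sq0 : ∀ v ∈ J, v ≠ v₀ → SqMod v (-1 : K)

theorem exists_dual.{u} {K : Type u} [Field K] [NumberField K] [IsTotallyComplex K] (hi : ¬ IsSquare (-1 : K))
    (S : Finset (Pl K)) (k : ℕ) (hk : k + 1 ≤ Units.rank K + 1 + S.card) :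
    ∃ J u v₀, DualJ S J u v₀ ∧ J.card = k + 1 := by
  classical
  induction k with
  | zero =>
    obtain ⟨v, hv, -, hv2⟩ := exists_nonsq (-1 : K) hi S
    refine ⟨{v}, fun _ => -1, v, ⟨by simpa using hv, ?_, by simpa using hv2, by simp, by simp, hv2, by simp⟩, by simp⟩
    intro _ _
    rw [mem_SU]
    intro w _
    simp [ord_neg]
  | succ k ih =>
    obtain ⟨J, u, v₀, hJ, hc⟩ := ih (by omega)
    obtain ⟨e, heU, hens, he⟩ := exists_sq_on S J hJ.dis (by omega)
    have hneg : ¬ IsSquare (-(e : K)) := by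
      rintro ⟨z, hz⟩
      apply hJ.ns0
      have h1 := SU_val heU (hJ.dis _ hJ.mem0)
      refine SqMod.of_mul (x := (e : K)) h1 (by rw [Valuation.map_neg, map_one]) (he _ hJ.mem0) ?_
      rw [mul_neg_one, hz, ← sq]
      exact SqMod.of_sq _ z
    obtain ⟨v, hvT, hv1, hv2⟩ := exists_nonsq_split hi (e : K) hens hneg (S ∪ J)
    rw [Finset.mem_union, not_or] at hvT
    obtain ⟨hvS, hvJ⟩ := hvT
    have hne : ∀ j ∈ J, j ≠ v := by rintro j hj rfl; exact hvJ hj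
    let u' : Pl K → Kˣ := fun j => if j = v then e else if SqMod v (u j : K) then u j else u j * e
    have hu'v : u' v = e := by simp [u']
    have hu'1 : ∀ j ∈ J, SqMod v (u j : K) → u' j = u j := by
      intro j hj h; simp only [u', if_neg (hne j hj), if_pos h]
    have hu'2 : ∀ j ∈ J, ¬ SqMod v (u j : K) → u' j = u j * e := by
      intro j hj h; simp only [u', if_neg (hne j hj), if_neg h]
    refine ⟨insert v J, u', v₀, ⟨?_, ?_, ?_, ?_, ?_, hJ.ns0, ?_⟩, by rw [Finset.card_insert_of_notMem hvJ, hc]⟩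
    · intro j hj
      rcases Finset.mem_insert.1 hj with rfl | hj
      · exact hvS
      · exact hJ.dis j hj
    · intro j hj
      rcases Finset.mem_insert.1 hj with rfl | hj
      · rw [hu'v]; exact heU
      · by_cases h : SqMod v (u j : K)
        · rw [hu'1 j hj h]; exact hJ.mem j hj
        · rw [hu'2 j hj h]; exact mul_mem (hJ.mem j hj) heU
    · intro j hj
      rcases Finset.mem_insert.1 hj with rfl | hj
      · rw [hu'v]; exact hv1
      · by_cases h : SqMod v (u j : K)
        · rw [hu'1 j hj h]; exact hJ.ns j hj
        · rw [hu'2 j hj h]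
          intro h2
          apply hJ.ns j hj
          rw [Units.val_mul, mul_comm] at h2
          exact SqMod.of_mul (SU_val heU (hJ.dis j hj)) (SU_val (hJ.mem j hj) (hJ.dis j hj)) (he j hj) h2
    · intro j hj j' hj' hjj
      rcases Finset.mem_insert.1 hj with rfl | hjJ
      · rcases Finset.mem_insert.1 hj' with rfl | hj'
        · exact absurd rfl hjj
        · rw [hu'v]; exact he j' hj'
      · rcases Finset.mem_insert.1 hj' with rfl | hj'
        · by_cases h : SqMod j' (u j : K)
          · rw [hu'1 j hjJ h]; exact h
          · rw [hu'2 j hjJ h, Units.val_mul]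
            exact SqMod.of_not_not (SU_val (hJ.mem j hjJ) hvS) (SU_val heU hvS) h hv1
        · by_cases h : SqMod v (u j : K)
          · rw [hu'1 j hjJ h]; exact hJ.sq j hjJ j' hj' hjj
          · rw [hu'2 j hjJ h, Units.val_mul]
            exact SqMod.mul (SU_val (hJ.mem j hjJ) (hJ.dis j' hj')) (SU_val heU (hJ.dis j' hj')) (hJ.sq j hjJ j' hj' hjj) (he j' hj')
    · exact Finset.mem_insert_of_mem hJ.mem0
    · intro j hj hj0
      rcases Finset.mem_insert.1 hj with rfl | hj
      · exact hv2
      · exact hJ.sq0 j hj hj0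

end FiveSq

end

section
open Module NumberField IsDedekindDomain

namespace FiveSq

variable {K : Type*} [Field K] [NumberField K]

lemma norm_pos_of_tc [IsTotallyComplex K] (x : K) (hx : x ≠ 0) : 0 < Algebra.norm ℚ x := by
  classical
  have h0 : Algebra.norm ℚ x ≠ 0 := by rwa [Ne, Algebra.norm_eq_zero_iff]
  suffices h : 0 ≤ Algebra.norm ℚ x from lt_of_le_of_ne h h0.symm
  have h1 := Algebra.norm_eq_prod_embeddings ℚ ℂ x
  rw [← Fintype.prod_equiv (RingHom.equivRatAlgHom K ℂ) (fun f => f x)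
      (fun φ => φ x) fun _ => by simp [RingHom.equivRatAlgHom_apply]] at h1
  rw [← Finset.prod_fiberwise Finset.univ InfinitePlace.mk (fun φ => φ x)] at h1
  have h2 : ∀ w : InfinitePlace K, ∏ φ ∈ (Finset.univ.filter fun φ => InfinitePlace.mk φ = w), φ x = ((w x ^ 2 : ℝ) : ℂ) := by
    intro w
    have hne : w.embedding ≠ ComplexEmbedding.conjugate w.embedding := by
      intro h
      exact IsTotallyComplex.complexEmbedding_not_isReal w.embedding (ComplexEmbedding.isReal_iff.2 h.symm)
    have : (Finset.univ.filter fun φ => InfinitePlace.mk φ = w) = {w.embedding, ComplexEmbedding.conjugate w.embedding} := by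
      ext φ
      simp only [Finset.mem_filter, Finset.mem_univ, true_and, Finset.mem_insert, Finset.mem_singleton]
      nth_rewrite 1 [← InfinitePlace.mk_embedding w]
      rw [InfinitePlace.mk_eq_iff]
      constructor
      · rintro (h | h)
        · left; exact h
        · right; rw [← h, ComplexEmbedding.involutive_conjugate]
      · rintro (h | h)
        · left; exact h
        · right; rw [h, ComplexEmbedding.involutive_conjugate]
    rw [this, Finset.prod_pair hne, ComplexEmbedding.conjugate_coe_eq, Complex.mul_conj, Complex.normSq_eq_norm_sq, InfinitePlace.norm_embedding_eq]
  simp only [h2] at h1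
  rw [← Complex.ofReal_prod, eq_ratCast, ← Complex.ofReal_ratCast, Complex.ofReal_inj] at h1
  have h3 : (0 : ℝ) ≤ (Algebra.norm ℚ x : ℚ) := by
    rw [h1]; exact Finset.prod_nonneg fun w _ => sq_nonneg _
  exact_mod_cast h3

lemma norm_congr4 (a b k : 𝓞 K) (h : a - b = 4 * k) : ((Algebra.norm ℤ a : ℤ) : ZMod 4) = (Algebra.norm ℤ b : ℤ) := by
  classical
  have ha : a = b + 4 * k := by linear_combination h
  let bs := Module.Free.chooseBasis ℤ (𝓞 K)
  rw [Algebra.norm_eq_matrix_det bs, Algebra.norm_eq_matrix_det bs]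
  change (Int.castRingHom (ZMod 4)) _ = (Int.castRingHom (ZMod 4)) _
  rw [RingHom.map_det, RingHom.map_det]
  congr 1
  ext i j
  have : Algebra.leftMulMatrix bs a i j = Algebra.leftMulMatrix bs b i j + 4 * Algebra.leftMulMatrix bs k i j := by
    have h4 : (4 : 𝓞 K) * k = (4 : ℤ) • k := by simp
    rw [ha, h4, map_add, map_smul, Matrix.add_apply, Matrix.smul_apply, smul_eq_mul]
  simp only [RingHom.mapMatrix_apply, Matrix.map_apply, this, map_add, map_mul]
  have h5 : (Int.castRingHom (ZMod 4)) 4 = 0 := by decide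
  rw [h5]; ring

lemma norm_mod_four (st : Setup K) (d c k : 𝓞 K) (h : d - c ^ 2 = 4 * st.N * k) (hc : ∀ v ∈ st.S, c ∉ v.asIdeal) :
    ((Algebra.norm ℤ d : ℤ) : ZMod 4) = 1 := by
  rw [norm_congr4 d (c ^ 2) (st.N * k) (by rw [h]; ring)]
  obtain ⟨y, hy⟩ := (st.isUnit hc).exists_right_inv
  obtain ⟨b, rfl⟩ := Ideal.Quotient.mk_surjective y
  rw [← map_mul, ← map_one (Ideal.Quotient.mk _), Ideal.Quotient.eq, Ideal.mem_span_singleton] at hy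
  obtain ⟨m, hm⟩ := hy
  have h2 := norm_congr4 (c * b) 1 (st.N * m) (by rw [hm]; ring)
  rw [map_mul, map_one] at h2
  rw [map_pow]
  push_cast at h2 ⊢
  generalize ((Algebra.norm ℤ c : ℤ) : ZMod 4) = x at *
  generalize ((Algebra.norm ℤ b : ℤ) : ZMod 4) = y at *
  revert x y; decide

lemma count_eq_ord (v : Pl K) (a : 𝓞 K) (ha : a ≠ 0) [DecidableEq (Ideal (𝓞 K))] :
    ((Multiset.count v.asIdeal (UniqueFactorizationMonoid.normalizedFactors (Ideal.span {a})) : ℕ) : ℤ) = ord v (algebraMap (𝓞 K) K a) := by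
  have hsr : Ideal.span {a} ≠ 0 := by simpa using ha
  unfold ord
  rw [v.valuation_of_algebraMap, v.intValuation_if_neg ha, Ideal.count_associates_factors_eq hsr v.isPrime v.ne_bot]
  simp only [WithZero.log_exp, neg_neg, Nat.cast_inj]
  convert rfl

lemma chi_absNorm (v : Pl K) (h2 : (2 : 𝓞 K) ∉ v.asIdeal) :
    (ZMod.χ₄ (Ideal.absNorm v.asIdeal : ZMod 4) = 1 ∧ SqMod v (-1 : K)) ∨ (ZMod.χ₄ (Ideal.absNorm v.asIdeal : ZMod 4) = -1 ∧ ¬ SqMod v (-1 : K)) := by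
  classical
  haveI := v.isMaximal
  letI := Ideal.Quotient.field v.asIdeal
  haveI : Finite (𝓞 K ⧸ v.asIdeal) := Ideal.finiteQuotientOfFreeOfNeBot _ v.ne_bot
  haveI := Fintype.ofFinite (𝓞 K ⧸ v.asIdeal)
  have hcard : Ideal.absNorm v.asIdeal = Fintype.card (𝓞 K ⧸ v.asIdeal) := by
    rw [Ideal.absNorm_apply, Submodule.cardQuot_apply, Nat.card_eq_fintype_card]
  have hodd : Fintype.card (𝓞 K ⧸ v.asIdeal) % 2 = 1 := by
    apply FiniteField.odd_card_of_char_ne_two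
    intro h
    apply h2
    rw [← Ideal.Quotient.eq_zero_iff_mem, map_ofNat]
    have := ringChar.Nat.cast_ringChar (R := 𝓞 K ⧸ v.asIdeal)
    rw [h] at this
    exact_mod_cast this
  have h1 : SqMod v (-1 : K) ↔ Fintype.card (𝓞 K ⧸ v.asIdeal) % 4 ≠ 3 := by
    rw [← FiniteField.isSquare_neg_one_iff]
    have := sqMod_int_iff v (-1)
    rw [map_neg, map_one, map_neg, map_one] at this
    exact this
  rw [hcard, h1, ZMod.χ₄_nat_eq_if_mod_four]
  simp only [show ¬ (Fintype.card (𝓞 K ⧸ v.asIdeal) % 2 = 0) by omega, if_false]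
  by_cases h : Fintype.card (𝓞 K ⧸ v.asIdeal) % 4 = 1
  · left; simp [h]
  · right; have : Fintype.card (𝓞 K ⧸ v.asIdeal) % 4 = 3 := by omega
    simp [this]

/-- product formula for `-1` -/
theorem prod_formula [IsTotallyComplex K] (st : Setup K) (d : K) (hd : InH st d) (v₀ : Pl K) (hv₀ : v₀ ∉ st.S) (hodd : Odd (ord v₀ d))
    (hns : ¬ SqMod v₀ (-1 : K)) : ∃ v, v ∉ st.S ∧ v ≠ v₀ ∧ Odd (ord v d) ∧ ¬ SqMod v (-1 : K) := by
  classical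
  by_contra hcon
  push Not at hcon
  obtain ⟨t, ht, d₀, c, k, rfl, h1, hc⟩ := hd
  have hd0 : d₀ ≠ 0 := by rintro rfl; simp at hodd
  have hdK := coe_ne hd0
  have hpar : ∀ v, Odd (ord v (t ^ 2 * algebraMap (𝓞 K) K d₀)) ↔ Odd (ord v (algebraMap (𝓞 K) K d₀)) := by
    intro v
    rw [ord_mul v (pow_ne_zero _ ht) hdK, ord_pow, Int.odd_add]
    have h2 : ¬ Odd ((2 : ℕ) * ord v t : ℤ) := by rw [Int.not_odd_iff_even]; exact even_two_mul _
    rw [iff_false_left h2, Int.not_even_iff_odd]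
  simp only [hpar] at hcon hodd
  have hn1 := norm_mod_four st d₀ c k h1 hc
  have hpos : 0 < Algebra.norm ℤ d₀ := by
    have := norm_pos_of_tc (algebraMap (𝓞 K) K d₀) hdK
    have e := Algebra.coe_norm_int d₀
    have e' : ((Algebra.norm ℤ d₀ : ℤ) : ℚ) = Algebra.norm ℚ (algebraMap (𝓞 K) K d₀) := e
    rw [← e'] at this
    exact_mod_cast this
  have hn2 : (Ideal.absNorm (Ideal.span {d₀}) : ZMod 4) = 1 := by
    rw [Ideal.absNorm_span_singleton, ← hn1]
    have : (((Algebra.norm ℤ d₀).natAbs : ℤ)) = Algebra.norm ℤ d₀ := Int.natAbs_of_nonneg hpos.le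
    nth_rewrite 2 [← this]
    rw [Int.cast_natCast]
  have hd0S : ∀ v ∈ st.S, d₀ ∉ v.asIdeal := by
    intro v hv h
    apply hc v hv
    have h2 : d₀ - 4 * st.N * k ∈ v.asIdeal := sub_mem h (Ideal.mul_mem_right _ _ (Ideal.mul_mem_left _ _ ((st.hS v).1 hv)))
    rw [← h1, sub_sub_cancel] at h2
    exact v.isPrime.mem_of_pow_mem _ h2
  have hI : Ideal.span {d₀} ≠ 0 := by simpa using hd0
  set F := UniqueFactorizationMonoid.normalizedFactors (Ideal.span {d₀}) with hF
  have hprod : (F.map (fun I => ZMod.χ₄ (Ideal.absNorm I : ZMod 4))).prod = 1 := by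
    have e : F.prod = Ideal.span {d₀} := by
      have := UniqueFactorizationMonoid.prod_normalizedFactors hI
      exact associated_iff_eq.1 this
    have h3 : ((ZMod.χ₄.toMonoidHom.comp ((Nat.castRingHom (ZMod 4)).toMonoidHom.comp (Ideal.absNorm (S := 𝓞 K)).toMonoidHom))) F.prod = 1 := by
      rw [e]
      change ZMod.χ₄ (Ideal.absNorm (Ideal.span {d₀}) : ZMod 4) = 1
      rw [hn2]; simp
    rw [map_multiset_prod] at h3
    exact h3
  rw [Finset.prod_multiset_map_count] at hprod
  have hpl : ∀ I ∈ F, ∃ v : Pl K, v.asIdeal = I ∧ v ∉ st.S := by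
    intro I hI'
    have hp := UniqueFactorizationMonoid.prime_of_normalized_factor I hI'
    have hd := UniqueFactorizationMonoid.dvd_of_mem_normalizedFactors hI'
    refine ⟨⟨I, Ideal.isPrime_of_prime hp, hp.ne_zero⟩, rfl, fun hS => ?_⟩
    apply hd0S _ hS
    exact (Ideal.dvd_iff_le.1 hd) (Ideal.mem_span_singleton_self _)
  have h2S : ∀ v : Pl K, v ∉ st.S → (2 : 𝓞 K) ∉ v.asIdeal := by
    intro v hv h2
    apply hv
    rw [st.hS]
    obtain ⟨m, hm⟩ := st.two
    rw [hm]; push_cast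
    exact Ideal.mul_mem_right _ _ h2
  have hmem : v₀.asIdeal ∈ F.toFinset := by
    rw [Multiset.mem_toFinset, ← Multiset.count_pos]
    have := count_eq_ord v₀ d₀ hd0
    rw [← this] at hodd
    by_contra h
    have : Multiset.count v₀.asIdeal F = 0 := by omega
    rw [← hF, this] at hodd
    simp at hodd
  rw [Finset.prod_eq_single_of_mem _ hmem] at hprod
  · rcases chi_absNorm v₀ (h2S v₀ hv₀) with h | h
    · exact hns h.2
    · rw [h.1] at hprod
      have hodd' := hodd
      rw [← count_eq_ord v₀ d₀ hd0, ← hF] at hodd'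
      have h5 : Odd (Multiset.count v₀.asIdeal F) := by exact_mod_cast hodd'
      rw [h5.neg_one_pow] at hprod
      norm_num at hprod
  · intro I hI' hne
    obtain ⟨v, rfl, hvS⟩ := hpl I (Multiset.mem_toFinset.1 hI')
    have hvne : v ≠ v₀ := by rintro rfl; exact hne rfl
    rcases chi_absNorm v (h2S v hvS) with h | h
    · rw [h.1, one_pow]
    · rw [h.1]
      have : ¬ Odd (ord v (algebraMap (𝓞 K) K d₀)) := fun ho => h.2 (hcon v hvS hvne ho)
      rw [← count_eq_ord v d₀ hd0, ← hF, Int.not_odd_iff_even] at this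
      have h5 : Even (Multiset.count v.asIdeal F) := by exact_mod_cast this
      exact h5.neg_one_pow

end FiveSq

end

section
open Module NumberField IsDedekindDomain

namespace FiveSq

variable {K : Type*} [Field K] [NumberField K]

lemma val_two_lt (v : Pl K) (h : (2 : 𝓞 K) ∈ v.asIdeal) : v.valuation K 2 < 1 := by
  have : v.valuation K (algebraMap (𝓞 K) K 2) < 1 := (v.valuation_lt_one_iff_mem _).2 h
  rwa [map_ofNat] at this

lemma val_two_eq (v : Pl K) (h : (2 : 𝓞 K) ∉ v.asIdeal) : v.valuation K 2 = 1 := by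
  apply le_antisymm (val_two_le v)
  by_contra h2
  apply h
  rw [← v.valuation_lt_one_iff_mem (K := K)]
  change v.valuation K (algebraMap (𝓞 K) K 2) < 1
  rw [map_ofNat]; exact not_le.1 h2

lemma local_odd (v : Pl K) (h : (2 : 𝓞 K) ∉ v.asIdeal) :
    ∃ x y t : K, v.valuation K x ≤ 1 ∧ v.valuation K y ≤ 1 ∧ v.valuation K t = 1 ∧ v.valuation K (x ^ 2 + y ^ 2 + t ^ 2) < v.valuation K 4 := by
  classical
  have h4 : v.valuation K 4 = 1 := by
    rw [show (4 : K) = 2 * 2 by norm_num, map_mul, val_two_eq v h, one_mul]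
  haveI := v.isMaximal
  letI := Ideal.Quotient.field v.asIdeal
  haveI : Finite (𝓞 K ⧸ v.asIdeal) := Ideal.finiteQuotientOfFreeOfNeBot _ v.ne_bot
  haveI := Fintype.ofFinite (𝓞 K ⧸ v.asIdeal)
  obtain ⟨a, b, hab⟩ : ∃ a b : 𝓞 K ⧸ v.asIdeal, a ^ 2 + b ^ 2 = -1 := by
    haveI : NeZero (ringChar (𝓞 K ⧸ v.asIdeal)) := ⟨CharP.char_ne_zero_of_finite (𝓞 K ⧸ v.asIdeal) _⟩
    obtain ⟨a, b, hab⟩ := CharP.sq_add_sq (𝓞 K ⧸ v.asIdeal) (ringChar (𝓞 K ⧸ v.asIdeal)) (-1)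
    exact ⟨a, b, by simpa using hab⟩
  obtain ⟨a, rfl⟩ := Ideal.Quotient.mk_surjective a
  obtain ⟨b, rfl⟩ := Ideal.Quotient.mk_surjective b
  refine ⟨algebraMap (𝓞 K) K a, algebraMap (𝓞 K) K b, 1, v.valuation_le_one a, v.valuation_le_one b, map_one _, ?_⟩
  rw [h4]
  have : algebraMap (𝓞 K) K (a ^ 2 + b ^ 2 + 1) = algebraMap (𝓞 K) K a ^ 2 + algebraMap (𝓞 K) K b ^ 2 + 1 ^ 2 := by simp
  rw [← this]
  apply (v.valuation_lt_one_iff_mem _).2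
  rw [← Ideal.Quotient.eq_zero_iff_mem]
  simp only [map_add, map_pow, map_one, hab]; ring

lemma local_newton (v : Pl K) (X τ : K) (hX : v.valuation K X = 1) (hτ : v.valuation K (X ^ 2 + 3 * τ) < 1) (n : ℕ) :
    ∃ Y : K, v.valuation K Y < 1 ∧ v.valuation K (Y ^ 2 - X * Y + (X ^ 2 + 3 * τ)) ≤ WithZero.exp (-((n : ℤ) + 1)) := by
  induction n with
  | zero =>
    refine ⟨0, by simp, ?_⟩
    simpa using (val_lt_one_iff v _).1 hτ
  | succ n ih =>
    obtain ⟨Y, h1, h2⟩ := ih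
    set f := Y ^ 2 - X * Y + (X ^ 2 + 3 * τ) with hf
    have hD : v.valuation K (2 * Y - X) = 1 := by
      rw [← hX]
      apply Valuation.map_sub_eq_of_lt_right
      rw [hX, map_mul]
      exact mul_lt_one_of_nonneg_of_lt_one_right (val_two_le v) zero_le' h1
    have hD0 : 2 * Y - X ≠ 0 := by intro h0; rw [h0] at hD; simp at hD
    refine ⟨Y - f / (2 * Y - X), ?_, ?_⟩
    · refine (Valuation.map_sub _ _ _).trans_lt (max_lt h1 ?_)
      rw [map_div₀, hD, div_one]
      refine h2.trans_lt ?_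
      rw [← WithZero.exp_zero, WithZero.exp_lt_exp]; omega
    · have e : (Y - f / (2 * Y - X)) ^ 2 - X * (Y - f / (2 * Y - X)) + (X ^ 2 + 3 * τ) = f ^ 2 / (2 * Y - X) ^ 2 := by
        have : X ^ 2 + 3 * τ = f - Y ^ 2 + X * Y := by rw [hf]; ring
        obtain ⟨g, hg⟩ : ∃ g, f = g * (2 * Y - X) := ⟨f / (2 * Y - X), by rw [div_mul_cancel₀ _ hD0]⟩
        rw [this, hg, mul_div_assoc, div_self hD0, mul_one, mul_pow, mul_div_assoc, div_self (pow_ne_zero 2 hD0)]; ring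
      rw [e, map_div₀, map_pow, map_pow, hD, one_pow, div_one]
      calc (v.valuation K f) ^ 2 = v.valuation K f * v.valuation K f := sq _
        _ ≤ WithZero.exp (-((n : ℤ) + 1)) * WithZero.exp (-((n : ℤ) + 1)) := mul_le_mul' h2 h2
        _ = WithZero.exp (-((n : ℤ) + 1) + -((n : ℤ) + 1)) := (WithZero.exp_add _ _).symm
        _ ≤ _ := by rw [WithZero.exp_le_exp]; push_cast; omega

lemma local_even (v : Pl K) (h : (2 : 𝓞 K) ∈ v.asIdeal) (T : K) (hT : v.valuation K (T ^ 2 / 2) = 1) :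
    ∃ x y t : K, v.valuation K x ≤ 1 ∧ v.valuation K y ≤ 1 ∧ v.valuation K t = 1 ∧ v.valuation K (x ^ 2 + y ^ 2 + t ^ 2) < v.valuation K 4 := by
  classical
  have h2 := val_two_lt v h
  have hT1 : v.valuation K T < 1 := by
    have : T ^ 2 = (T ^ 2 / 2) * 2 := by field_simp
    have h3 : v.valuation K T ^ 2 < 1 := by rw [← map_pow, this, map_mul, hT, one_mul]; exact h2
    exact (pow_lt_one_iff_of_nonneg zero_le' two_ne_zero).1 h3
  set τ := T ^ 2 / 2 with hτ
  have hTT : T ^ 2 = 2 * τ := by rw [hτ]; field_simp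
  -- square root of `τ` modulo `v`
  have hs : SqMod v τ := by
    obtain ⟨a, ha⟩ := v.exists_valuation_sub_lt_of_integer hT.le 1
    rw [Units.val_one] at ha
    haveI := v.isMaximal
    letI := Ideal.Quotient.field v.asIdeal
    haveI : Finite (𝓞 K ⧸ v.asIdeal) := Ideal.finiteQuotientOfFreeOfNeBot _ v.ne_bot
    refine SqMod.congr (x := algebraMap (𝓞 K) K a) (by rwa [Valuation.map_sub_swap]) ?_
    rw [sqMod_int_iff]
    apply FiniteField.isSquare_of_char_two
    have h0 : ((2 : ℕ) : 𝓞 K ⧸ v.asIdeal) = 0 := by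
      have := Ideal.Quotient.eq_zero_iff_mem.2 h
      rw [map_ofNat] at this
      exact_mod_cast this
    exact ringChar.eq_iff.2 (CharTwo.of_one_ne_zero_of_two_eq_zero one_ne_zero (by exact_mod_cast h0))
  obtain ⟨X, hX⟩ := hs
  have hX1 := SqMod.val_t hT hX
  have h4lt : v.valuation K 4 < 1 := by
    rw [show (4 : K) = 2 * 2 by norm_num, map_mul]
    exact mul_lt_one_of_nonneg_of_lt_one_right h2.le zero_le' h2
  have hXt : v.valuation K (X ^ 2 + 3 * τ) < 1 := by
    rw [show X ^ 2 + 3 * τ = 4 * τ - (τ - X ^ 2) by ring]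
    refine (Valuation.map_sub _ _ _).trans_lt (max_lt ?_ hX)
    rw [map_mul, hT, mul_one]; exact h4lt
  obtain ⟨Y, hY1, hY2⟩ := local_newton v X τ hX1 hXt (ord v (4 : K)).toNat
  refine ⟨X + T, T - Y, Y - X + T, ?_, ?_, ?_, ?_⟩
  · exact (Valuation.map_add _ _ _).trans (max_le hX1.le hT1.le)
  · exact (Valuation.map_sub _ _ _).trans (max_le hT1.le hY1.le)
  · rw [show Y - X + T = (Y + T) - X by ring, ← hX1]
    apply Valuation.map_sub_eq_of_lt_right
    rw [hX1]
    exact (Valuation.map_add _ _ _).trans_lt (max_lt hY1 hT1)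
  · have e : (X + T) ^ 2 + (T - Y) ^ 2 + (Y - X + T) ^ 2 = 2 * (Y ^ 2 - X * Y + (X ^ 2 + 3 * τ)) := by
      linear_combination 3 * hTT
    rw [e, map_mul]
    refine (mul_le_of_le_one_left' h2.le).trans_lt (hY2.trans_lt ?_)
    have h40 : (4 : K) ≠ 0 := four_ne_K
    have : v.valuation K 4 = WithZero.exp (-(ord v (4 : K))) := by
      unfold ord; rw [neg_neg, WithZero.exp_log (val_ne_zero v h40)]
    rw [this, WithZero.exp_lt_exp]
    omega

/-- the initial `δ` -/
lemma exists_delta (st : Setup K) (T : K) (hT : ∀ v : Pl K, (2 : 𝓞 K) ∈ v.asIdeal → v.valuation K (T ^ 2 / 2) = 1) :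
    ∃ X Y : K, -(X ^ 2 + Y ^ 2) ≠ 0 ∧ InH st (-(X ^ 2 + Y ^ 2)) := by
  classical
  have hloc : ∀ v : Pl K, ∃ x y t : K, v.valuation K x ≤ 1 ∧ v.valuation K y ≤ 1 ∧ v.valuation K t = 1 ∧ v.valuation K (x ^ 2 + y ^ 2 + t ^ 2) < v.valuation K 4 := by
    intro v
    by_cases h : (2 : 𝓞 K) ∈ v.asIdeal
    · exact local_even v h T (hT v h)
    · exact local_odd v h
  choose x y t hx hy ht hxyt using hloc
  obtain ⟨n, hn⟩ : ∃ n : ℕ, ∀ v ∈ st.S, ord v (4 : K) < n := by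
    refine ⟨∑ v ∈ st.S, ((ord v (4 : K)).toNat + 1), fun v hv => ?_⟩
    have h1 := Finset.single_le_sum (f := fun v : Pl K => ((ord v (4 : K)).toNat + 1)) (fun i _ => Nat.zero_le _) hv
    have h2 : (ord v (4 : K)).toNat + 1 ≤ ∑ v ∈ st.S, ((ord v (4 : K)).toNat + 1) := h1
    omega
  have hn4 : ∀ v ∈ st.S, WithZero.exp (-(n : ℤ)) < v.valuation K 4 := by
    intro v hv
    have h40 : (4 : K) ≠ 0 := four_ne_K
    have : v.valuation K 4 = WithZero.exp (-(ord v (4 : K))) := by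
      unfold ord; rw [neg_neg, WithZero.exp_log (val_ne_zero v h40)]
    rw [this, WithZero.exp_lt_exp]
    have := hn v hv
    omega
  have happ : ∀ z : Pl K → K, (∀ v : Pl K, v.valuation K (z v) ≤ 1) → ∃ Z : 𝓞 K, ∀ v ∈ st.S, v.valuation K (algebraMap (𝓞 K) K Z - z v) < v.valuation K 4 := by
    intro z hz
    have : ∀ v : Pl K, ∃ a : 𝓞 K, v.valuation K (algebraMap (𝓞 K) K a - z v) < WithZero.exp (-(n : ℤ)) := by
      intro v
      obtain ⟨a, ha⟩ := v.exists_valuation_sub_lt_of_integer (hz v) (Units.mk0 (WithZero.exp (-(n : ℤ))) WithZero.exp_ne_zero)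
      exact ⟨a, ha⟩
    choose a ha using this
    obtain ⟨Z, hZ⟩ := IsDedekindDomain.exists_forall_sub_mem_ideal (s := st.S) (fun v : Pl K => v.asIdeal) (fun _ => n)
      (fun v hv => v.prime) (fun v _ w _ hvw he => hvw (HeightOneSpectrum.ext he)) (fun v => a v)
    refine ⟨Z, fun v hv => ?_⟩
    have h1 := (mem_pow_iff v _ _).1 (hZ v hv)
    rw [show algebraMap (𝓞 K) K Z - z v = algebraMap (𝓞 K) K (Z - a v) + (algebraMap (𝓞 K) K (a v) - z v) by rw [map_sub]; ring]
    exact (Valuation.map_add _ _ _).trans_lt (max_lt (h1.trans_lt (hn4 v hv)) ((ha v).trans (hn4 v hv)))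
  obtain ⟨X, hX⟩ := happ x hx
  obtain ⟨Y, hY⟩ := happ y hy
  have hdiff : ∀ v ∈ st.S, ∀ (Z : 𝓞 K) (z : K), v.valuation K z ≤ 1 → v.valuation K (algebraMap (𝓞 K) K Z - z) < v.valuation K 4 →
      v.valuation K (algebraMap (𝓞 K) K Z ^ 2 - z ^ 2) < v.valuation K 4 := by
    intro v hv Z z hz h
    rw [show algebraMap (𝓞 K) K Z ^ 2 - z ^ 2 = (algebraMap (𝓞 K) K Z - z) * (algebraMap (𝓞 K) K Z + z) by ring, map_mul]
    refine (mul_le_of_le_one_right' ?_).trans_lt h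
    exact (Valuation.map_add _ _ _).trans (max_le (v.valuation_le_one Z) hz)
  have hls : ∀ v ∈ st.S, LocSq v (-(algebraMap (𝓞 K) K X ^ 2 + algebraMap (𝓞 K) K Y ^ 2)) := by
    intro v hv
    have ht0 : t v ≠ 0 := by intro h; have := ht v; rw [h] at this; simp at this
    refine ⟨t v, ht0, ?_⟩
    have h4 : v.valuation K 4 ≠ 0 := val_ne_zero v four_ne_K
    rw [map_div₀, map_mul, map_pow, ht v, one_pow, mul_one, div_lt_one₀ (zero_lt_iff.2 h4), ← Valuation.map_neg]
    rw [show -(-(algebraMap (𝓞 K) K X ^ 2 + algebraMap (𝓞 K) K Y ^ 2) - t v ^ 2) = (algebraMap (𝓞 K) K X ^ 2 - x v ^ 2) +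
      ((algebraMap (𝓞 K) K Y ^ 2 - y v ^ 2) + (x v ^ 2 + y v ^ 2 + t v ^ 2)) by ring]
    refine (Valuation.map_add _ _ _).trans_lt (max_lt (hdiff v hv _ _ (hx v) (hX v hv)) ?_)
    exact (Valuation.map_add _ _ _).trans_lt (max_lt (hdiff v hv _ _ (hy v) (hY v hv)) (hxyt v))
  have hne : -(algebraMap (𝓞 K) K X ^ 2 + algebraMap (𝓞 K) K Y ^ 2) ≠ 0 := by
    intro h0
    obtain ⟨v, hv⟩ := exists_pl_of_nat K 2 two_ne_zero (by norm_num)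
    have hvS : v ∈ st.S := by
      rw [st.hS]
      obtain ⟨m, hm⟩ := st.two
      rw [hm]; push_cast
      exact Ideal.mul_mem_right _ _ hv
    obtain ⟨s, hs, h⟩ := hls v hvS
    rw [h0, show (0 - s ^ 2) / (4 * s ^ 2) = - (4 : K)⁻¹ by field_simp; ring, Valuation.map_neg, map_inv₀] at h
    have h4 : v.valuation K 4 ≠ 0 := val_ne_zero v four_ne_K
    have := (inv_lt_one₀ (zero_lt_iff.2 h4)).1 h
    exact absurd (val_four_le v) (not_le.2 this)
  exact ⟨_, _, hne, InH.of_locSq st _ hne hls⟩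

lemma sqMod_neg_one_of_delta {X Y : K} (v : Pl K) (h : Odd (ord v (-(X ^ 2 + Y ^ 2)))) : SqMod v (-1 : K) := by
  by_cases hY : Y = 0
  · exfalso
    rw [hY, ord_neg, show X ^ 2 + 0 ^ 2 = X ^ 2 by ring, ord_pow] at h
    exact Int.not_odd_iff_even.2 (even_two_mul _) h
  · refine SqMod.of_norm (x := X / Y) (y := 1 / Y) (d := X ^ 2 + Y ^ 2) (by rw [Valuation.map_neg, map_one]) (by rwa [ord_neg] at h) ?_
    field_simp; ring

end FiveSq

end

section
open Module NumberField IsDedekindDomain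

namespace FiveSq

/-- each auxiliary place `w` where `-1` is a square gives a correcting sum of two squares -/
lemma exists_corr.{u} {K : Type u} [Field K] [NumberField K] [IsTotallyComplex K] (st : Setup K)
    (J : Finset (Pl K)) (u : Pl K → Kˣ) (v₀ : Pl K) (hJ : DualJ st.S J u v₀) (hcard : J.card = Units.rank K + 1 + st.S.card)
    (w : Pl K) (hwS : w ∉ st.S) (hwJ : w ∉ J) (hw : SqMod w (-1 : K)) :
    ∃ d a b : K, d ≠ 0 ∧ d = a ^ 2 + b ^ 2 ∧ InH st d ∧ Odd (ord w d) ∧ ∀ v, v ∉ st.S → v ∉ J → v ≠ w → ord v d = 0 := by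
  classical
  have hfin : finrank ℚ K = 2 * (Units.rank K + 1) := by
    rw [IsTotallyComplex.finrank K, Units.rank]
    have : 0 < Fintype.card (InfinitePlace K) := Fintype.card_pos
    have h2 := InfinitePlace.card_eq_nrRealPlaces_add_nrComplexPlaces K
    rw [IsTotallyComplex.nrRealPlaces_eq_zero] at h2
    omega
  have hdis : Disjoint st.S J := Finset.disjoint_left.2 (fun v hv hv' => hJ.dis v hv' hv)
  have hwU : w ∉ st.S ∪ J := by simp [hwS, hwJ]
  have hc : (insert w (st.S ∪ J)).card = st.S.card + J.card + 1 := by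
    rw [Finset.card_insert_of_notMem hwU, Finset.card_union_of_disjoint hdis]
  obtain ⟨d, hd, hsq, hH⟩ := exists_InH st (insert w (st.S ∪ J)) (by rw [hc, hfin, hcard]; omega)
  have hd' : ∀ v, v ∉ st.S → v ∉ J → v ≠ w → ord v (d : K) = 0 := by
    intro v h1 h2 h3
    exact mem_SU.1 hd v (by simp [h1, h2, h3])
  set R := (insert w J).filter (fun v => Odd (ord v (d : K))) with hRdef
  have hR : ∀ v, v ∈ R ↔ v ∉ st.S ∧ Odd (ord v (d : K)) := by
    intro v
    rw [hRdef, Finset.mem_filter, Finset.mem_insert]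
    constructor
    · rintro ⟨rfl | h, h2⟩
      · exact ⟨hwS, h2⟩
      · exact ⟨hJ.dis v h, h2⟩
    · rintro ⟨h1, h2⟩
      refine ⟨?_, h2⟩
      by_contra h3
      push Not at h3
      rw [hd' v h1 h3.2 h3.1] at h2
      simp at h2
  set Q := R.erase w with hQdef
  have hQR : Q ⊆ R := Finset.erase_subset _ _
  have hQJ : ∀ v ∈ Q, v ∈ J := by
    intro v hv
    rw [hQdef, Finset.mem_erase, hRdef, Finset.mem_filter, Finset.mem_insert] at hv
    exact hv.2.1.resolve_left hv.1
  obtain ⟨h1, h2⟩ := herbrand.{u} st (d : K) hH hsq R hR Q hQR u (fun v hv => hJ.mem v (hQJ v hv)) (fun v hv => hJ.ns v (hQJ v hv))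
    (fun v hv v' hv' hne => hJ.sq v (hQJ v hv) v' (hQJ v' hv') hne)
  have hwR : w ∈ R := by
    by_contra h
    rw [hQdef, Finset.erase_eq_of_notMem h] at h1
    omega
  have h3 := h2 (Finset.card_erase_add_one hwR) (-1) (mem_SU.2 (fun v _ => by rw [Units.val_neg, Units.val_one, ord_neg, ord_one])) (by
    intro v hv
    rw [Units.val_neg, Units.val_one]
    by_cases hv0 : v = v₀
    · exfalso
      subst hv0
      have hvR := (hR v).1 (hQR hv)
      obtain ⟨v', h4, h5, h6, h7⟩ := prod_formula st (d : K) hH v hvR.1 hvR.2 hJ.ns0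
      have h8 := (hR v').2 ⟨h4, h6⟩
      rw [hRdef, Finset.mem_filter, Finset.mem_insert] at h8
      rcases h8.1 with rfl | h9
      · exact h7 hw
      · exact h7 (hJ.sq0 v' h9 h5)
    · exact hJ.sq0 v (hQJ v hv) hv0)
  obtain ⟨x, y, hxy⟩ := h3
  rw [Units.val_neg, Units.val_one] at hxy
  by_cases hy : y = 0
  · -- `-1 = x ^ 2`, then `-1` is a square everywhere
    exfalso
    apply hJ.ns0
    refine ⟨x, ?_⟩
    rw [hxy, hy]; simp
  · refine ⟨d, x / y, 1 / y, d.ne_zero, ?_, hH, ((hR w).1 hwR).2, hd'⟩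
    field_simp
    linear_combination hxy

/-- the core theorem -/
theorem core.{u} {K : Type u} [Field K] [NumberField K] [IsTotallyComplex K] (T : K)
    (hT : ∀ v : Pl K, (2 : 𝓞 K) ∈ v.asIdeal → v.valuation K (T ^ 2 / 2) = 1) : ∃ a b : K, -1 = a ^ 2 + b ^ 2 := by
  classical
  by_cases hi : IsSquare (-1 : K)
  · obtain ⟨a, ha⟩ := hi
    exact ⟨a, 0, by rw [ha]; ring⟩
  obtain ⟨st⟩ := exists_setup K
  obtain ⟨J, u, v₀, hJ, hcard⟩ := exists_dual hi st.S (Units.rank K + st.S.card) (by omega)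
  have hcard' : J.card = Units.rank K + 1 + st.S.card := by omega
  obtain ⟨X, Y, h0, hH⟩ := exists_delta st T hT
  have key : ∀ (n : ℕ) (X Y : K), -(X ^ 2 + Y ^ 2) ≠ 0 → InH st (-(X ^ 2 + Y ^ 2)) → ∀ W : Finset (Pl K), W.card = n →
      (∀ v, v ∉ st.S → v ∉ J → Odd (ord v (-(X ^ 2 + Y ^ 2))) → v ∈ W) → ∃ a b : K, -1 = a ^ 2 + b ^ 2 := by
    intro n
    induction n with
    | zero =>
      intro X Y h0 hH W hW h
      rw [Finset.card_eq_zero] at hW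
      subst hW
      by_cases hsq : IsSquare (-(X ^ 2 + Y ^ 2))
      · obtain ⟨z, hz⟩ := hsq
        have hz0 : z ≠ 0 := by rintro rfl; exact h0 (by rw [hz, zero_mul])
        refine ⟨X / z, Y / z, ?_⟩
        field_simp
        linear_combination hz
      · exfalso
        have hR : ∀ v, v ∈ J.filter (fun v => Odd (ord v (-(X ^ 2 + Y ^ 2)))) ↔ v ∉ st.S ∧ Odd (ord v (-(X ^ 2 + Y ^ 2))) := by
          intro v
          rw [Finset.mem_filter]
          constructor
          · rintro ⟨h1, h2⟩; exact ⟨hJ.dis v h1, h2⟩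
          · rintro ⟨h1, h2⟩
            refine ⟨?_, h2⟩
            by_contra h3
            exact absurd (h v h1 h3 h2) (Finset.notMem_empty _)
        have hRJ : ∀ v ∈ J.filter (fun v => Odd (ord v (-(X ^ 2 + Y ^ 2)))), v ∈ J := fun v hv => (Finset.mem_filter.1 hv).1
        have := (herbrand.{u} st _ hH hsq _ hR _ (Finset.Subset.refl _) u (fun v hv => hJ.mem v (hRJ v hv)) (fun v hv => hJ.ns v (hRJ v hv))
          (fun v hv v' hv' hne => hJ.sq v (hRJ v hv) v' (hRJ v' hv') hne)).1
        omega
    | succ n ih =>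
      intro X Y h0 hH W hW h
      obtain ⟨w, hw⟩ : W.Nonempty := by rw [← Finset.card_pos]; omega
      have hWe : (W.erase w).card = n := by rw [Finset.card_erase_of_mem hw]; omega
      by_cases hbad : w ∉ st.S ∧ w ∉ J ∧ Odd (ord w (-(X ^ 2 + Y ^ 2)))
      · obtain ⟨hwS, hwJ, hodd⟩ := hbad
        obtain ⟨d, a, b, hd0, hd, hdH, hdo, hdz⟩ := exists_corr st J u v₀ hJ hcard' w hwS hwJ (sqMod_neg_one_of_delta w hodd)
        have e : -((X * a - Y * b) ^ 2 + (X * b + Y * a) ^ 2) = -(X ^ 2 + Y ^ 2) * d := by rw [hd]; ring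
        refine ih (X * a - Y * b) (X * b + Y * a) (by rw [e]; exact mul_ne_zero h0 hd0) (by rw [e]; exact hH.mul hdH) _ hWe ?_
        intro v h1 h2 h3
        rw [e, ord_mul v h0 hd0] at h3
        rw [Finset.mem_erase]
        have hne : v ≠ w := by
          rintro rfl
          exact Int.not_odd_iff_even.2 (hodd.add_odd hdo) h3
        rw [hdz v h1 h2 hne, add_zero] at h3
        exact ⟨hne, h v h1 h2 h3⟩
      · refine ih X Y h0 hH _ hWe ?_
        intro v h1 h2 h3
        rw [Finset.mem_erase]
        refine ⟨?_, h v h1 h2 h3⟩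
        rintro rfl
        exact hbad ⟨h1, h2, h3⟩
  refine key _ X Y h0 hH (ord_finite h0).toFinset rfl ?_
  intro v _ _ h3
  rw [Set.Finite.mem_toFinset, Set.mem_setOf_eq]
  intro h4
  rw [h4] at h3
  simp at h3

end FiveSq

end

section
open Module NumberField IsDedekindDomain

namespace FiveSq

open Polynomial in
/-- sums of four squares in `ℚ[X]` -/
def Sum4 (p : Polynomial ℚ) : Prop := ∃ a b c d : Polynomial ℚ, p = a ^ 2 + b ^ 2 + c ^ 2 + d ^ 2

open Polynomial

lemma Sum4.mul {p q : ℚ[X]} (hp : Sum4 p) (hq : Sum4 q) : Sum4 (p * q) := by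
  obtain ⟨a, b, c, d, rfl⟩ := hp
  obtain ⟨x, y, z, w, rfl⟩ := hq
  exact ⟨_, _, _, _, (euler_four_squares a b c d x y z w).symm⟩

lemma Sum4.const {c : ℚ} (hc : 0 ≤ c) : Sum4 (C c) := by
  obtain ⟨a, b, c', d, h⟩ := Nat.sum_four_squares (c.num.toNat * c.den)
  have hd : (c.den : ℚ) ≠ 0 := by exact_mod_cast c.den_ne_zero
  refine ⟨C (a / c.den), C (b / c.den), C (c' / c.den), C (d / c.den), ?_⟩
  rw [← C_pow, ← C_pow, ← C_pow, ← C_pow, ← C_add, ← C_add, ← C_add]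
  congr 1
  have h1 : ((c.num.toNat : ℤ) : ℚ) = c.num := by rw [Int.toNat_of_nonneg (Rat.num_nonneg.2 hc)]
  have h2 : (a : ℚ) ^ 2 + b ^ 2 + c' ^ 2 + d ^ 2 = c.num * c.den := by rw [← h1]; exact_mod_cast h
  have h3 : c = c.num / c.den := (Rat.num_div_den c).symm
  rw [div_pow, div_pow, div_pow, div_pow, ← add_div, ← add_div, ← add_div, h2]
  conv_lhs => rw [h3]
  field_simp

lemma Sum4.eval_nonneg {p : ℚ[X]} (hp : Sum4 p) (t : ℚ) : 0 ≤ p.eval t := by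
  obtain ⟨a, b, c, d, rfl⟩ := hp
  simp only [eval_add, eval_pow]
  positivity

lemma four_sq_eq_zero {a b c d : ℚ[X]} (h : a ^ 2 + b ^ 2 + c ^ 2 + d ^ 2 = 0) : a = 0 ∧ b = 0 ∧ c = 0 ∧ d = 0 := by
  have key : ∀ t : ℚ, a.eval t = 0 ∧ b.eval t = 0 ∧ c.eval t = 0 ∧ d.eval t = 0 := by
    intro t
    have h1 := congrArg (eval t) h
    simp only [eval_add, eval_pow, eval_zero] at h1
    refine ⟨?_, ?_, ?_, ?_⟩ <;> rw [← sq_eq_zero_iff] <;>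
    linarith [sq_nonneg (eval t a), sq_nonneg (eval t b), sq_nonneg (eval t c), sq_nonneg (eval t d)]
  refine ⟨?_, ?_, ?_, ?_⟩ <;> apply Polynomial.funext <;> intro t <;> rw [eval_zero]
  exacts [(key t).1, (key t).2.1, (key t).2.2.1, (key t).2.2.2]

lemma descent (g : ℚ[X]) (hg : Irreducible g) (hpos : ∀ t : ℚ, 0 < g.eval t) :
    ∀ (n : ℕ) (h : ℚ[X]), h.natDegree = n → h ≠ 0 → h.natDegree < g.natDegree → Sum4 (g * h) → Sum4 g := by
  intro n
  induction n using Nat.strong_induction_on with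
  | _ n ih =>
  intro h hn h0 hlt hs
  by_cases hn0 : n = 0
  · obtain ⟨c, rfl⟩ : ∃ c, h = C c := ⟨_, eq_C_of_natDegree_eq_zero (hn.trans hn0)⟩
    have hc0 : c ≠ 0 := by rintro rfl; simp at h0
    have hc : 0 ≤ c := by
      have := hs.eval_nonneg 0
      rw [eval_mul, eval_C] at this
      exact nonneg_of_mul_nonneg_right this (hpos 0)
    have := hs.mul (Sum4.const (inv_nonneg.2 hc))
    rwa [mul_assoc, ← C_mul, mul_inv_cancel₀ hc0, C_1, mul_one] at this
  obtain ⟨p₁, p₂, p₃, p₄, hp⟩ := hs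
  have hdeg : ∀ p : ℚ[X], (p % h) = 0 ∨ (p % h).natDegree < h.natDegree := by
    intro p
    right
    exact natDegree_mod_lt p (by omega)
  have hdm : ∀ p : ℚ[X], p = p % h + h * (p / h) := fun p => (EuclideanDomain.mod_add_div p h).symm
  have key : ∀ q₁ q₂ q₃ q₄ r₁ r₂ r₃ r₄ : ℚ[X], r₁.natDegree < h.natDegree → r₂.natDegree < h.natDegree → r₃.natDegree < h.natDegree →
      r₄.natDegree < h.natDegree → p₁ = r₁ + h * q₁ → p₂ = r₂ + h * q₂ → p₃ = r₃ + h * q₃ → p₄ = r₄ + h * q₄ → Sum4 g := by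
    intro q₁ q₂ q₃ q₄ r₁ r₂ r₃ r₄ d₁ d₂ d₃ d₄ e₁ e₂ e₃ e₄
    set k := g - (2 * (r₁ * q₁ + r₂ * q₂ + r₃ * q₃ + r₄ * q₄) + h * (q₁ ^ 2 + q₂ ^ 2 + q₃ ^ 2 + q₄ ^ 2)) with hk
    have hr : r₁ ^ 2 + r₂ ^ 2 + r₃ ^ 2 + r₄ ^ 2 = h * k := by
      rw [hk]
      rw [e₁, e₂, e₃, e₄] at hp
      linear_combination -hp
    by_cases hk0 : k = 0
    · exfalso
      rw [hk0, mul_zero] at hr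
      obtain ⟨z₁, z₂, z₃, z₄⟩ := four_sq_eq_zero hr
      have hdvd : h ∣ g := by
        refine ⟨q₁ ^ 2 + q₂ ^ 2 + q₃ ^ 2 + q₄ ^ 2, ?_⟩
        rw [hk, z₁, z₂, z₃, z₄] at hk0
        linear_combination hk0
      rcases hg.dvd_iff.1 hdvd with h1 | h1
      · exact hn0 (hn ▸ natDegree_eq_zero_of_isUnit h1)
      · rw [natDegree_eq_of_degree_eq (degree_eq_degree_of_associated h1)] at hlt
        exact lt_irrefl _ hlt
    · have hkd : k.natDegree < h.natDegree := by
        have h1 : (h * k).natDegree ≤ 2 * (h.natDegree - 1) := by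
          rw [← hr]
          refine natDegree_add_le_of_degree_le (natDegree_add_le_of_degree_le (natDegree_add_le_of_degree_le ?_ ?_) ?_) ?_ <;>
          refine natDegree_pow_le.trans (Nat.mul_le_mul_left _ ?_) <;> omega
        rw [natDegree_mul h0 hk0] at h1
        omega
      refine ih k.natDegree (by omega) k rfl hk0 (hkd.trans hlt) ?_
      refine ⟨g - (p₁ * q₁ + p₂ * q₂ + p₃ * q₃ + p₄ * q₄), p₂ * q₁ - p₁ * q₂ + p₄ * q₃ - p₃ * q₄,
        p₃ * q₁ - p₁ * q₃ + p₂ * q₄ - p₄ * q₂, p₄ * q₁ - p₁ * q₄ + p₃ * q₂ - p₂ * q₃, ?_⟩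
      apply mul_left_cancel₀ (pow_ne_zero 2 h0)
      have f₁ : r₁ = p₁ - h * q₁ := by rw [e₁]; ring
      have f₂ : r₂ = p₂ - h * q₂ := by rw [e₂]; ring
      have f₃ : r₃ = p₃ - h * q₃ := by rw [e₃]; ring
      have f₄ : r₄ = p₄ - h * q₄ := by rw [e₄]; ring
      have hk2 : k = g - 2 * (p₁ * q₁ + p₂ * q₂ + p₃ * q₃ + p₄ * q₄) + h * (q₁ ^ 2 + q₂ ^ 2 + q₃ ^ 2 + q₄ ^ 2) := by
        rw [hk, f₁, f₂, f₃, f₄]; ring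
      rw [hk2]
      linear_combination (h ^ 2 * (q₁ ^ 2 + q₂ ^ 2 + q₃ ^ 2 + q₄ ^ 2)) * hp
  exact key _ _ _ _ _ _ _ _ (natDegree_mod_lt p₁ (by omega)) (natDegree_mod_lt p₂ (by omega)) (natDegree_mod_lt p₃ (by omega))
    (natDegree_mod_lt p₄ (by omega)) (hdm p₁) (hdm p₂) (hdm p₃) (hdm p₄)

lemma sum4_of_neg_one (g : ℚ[X]) (hg : Irreducible g) (hpos : ∀ t : ℚ, 0 < g.eval t)
    (h : ∃ a b : AdjoinRoot g, -1 = a ^ 2 + b ^ 2) : Sum4 g := by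
  obtain ⟨a, b, hab⟩ := h
  obtain ⟨A, rfl⟩ := AdjoinRoot.mk_surjective a
  obtain ⟨B, rfl⟩ := AdjoinRoot.mk_surjective b
  have hgd : 0 < g.natDegree := hg.natDegree_pos
  have hA : AdjoinRoot.mk g (A % g) = AdjoinRoot.mk g A := by
    rw [AdjoinRoot.mk_eq_mk]; exact ⟨-(A / g), by linear_combination EuclideanDomain.mod_add_div A g⟩
  have hB : AdjoinRoot.mk g (B % g) = AdjoinRoot.mk g B := by
    rw [AdjoinRoot.mk_eq_mk]; exact ⟨-(B / g), by linear_combination EuclideanDomain.mod_add_div B g⟩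
  rw [← hA, ← hB] at hab
  have hdA := natDegree_mod_lt A hgd.ne'
  have hdB := natDegree_mod_lt B hgd.ne'
  have : g ∣ (A % g) ^ 2 + (B % g) ^ 2 + 1 := by
    rw [← AdjoinRoot.mk_eq_zero, map_add, map_add, map_pow, map_pow, ← hab, map_one]; ring
  obtain ⟨h, hh⟩ := this
  have h0 : h ≠ 0 := by
    rintro rfl
    rw [mul_zero] at hh
    have := (four_sq_eq_zero (a := A % g) (b := B % g) (c := 1) (d := 0) (by linear_combination hh)).2.2.1
    exact one_ne_zero this
  refine descent g hg hpos _ h rfl h0 ?_ ⟨A % g, B % g, 1, 0, by rw [← hh]; ring⟩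
  have h1 : (g * h).natDegree ≤ 2 * (g.natDegree - 1) := by
    rw [← hh]
    refine natDegree_add_le_of_degree_le (natDegree_add_le_of_degree_le ?_ ?_) (by simp)
    all_goals refine natDegree_pow_le.trans (Nat.mul_le_mul_left _ ?_); omega
  rw [natDegree_mul hg.ne_zero h0] at h1
  omega

lemma sign_const (q : ℚ[X]) (hq : ∀ t : ℝ, aeval t q ≠ 0) : (∀ t : ℝ, 0 < aeval t q) ∨ (∀ t : ℝ, aeval t q < 0) := by
  by_contra hcon
  push Not at hcon
  obtain ⟨⟨a, ha⟩, ⟨b, hb⟩⟩ := hcon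
  have hc : Continuous (fun t : ℝ => aeval t q) := by fun_prop
  obtain ⟨t, ht⟩ := mem_range_of_exists_le_of_exists_ge hc ⟨a, ha⟩ ⟨b, hb⟩
  exact hq t ht

lemma pos_rat {q : ℚ[X]} (hq : ∀ t : ℝ, 0 < aeval t q) (t : ℚ) : 0 < q.eval t := by
  have := hq (algebraMap ℚ ℝ t)
  rw [aeval_algebraMap_apply] at this
  simpa using this

lemma sum4_scaled {g : ℚ[X]} (H : ∀ q : ℚ[X], Irreducible q → (∀ t : ℝ, aeval t q ≠ 0) → q ∣ g → ∃ a b : AdjoinRoot q, -1 = a ^ 2 + b ^ 2) (p : ℚ[X]) :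
    p ≠ 0 → p ∣ g → (∀ t : ℝ, aeval t p ≠ 0) → ∃ (c : ℚ) (s : ℚ[X]), p = C c * s ∧ Sum4 s := by
  induction p using WfDvdMonoid.induction_on_irreducible with
  | zero => intro h; exact absurd rfl h
  | unit u hu =>
    intro _ _ _
    obtain ⟨c, hc⟩ : ∃ c, u = C c := ⟨_, eq_C_of_natDegree_eq_zero (natDegree_eq_zero_of_isUnit hu)⟩
    exact ⟨c, 1, by rw [mul_one, hc], 1, 0, 0, 0, by ring⟩
  | mul a q ha hq ih =>
    intro _ hd hr
    have hr1 : ∀ t : ℝ, aeval t q ≠ 0 := fun t h => hr t (by rw [map_mul, h, zero_mul])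
    have hr2 : ∀ t : ℝ, aeval t a ≠ 0 := fun t h => hr t (by rw [map_mul, h, mul_zero])
    obtain ⟨c, s, hs, hs4⟩ := ih ha ((Dvd.intro_left _ rfl).trans hd) hr2
    have hqd : q ∣ g := (Dvd.intro _ rfl).trans hd
    rcases sign_const q hr1 with h | h
    · exact ⟨c, q * s, by rw [hs]; ring, (sum4_of_neg_one q hq (pos_rat h) (H q hq hr1 hqd)).mul hs4⟩
    · have hq' : Irreducible (-q) := (Associated.neg_left (Associated.refl q)).irreducible_iff.2 hq
      have := sum4_of_neg_one (-q) hq' (pos_rat (fun t => by rw [map_neg]; linarith [h t]))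
        (H (-q) hq' (fun t => by rw [map_neg]; exact neg_ne_zero.2 (hr1 t)) ((neg_dvd).2 hqd))
      exact ⟨-c, (-q) * s, by rw [hs, C_neg]; ring, this.mul hs4⟩

lemma sum4_of_factors (g : ℚ[X]) (hpos : ∀ t : ℝ, 0 < aeval t g)
    (H : ∀ q : ℚ[X], Irreducible q → (∀ t : ℝ, aeval t q ≠ 0) → q ∣ g → ∃ a b : AdjoinRoot q, -1 = a ^ 2 + b ^ 2) : Sum4 g := by
  have hg0 : g ≠ 0 := by rintro rfl; simpa using hpos 0
  obtain ⟨c, s, hs, hs4⟩ := sum4_scaled H g hg0 dvd_rfl (fun t => (hpos t).ne')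
  have h1 := pos_rat hpos 0
  rw [hs, eval_mul, eval_C] at h1
  have h2 : 0 ≤ c := by
    by_contra h
    have := mul_nonpos_of_nonpos_of_nonneg (not_le.1 h).le (hs4.eval_nonneg 0)
    linarith
  rw [hs]
  exact (Sum4.const h2).mul hs4

end FiveSq

end

section
open Module NumberField IsDedekindDomain

namespace FiveSq

open Polynomial

section
variable {K : Type*} [Field K] [NumberField K]

lemma val_nat (v : Pl K) (h : (2 : 𝓞 K) ∈ v.asIdeal) (n : ℕ) (hn : n ≠ 0) :
    v.valuation K (n : K) = v.valuation K 2 ^ (padicValNat 2 n) := by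
  obtain ⟨k, m, hm, rfl⟩ := Nat.exists_eq_two_pow_mul_odd hn
  have hm1 : v.valuation K (m : K) = 1 := by
    apply le_antisymm
    · have := v.valuation_le_one (K := K) (m : 𝓞 K)
      simpa using this
    · by_contra hlt
      have h1 : v.valuation K (algebraMap (𝓞 K) K (m : 𝓞 K)) < 1 := by rw [map_natCast]; exact not_le.1 hlt
      have h2 : (m : 𝓞 K) ∈ v.asIdeal := (v.valuation_lt_one_iff_mem _).1 h1
      obtain ⟨j, rfl⟩ := hm
      apply v.isPrime.one_notMem
      have := v.asIdeal.sub_mem h2 (v.asIdeal.mul_mem_right (j : 𝓞 K) h)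
      push_cast at this
      simpa using this
  have hm0 : m ≠ 0 := by rintro rfl; simp at hm
  have hp : padicValNat 2 (2 ^ k * m) = k := by
    rw [padicValNat.mul (pow_ne_zero _ two_ne_zero) hm0, padicValNat.prime_pow,
      padicValNat.eq_zero_of_not_dvd (by rw [← even_iff_two_dvd, Nat.not_even_iff_odd]; exact hm), add_zero]
  rw [hp]; push_cast
  rw [map_mul, map_pow, hm1, mul_one]

lemma val_rat (v : Pl K) (h : (2 : 𝓞 K) ∈ v.asIdeal) (a : ℚ) (ha : a ≠ 0) :
    v.valuation K (algebraMap ℚ K a) = v.valuation K 2 ^ (padicValRat 2 a) := by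
  have hα : v.valuation K 2 ≠ 0 := val_ne_zero v two_ne_zero
  rw [eq_ratCast, Rat.cast_def, map_div₀, val_nat v h _ a.den_ne_zero, padicValRat_def, zpow_sub₀ hα, zpow_natCast, zpow_natCast]
  congr 1
  have hn : a.num ≠ 0 := Rat.num_ne_zero.2 ha
  rw [padicValInt, ← val_nat v h _ (Int.natAbs_ne_zero.2 hn)]
  rcases Int.natAbs_eq a.num with h1 | h1
  · conv_lhs => rw [h1]
    rw [Int.cast_natCast]
  · conv_lhs => rw [h1]
    rw [Int.cast_neg, Int.cast_natCast, Valuation.map_neg]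

lemma dominate (v : Pl K) (f : ℚ[X]) (hf : f ≠ 0) (θ : K) (B : WithZero (Multiplicative ℤ)) (hB : 1 ≤ B)
    (h1 : ∀ i, v.valuation K (algebraMap ℚ K (f.coeff i)) ≤ B)
    (h2 : ∀ i, v.valuation K (algebraMap ℚ K (f.coeff i)) ≤ B * v.valuation K (algebraMap ℚ K f.leadingCoeff))
    (h3 : B * B ^ f.natDegree < v.valuation K (aeval θ f)) :
    v.valuation K (algebraMap ℚ K f.leadingCoeff) * v.valuation K θ ^ f.natDegree = v.valuation K (aeval θ f) := by
  have hl0 : v.valuation K (algebraMap ℚ K f.leadingCoeff) ≠ 0 :=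
    val_ne_zero v (by rw [Ne, map_eq_zero]; exact leadingCoeff_ne_zero.2 hf)
  have hx : B < v.valuation K θ := by
    by_contra hx
    push Not at hx
    apply absurd h3 (not_lt.2 _)
    rw [aeval_eq_sum_range]
    apply Valuation.map_sum_le
    intro i hi
    rw [Algebra.smul_def, map_mul, map_pow]
    refine mul_le_mul' (h1 i) ?_
    exact (pow_le_pow_left' hx i).trans (pow_le_pow_right' hB (by have := Finset.mem_range.1 hi; omega))
  have hx1 : 1 < v.valuation K θ := hB.trans_lt hx
  rw [aeval_eq_sum_range, Finset.sum_range_succ, Algebra.smul_def (f.coeff f.natDegree)]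
  rw [Valuation.map_add_eq_of_lt_right]
  · rw [map_mul, map_pow]; rfl
  rw [map_mul, map_pow, coeff_natDegree]
  apply Valuation.map_sum_lt
  · exact mul_ne_zero hl0 (pow_ne_zero _ (zero_lt_one.trans hx1).ne')
  intro i hi
  rw [Algebra.smul_def, map_mul, map_pow]
  have hi' := Finset.mem_range.1 hi
  obtain ⟨j, hj⟩ : ∃ j, f.natDegree = i + (j + 1) := ⟨f.natDegree - i - 1, by omega⟩
  rw [hj, pow_add]
  calc v.valuation K (algebraMap ℚ K (f.coeff i)) * v.valuation K θ ^ i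
      ≤ (B * v.valuation K (algebraMap ℚ K f.leadingCoeff)) * v.valuation K θ ^ i := mul_le_mul_left (h2 i) _
    _ < (v.valuation K θ * v.valuation K (algebraMap ℚ K f.leadingCoeff)) * v.valuation K θ ^ i := by
      refine mul_lt_mul_of_pos_right (mul_lt_mul_of_pos_right hx (zero_lt_iff.2 hl0)) ?_
      exact zero_lt_iff.2 (pow_ne_zero _ (zero_lt_one.trans hx1).ne')
    _ = v.valuation K (algebraMap ℚ K f.leadingCoeff) * (v.valuation K θ ^ i * v.valuation K θ ^ 1) := by rw [pow_one]; ac_rfl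
    _ ≤ _ := by
      refine mul_le_mul_right (mul_le_mul_right (pow_le_pow_right' hx1.le (by omega)) _) _

end

/-- the 2-adic threshold depending only on `f` -/
lemma exists_threshold (f : ℚ[X]) : ∃ N : ℕ, ∀ i, f.coeff i ≠ 0 → -(N : ℤ) ≤ padicValRat 2 (f.coeff i) ∧
    -(N : ℤ) + padicValRat 2 f.leadingCoeff ≤ padicValRat 2 (f.coeff i) := by
  refine ⟨∑ i ∈ f.support, ((padicValRat 2 (f.coeff i)).natAbs + (padicValRat 2 (f.coeff i) - padicValRat 2 f.leadingCoeff).natAbs), fun i hi => ?_⟩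
  have h1 := Finset.single_le_sum (f := fun i => ((padicValRat 2 (f.coeff i)).natAbs + (padicValRat 2 (f.coeff i) - padicValRat 2 f.leadingCoeff).natAbs))
    (fun i _ => Nat.zero_le _) (mem_support_iff.2 hi)
  have h2 : ((padicValRat 2 (f.coeff i)).natAbs + (padicValRat 2 (f.coeff i) - padicValRat 2 f.leadingCoeff).natAbs) ≤ 
    ∑ i ∈ f.support, ((padicValRat 2 (f.coeff i)).natAbs + (padicValRat 2 (f.coeff i) - padicValRat 2 f.leadingCoeff).natAbs) := h1
  omega

lemma exists_T {K : Type*} [Field K] [NumberField K] (f : ℚ[X]) (m : ℕ) (hdeg : f.natDegree = 4 * m) (hf : f ≠ 0) (N : ℕ)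
    (hN : ∀ i, f.coeff i ≠ 0 → -(N : ℤ) ≤ padicValRat 2 (f.coeff i) ∧ -(N : ℤ) + padicValRat 2 f.leadingCoeff ≤ padicValRat 2 (f.coeff i))
    (ℓ : ℕ) (hℓ : N * (4 * m + 1) < 2 * ℓ)
    (hpar : ¬ (4 : ℤ) ∣ padicValRat 2 f.leadingCoeff + 2 * ℓ)
    (θ : K) (hθ : aeval θ f = algebraMap ℚ K (1 / 2 ^ (2 * ℓ))) :
    ∃ T : K, ∀ v : Pl K, (2 : 𝓞 K) ∈ v.asIdeal → v.valuation K (T ^ 2 / 2) = 1 := by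
  set lam := padicValRat 2 f.leadingCoeff with hlam
  have key : ∀ v : Pl K, (2 : 𝓞 K) ∈ v.asIdeal → v.valuation K θ ^ (4 * m) = v.valuation K 2 ^ (-(lam + 2 * ℓ)) := by
    intro v hv
    have hα : v.valuation K 2 ≠ 0 := val_ne_zero v two_ne_zero
    have hα1 := val_two_lt v hv
    have hfθ : v.valuation K (aeval θ f) = v.valuation K 2 ^ (-(2 * ℓ : ℤ)) := by
      rw [hθ, map_div₀, map_one, map_pow, map_ofNat, map_div₀, map_one, map_pow, zpow_neg, one_div]
      norm_cast
    have hle : ∀ a b : ℤ, b ≤ a → v.valuation K 2 ^ a ≤ v.valuation K 2 ^ b := fun a b hab =>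
      zpow_le_zpow_right_of_le_one₀ (zero_lt_iff.2 hα) hα1.le hab
    have hlt : ∀ a b : ℤ, b < a → v.valuation K 2 ^ a < v.valuation K 2 ^ b := fun a b hab =>
      zpow_lt_zpow_right_of_lt_one₀ (zero_lt_iff.2 hα) hα1 hab
    have h := dominate v f hf θ (v.valuation K 2 ^ (-(N : ℤ))) (by simpa using hle 0 (-N) (by omega)) ?_ ?_ ?_
    · rw [hfθ, val_rat v hv _ (leadingCoeff_ne_zero.2 hf), hdeg, ← hlam] at h
      rw [neg_add, zpow_add₀ hα, ← h, ← mul_assoc, zpow_neg, inv_mul_cancel₀ (zpow_ne_zero _ hα), one_mul]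
    · intro i
      by_cases hi : f.coeff i = 0
      · rw [hi]; simp
      · rw [val_rat v hv _ hi]; exact hle _ _ (hN i hi).1
    · intro i
      by_cases hi : f.coeff i = 0
      · rw [hi]; simp
      · rw [val_rat v hv _ hi, val_rat v hv _ (leadingCoeff_ne_zero.2 hf), ← zpow_add₀ hα]; exact hle _ _ (hN i hi).2
    · rw [hfθ, hdeg, ← zpow_natCast, ← zpow_mul, ← zpow_add₀ hα]
      apply hlt
      push_cast
      have : ((N * (4 * m + 1) : ℕ) : ℤ) < 2 * ℓ := by exact_mod_cast hℓ
      push_cast at this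
      linarith
  rcases Int.even_or_odd' (lam + 2 * ℓ) with ⟨k, hk | hk⟩
  · obtain ⟨j, hj⟩ : ∃ j, k = 2 * j + 1 := by
      rcases Int.even_or_odd' k with ⟨j, hj | hj⟩
      · exact absurd ⟨j, by rw [hk, hj]; ring⟩ hpar
      · exact ⟨j, hj⟩
    refine ⟨θ ^ m * 2 ^ (j + 1), fun v hv => ?_⟩
    have hα : v.valuation K 2 ≠ 0 := val_ne_zero v two_ne_zero
    have h1 : v.valuation K θ ^ (2 * m) = v.valuation K 2 ^ (-k) := by
      have h2 := key v hv
      rw [hk, show 4 * m = (2 * m) * 2 by ring, pow_mul, show -(2 * k) = (-k) * (2 : ℕ) by push_cast; ring, zpow_mul, zpow_natCast] at h2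
      exact (pow_left_inj₀ zero_le' zero_le' two_ne_zero).1 h2
    rw [map_div₀, map_pow, map_mul, map_pow, map_zpow₀, mul_pow, ← pow_mul, mul_comm m 2, h1, ← zpow_natCast, ← zpow_mul, ← zpow_add₀ hα,
      div_eq_one_iff_eq hα]
    conv_rhs => rw [← zpow_one (v.valuation K 2)]
    congr 1
    push_cast; rw [hj]; ring
  · refine ⟨θ ^ (2 * m) * 2 ^ (k + 1), fun v hv => ?_⟩
    have hα : v.valuation K 2 ≠ 0 := val_ne_zero v two_ne_zero
    have h1 := key v hv
    rw [map_div₀, map_pow, map_mul, map_pow, map_zpow₀, mul_pow, ← pow_mul, show 2 * m * 2 = 4 * m by ring, h1, ← zpow_natCast, ← zpow_mul, ← zpow_add₀ hα,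
      div_eq_one_iff_eq hα]
    conv_rhs => rw [← zpow_one (v.valuation K 2)]
    congr 1
    push_cast; rw [hk]; ring

lemma totallyComplex {K : Type*} [Field K] [NumberField K] (q : ℚ[X]) (hq : ∀ t : ℝ, aeval t q ≠ 0) (θ : K) (hθ : aeval θ q = 0) : IsTotallyComplex K := by
  refine ⟨fun v => ?_⟩
  rw [← InfinitePlace.not_isReal_iff_isComplex]
  rintro ⟨φ, hφ, -⟩
  let ψ : K →ₐ[ℚ] ℝ := (ComplexEmbedding.IsReal.embedding hφ).toRatAlgHom
  apply hq (ψ θ)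
  rw [aeval_algHom_apply, hθ, map_zero]

lemma exists_pos_bound (f : ℚ[X]) (hd : 0 < f.natDegree) (hpos : ∀ t : ℝ, 0 < aeval t f) : ∃ ε : ℝ, 0 < ε ∧ ∀ t : ℝ, ε ≤ aeval t f := by
  have hc : Continuous (fun t : ℝ => aeval t f) := by fun_prop
  have ht : Filter.Tendsto (fun t : ℝ => aeval t f) (Filter.cocompact ℝ) Filter.atTop := by
    have h1 := Polynomial.tendsto_norm_atTop (f.map (algebraMap ℚ ℝ)) (by rw [degree_map]; exact natDegree_pos_iff_degree_pos.1 hd)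
      (tendsto_norm_cocompact_atTop (E := ℝ))
    refine h1.congr (fun t => ?_)
    rw [eval_map_algebraMap, Real.norm_eq_abs, abs_of_pos (hpos t)]
  obtain ⟨t₀, h⟩ := hc.exists_forall_le ht
  exact ⟨_, hpos t₀, h⟩

lemma main_aux (f : ℚ[X]) (m : ℕ) (hm : 0 < m) (hdeg : f.natDegree = 4 * m) (hpos : ∀ t : ℝ, 0 < aeval t f) :
    ∃ ℓ : ℕ, Sum4 (f - C ((1 : ℚ) / 2 ^ (2 * ℓ))) := by
  have hf : f ≠ 0 := by rintro rfl; simpa using hpos 0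
  obtain ⟨N, hN⟩ := exists_threshold f
  obtain ⟨ε, hε, hb⟩ := exists_pos_bound f (by omega) hpos
  obtain ⟨k, hk⟩ := exists_pow_lt_of_lt_one hε (show (1 / 2 : ℝ) < 1 by norm_num)
  obtain ⟨ℓ, h1, h2, h3⟩ : ∃ ℓ : ℕ, N * (4 * m + 1) < 2 * ℓ ∧ k ≤ 2 * ℓ ∧ ¬ (4 : ℤ) ∣ padicValRat 2 f.leadingCoeff + 2 * ℓ := by
    generalize padicValRat 2 f.leadingCoeff = lam
    by_cases h : (4 : ℤ) ∣ lam + 2 * ((N * (4 * m + 1) + k + 1 : ℕ) : ℤ)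
    · refine ⟨N * (4 * m + 1) + k + 2, ?_, ?_, ?_⟩ <;> generalize N * (4 * m + 1) = z at * <;> push_cast at * <;> omega
    · refine ⟨N * (4 * m + 1) + k + 1, ?_, ?_, h⟩ <;> generalize N * (4 * m + 1) = z at * <;> omega
  refine ⟨ℓ, sum4_of_factors _ ?_ ?_⟩
  · intro t
    rw [map_sub, aeval_C]
    have h4 : algebraMap ℚ ℝ (1 / 2 ^ (2 * ℓ)) = (1 / 2 : ℝ) ^ (2 * ℓ) := by simp
    rw [h4]
    have h5 : (1 / 2 : ℝ) ^ (2 * ℓ) ≤ (1 / 2 : ℝ) ^ k := pow_le_pow_of_le_one (by norm_num) (by norm_num) h2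
    linarith [hb t]
  · intro q hq hr hqd
    haveI : Fact (Irreducible q) := ⟨hq⟩
    haveI hc : CharZero (AdjoinRoot q) := charZero_of_injective_algebraMap (algebraMap ℚ (AdjoinRoot q)).injective
    have hfin : FiniteDimensional ℚ (AdjoinRoot q) := (AdjoinRoot.powerBasis hq.ne_zero).finite
    haveI : NumberField (AdjoinRoot q) := @NumberField.mk _ _ hc (by convert hfin)
    have hroot' : @aeval ℚ (AdjoinRoot q) _ _ DivisionRing.toRatAlgebra (AdjoinRoot.root q) q = 0 := by
      rw [aeval_def, ← AdjoinRoot.eval₂_root q]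
      exact congrArg (fun φ => eval₂ φ (AdjoinRoot.root q) q) (RingHom.ext_rat _ _)
    haveI : IsTotallyComplex (AdjoinRoot q) := totallyComplex q hr (AdjoinRoot.root q) hroot'
    have hθ : @aeval ℚ (AdjoinRoot q) _ _ DivisionRing.toRatAlgebra (AdjoinRoot.root q) f =
        @algebraMap ℚ (AdjoinRoot q) _ _ DivisionRing.toRatAlgebra (1 / 2 ^ (2 * ℓ)) := by
      have h6 := aeval_eq_zero_of_dvd_aeval_eq_zero hqd hroot'
      rw [map_sub, aeval_C, sub_eq_zero] at h6
      exact h6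
    obtain ⟨T, hT⟩ := exists_T f m hdeg hf N hN ℓ h1 h3 (AdjoinRoot.root q) hθ
    exact core T hT

end FiveSq

end

open Polynomial

theorem deg_multiple_of_four_sum_of_five_squares
    (f : Polynomial ℚ) (hsf : Squarefree f)
    (m : ℕ) (hm : 0 < m) (hdeg : f.natDegree = 4 * m)
    (hpos : ∀ t : ℝ, 0 < Polynomial.aeval t f) :
    ((∃ p₁ p₂ p₃ p₄ : Polynomial ℚ, f = p₁ ^ 2 + p₂ ^ 2 + p₃ ^ 2 + p₄ ^ 2) ∨
      (∃ ℓ : ℕ, ∃ p₁ p₂ p₃ p₄ : Polynomial ℚ,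
        f - C ((1 : ℚ) / 2 ^ (2 * ℓ)) = p₁ ^ 2 + p₂ ^ 2 + p₃ ^ 2 + p₄ ^ 2)) ∧
    ∃ f₁ f₂ f₃ f₄ f₅ : Polynomial ℚ,
      f = f₁ ^ 2 + f₂ ^ 2 + f₃ ^ 2 + f₄ ^ 2 + f₅ ^ 2 := by
  obtain ⟨ℓ, a, b, c, d, h⟩ := FiveSq.main_aux f m hm hdeg hpos
  refine ⟨Or.inr ⟨ℓ, a, b, c, d, h⟩, a, b, c, d, C ((1 : ℚ) / 2 ^ ℓ), ?_⟩
  have e : (C ((1 : ℚ) / 2 ^ ℓ)) ^ 2 = C ((1 : ℚ) / 2 ^ (2 * ℓ)) := by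
    rw [← C_pow]
    congr 1
    rw [div_pow, one_pow, ← pow_mul, mul_comm ℓ 2]
  rw [e, ← h]
  ring
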